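/- Thomas' theorem on torsion-free abelian groups of finite rank: for every n ≥ 1, the isomorphism relation ≅ₙ is Borel reducible to ≅ₙ₊₁, but ≅ₙ₊₁ is not Borel reducible to ≅ₙ. Here, for each n ≥ 1, Gₙ = {χ : (Fin n → ℚ) → Bool | {v : χ v = true} is an additive subgroup of ℚⁿ containing n linearly independent vectors} is a Borel subset of the Polish space (Fin n → ℚ) → Bool, and ≅ₙ is the relation on Gₙ: χ ≅ₙ χ' iff the coded subgroups of ℚⁿ are isomorphic as additive groups. So there exists a Borel measurable φ : Gₙ → Gₙ₊₁ with χ ≅ₙ χ' ↔ φ χ ≅ₙ₊₁ φ χ' for all χ, χ' ∈ Gₙ, but there is no Borel measurable ψ : Gₙ₊₁ → Gₙ with χ ≅ₙ₊₁ χ' ↔ ψ χ ≅ₙ ψ χ' for all χ, χ' ∈ Gₙ₊₁. -/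

import Mathlib

/-- `χ : (Fin n → ℚ) → Bool` codes the additive subgroup `H` of `ℚⁿ`. -/
def CodesSubgroupN (n : ℕ) (χ : (Fin n → ℚ) → Bool) (H : AddSubgroup (Fin n → ℚ)) : Prop :=
  ∀ v : Fin n → ℚ, χ v = true ↔ v ∈ H

/-- The codes of additive subgroups of `ℚⁿ` containing `n` linearly independent vectors
(torsion-free abelian groups of rank `n`), a Borel subset of the Polish space
`(Fin n → ℚ) → Bool`. -/
def GN (n : ℕ) : Set ((Fin n → ℚ) → Bool) :=
  {χ | ∃ H : AddSubgroup (Fin n → ℚ), CodesSubgroupN n χ H ∧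
    ∃ b : Fin n → (Fin n → ℚ), (∀ i, b i ∈ H) ∧ LinearIndependent ℚ b}

/-- Isomorphism of the coded subgroups of `ℚⁿ` as additive groups. -/
def IsoN (n : ℕ) (χ χ' : (Fin n → ℚ) → Bool) : Prop :=
  ∃ H H' : AddSubgroup (Fin n → ℚ), CodesSubgroupN n χ H ∧ CodesSubgroupN n χ' H' ∧
    Nonempty (H ≃+ H')

set_option linter.unusedSectionVars false

section NilpotentBrackets

open Module LieModule

/-- The right-nested bracket `⁅h k, ⁅h (k-1), … ⁅h 1, h 0⁆⁆⁆`. -/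
def nestedBracket {L : Type*} [LieRing L] (h : ℕ → L) : ℕ → L
  | 0 => h 0
  | k + 1 => ⁅h (k + 1), nestedBracket h k⁆

theorem lowerCentralSeries_finrank_eq_bot (K L M : Type*) [Field K] [LieRing L] [LieAlgebra K L]
    [AddCommGroup M] [Module K M] [LieRingModule L M] [LieModule K L M] [FiniteDimensional K M]
    [LieModule.IsNilpotent L M] {k : ℕ} (hk : finrank K M ≤ k) :
    lowerCentralSeries K L M k = ⊥ := by
  have key : ∀ k, lowerCentralSeries K L M k = ⊥ ∨
      finrank K (lowerCentralSeries K L M k) + k ≤ finrank K M := by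
    intro k
    induction k with
    | zero =>
      right
      rw [add_zero]
      exact Submodule.finrank_le (lowerCentralSeries K L M 0).toSubmodule
    | succ k ih =>
      rcases ih with ih | ih
      · left
        exact eq_bot_iff.2 ((antitone_lowerCentralSeries K L M (Nat.le_succ k)).trans ih.le)
      have hle : lowerCentralSeries K L M (k + 1) ≤ lowerCentralSeries K L M k :=
        antitone_lowerCentralSeries K L M (Nat.le_succ k)
      by_cases heq : lowerCentralSeries K L M (k + 1) = lowerCentralSeries K L M k
      · left
        obtain ⟨N, hN⟩ := LieModule.IsNilpotent.nilpotent K L M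
        have hconst : ∀ j, lowerCentralSeries K L M (k + j) = lowerCentralSeries K L M k := by
          intro j
          induction j with
          | zero => rfl
          | succ j ihj =>
            rw [← add_assoc, LieModule.lowerCentralSeries_succ, ihj,
              ← LieModule.lowerCentralSeries_succ, heq]
        rw [heq, ← hconst N, eq_bot_iff, ← hN]
        exact antitone_lowerCentralSeries K L M (Nat.le_add_left _ _)
      · right
        have hlt : (lowerCentralSeries K L M (k + 1)).toSubmodule <
            (lowerCentralSeries K L M k).toSubmodule := by
          refine lt_of_le_of_ne hle fun h => heq ?_
          exact (LieSubmodule.toSubmodule_inj _ _).1 h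
        have := Submodule.finrank_lt_finrank_of_lt hlt
        change finrank K (lowerCentralSeries K L M (k + 1)).toSubmodule + (k + 1) ≤ _
        change finrank K (lowerCentralSeries K L M k).toSubmodule + k ≤ _ at ih
        omega
  rcases key k with h | h
  · exact h
  · have h0 : finrank K (lowerCentralSeries K L M k).toSubmodule = 0 := by
      change finrank K (lowerCentralSeries K L M k).toSubmodule + k ≤ _ at h
      omega
    rw [← LieSubmodule.toSubmodule_inj]
    simpa using Submodule.finrank_eq_zero.1 h0

theorem nestedBracket_lie_mem_lowerCentralSeries (K L M : Type*) [Field K] [LieRing L]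
    [LieAlgebra K L] [AddCommGroup M] [Module K M] [LieRingModule L M] [LieModule K L M]
    (h : ℕ → L) (k j : ℕ) (m : M) (hm : m ∈ lowerCentralSeries K L M j) :
    ⁅nestedBracket h k, m⁆ ∈ lowerCentralSeries K L M (j + k + 1) := by
  have step : ∀ (x : L) (i : ℕ) (m : M), m ∈ lowerCentralSeries K L M i →
      ⁅x, m⁆ ∈ lowerCentralSeries K L M (i + 1) := fun x i m hm => by
    rw [LieModule.lowerCentralSeries_succ]
    exact LieSubmodule.lie_mem_lie (LieSubmodule.mem_top x) hm
  induction k generalizing j m with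
  | zero => exact step _ _ _ hm
  | succ k ih =>
    rw [nestedBracket, lie_lie]
    refine sub_mem ?_ ?_
    · exact step _ _ _ (ih j m hm)
    · have := ih (j + 1) _ (step (h (k + 1)) j m hm)
      rwa [show j + 1 + k + 1 = j + (k + 1) + 1 by omega] at this

theorem nestedBracket_lie_eq_zero (K H M : Type*) [Field K] [IsAlgClosed K] [CharZero K]
    [LieRing H] [LieAlgebra K H] [LieRing.IsNilpotent H] [AddCommGroup M] [Module K M]
    [LieRingModule H M] [LieModule K H M] [FiniteDimensional K M] (h : ℕ → H) {k : ℕ}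
    (hk : 1 ≤ k) (hM : finrank K M ≤ k + 1) (m : M) : ⁅nestedBracket h k, m⁆ = 0 := by
  have htop : (⨆ χ : Weight K H M, (genWeightSpace M χ).toSubmodule) = ⊤ := by
    rw [← LieSubmodule.iSup_toSubmodule, iSup_genWeightSpace_eq_top' K H M]; rfl
  have hm : m ∈ (⨆ χ : Weight K H M, (genWeightSpace M χ).toSubmodule) := htop ▸ Submodule.mem_top
  suffices hle : (⨆ χ : Weight K H M, (genWeightSpace M χ).toSubmodule) ≤
      LinearMap.ker (toEnd K H M (nestedBracket h k)) by
    simpa using hle hm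
  refine iSup_le fun χ v hv => ?_
  obtain ⟨i, rfl⟩ : ∃ i, k = i + 1 := ⟨k - 1, by omega⟩
  have hbot : lowerCentralSeries K H (shiftedGenWeightSpace K H M χ) (i + 1 + 1) = ⊥ := by
    have : FiniteDimensional K (shiftedGenWeightSpace K H M χ) :=
      inferInstanceAs (FiniteDimensional K (genWeightSpace M χ))
    refine lowerCentralSeries_finrank_eq_bot K H _ (le_trans ?_ hM)
    exact Submodule.finrank_le (genWeightSpace M χ).toSubmodule
  let u : shiftedGenWeightSpace K H M χ := (⟨v, hv⟩ : genWeightSpace M χ)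
  have hmem := nestedBracket_lie_mem_lowerCentralSeries K H (shiftedGenWeightSpace K H M χ)
    h (i + 1) 0 u (LieSubmodule.mem_top u)
  rw [zero_add, hbot, LieSubmodule.mem_bot] at hmem
  have hval : ((⁅nestedBracket h (i + 1), u⁆ : shiftedGenWeightSpace K H M χ) : M) =
    ⁅nestedBracket h (i + 1), v⁆ - χ (nestedBracket h (i + 1)) • v := rfl
  have hz : χ (nestedBracket h (i + 1)) = 0 := Weight.apply_lie _ _
  rw [hmem, hz, zero_smul, sub_zero] at hval
  simpa using hval.symm

/-- If `L ⁄ S` is a nilpotent quotient of a Lie algebra of operators on a space of dimension at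
most `k + 1`, then the `(k + 1)`-fold brackets of `L` lie in `S`. -/
theorem nestedBracket_mem_of_ad_pow_mem (K L M : Type*) [Field K] [IsAlgClosed K] [CharZero K]
    [LieRing L] [LieAlgebra K L] [FiniteDimensional K L] [AddCommGroup M] [Module K M]
    [LieRingModule L M] [LieModule K L M] [FiniteDimensional K M]
    (hfaith : ∀ x : L, (∀ m : M, ⁅x, m⁆ = 0) → x = 0) (S : LieIdeal K L) (N : ℕ)
    (hN : ∀ x y : L, (LieAlgebra.ad K L x ^ N) y ∈ S) (h : ℕ → L) {k : ℕ}
    (hk : 1 ≤ k) (hM : finrank K M ≤ k + 1) : nestedBracket h k ∈ S := by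
  obtain ⟨x, hx⟩ := LieAlgebra.exists_isCartanSubalgebra_engel K L
  have hH : LieRing.IsNilpotent (LieSubalgebra.engel K x) := hx.nilpotent
  have hdec : ∀ y : L, ∃ z : LieSubalgebra.engel K x, y - (z : L) ∈ S := by
    intro y
    have hc := (LinearMap.isCompl_iSup_ker_pow_iInf_range_pow (LieAlgebra.ad K L x)).sup_eq_top
    have hy : y ∈ (⊤ : Submodule K L) := Submodule.mem_top
    rw [← hc] at hy
    obtain ⟨z, hz, w, hw, rfl⟩ := Submodule.mem_sup.1 hy
    refine ⟨⟨z, ?_⟩, ?_⟩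
    · rw [LieSubalgebra.mem_engel_iff]
      rw [Submodule.mem_iSup_of_directed] at hz
      · obtain ⟨i, hi⟩ := hz
        exact ⟨i, hi⟩
      · exact Monotone.directed_le (LinearMap.iterateKer _).monotone
    · rw [add_sub_cancel_left]
      obtain ⟨v, rfl⟩ := (Submodule.mem_iInf _).1 hw N
      exact hN x v
  choose z hz using fun i => hdec (h i)
  have hcongr : ∀ j, nestedBracket h j - ((nestedBracket z j : LieSubalgebra.engel K x) : L) ∈ S := by
    intro j
    induction j with
    | zero => exact hz 0
    | succ j ih =>
      have : nestedBracket h (j + 1) -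
          ((nestedBracket z (j + 1) : LieSubalgebra.engel K x) : L) =
          ⁅h (j + 1) - z (j + 1), nestedBracket h j⁆ +
          ⁅(z (j + 1) : L), nestedBracket h j - (nestedBracket z j : LieSubalgebra.engel K x)⁆ := by
        simp only [nestedBracket, LieSubalgebra.coe_bracket, sub_lie, lie_sub]
        abel
      rw [this]
      exact add_mem (lie_mem_left K L S _ _ (hz _)) (lie_mem_right K L S _ _ ih)
  have hzero : ((nestedBracket z k : LieSubalgebra.engel K x) : L) = 0 :=
    hfaith _ fun m => nestedBracket_lie_eq_zero K (LieSubalgebra.engel K x) M z hk hM m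
  simpa [hzero] using hcongr k

end NilpotentBrackets

section UnipotentMatrices

open Module LieModule

attribute [local instance] LieRing.ofAssociativeRing

/-- Operators on an `n`-dimensional space that satisfy, modulo a Lie-stable subspace `S`, the
relations of the strictly upper triangular elementary `(n + 1) × (n + 1)` matrices: the corner
element lies in `S`. -/
theorem corner_mem_of_triangular_relations {K V : Type*} [Field K] [IsAlgClosed K] [CharZero K]
    [AddCommGroup V] [Module K V] [FiniteDimensional K V] {n : ℕ} (hn : 2 ≤ n)
    (hV : finrank K V ≤ n) (S : Submodule K (Module.End K V)) (X : ℕ → ℕ → Module.End K V) (c : K)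
    (hc : c ≠ 0) (hSS : ∀ s ∈ S, ∀ t ∈ S, s * t - t * s ∈ S)
    (hXS : ∀ i j, i < j → j ≤ n → ∀ s ∈ S, X i j * s - s * X i j ∈ S)
    (hX : ∀ i j l, i < j → j < l → l ≤ n →
      X i j * X j l - X j l * X i j - c • X i l ∈ S)
    (hX' : ∀ i j k l, i < j → j ≤ n → k < l → l ≤ n → j ≠ k → l ≠ i →
      X i j * X k l - X k l * X i j ∈ S) : X 0 n ∈ S := by
  let G : ℕ → Set (Module.End K V) := fun d =>
    (S : Set (Module.End K V)) ∪ {y | ∃ i j, i < j ∧ j ≤ n ∧ i + d ≤ j ∧ y = X i j}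
  let F : ℕ → Submodule K (Module.End K V) := fun d => Submodule.span K (G d)
  have hSF : ∀ d, S ≤ F d := fun d s hs => Submodule.subset_span (Or.inl hs)
  have hXF : ∀ d i j, i < j → j ≤ n → i + d ≤ j → X i j ∈ F d := fun d i j h1 h2 h3 =>
    Submodule.subset_span (Or.inr ⟨i, j, h1, h2, h3, rfl⟩)
  have hbr : ∀ d e, ∀ x ∈ F d, ∀ y ∈ F e, ⁅x, y⁆ ∈ F (d + e) := by
    intro d e x hx y hy
    induction hx, hy using Submodule.span_induction₂ with
    | mem_mem x y hx hy =>
      rw [Ring.lie_def]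
      rcases hx with hx | ⟨i, j, hij, hj, hd, rfl⟩
      · rcases hy with hy | ⟨k, l, hkl, hl, he, rfl⟩
        · exact hSF _ (hSS x hx y hy)
        · have := neg_mem (hXS k l hkl hl x hx)
          rw [neg_sub] at this
          exact hSF _ this
      · rcases hy with hy | ⟨k, l, hkl, hl, he, rfl⟩
        · exact hSF _ (hXS i j hij hj y hy)
        · by_cases h1 : j = k
          · subst h1
            have h2 := add_mem (hSF (d + e) (hX i j l hij hkl hl))
              ((F (d + e)).smul_mem c (hXF (d + e) i l (by omega) hl (by omega)))
            rwa [sub_add_cancel] at h2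
          by_cases h2 : l = i
          · subst h2
            have h3 := neg_mem (add_mem (hSF (d + e) (hX k l j hkl hij hj))
              ((F (d + e)).smul_mem c (hXF (d + e) k j (by omega) hj (by omega))))
            rwa [sub_add_cancel, neg_sub] at h3
          · exact hSF _ (hX' i j k l hij hj hkl hl h1 h2)
    | zero_left y hy => simp
    | zero_right x hx => simp
    | add_left x y z _ _ _ h1 h2 => rw [add_lie]; exact add_mem h1 h2
    | add_right x y z _ _ _ h1 h2 => rw [lie_add]; exact add_mem h1 h2
    | smul_left r x y _ _ h => rw [smul_lie]; exact Submodule.smul_mem _ _ h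
    | smul_right r x y _ _ h => rw [lie_smul]; exact Submodule.smul_mem _ _ h
  have hmono : ∀ d e, d ≤ e → F e ≤ F d := by
    intro d e hde
    refine Submodule.span_mono ?_
    rintro y (hy | ⟨i, j, hij, hj, hd, rfl⟩)
    · exact Or.inl hy
    · exact Or.inr ⟨i, j, hij, hj, by omega, rfl⟩
  have hFS : F (n + 1) ≤ S := by
    refine Submodule.span_le.2 ?_
    rintro y (hy | ⟨i, j, hij, hj, hd, rfl⟩)
    · exact hy
    · omega
  let L : LieSubalgebra K (Module.End K V) :=
    { F 1 with lie_mem' := fun {x y} hx hy => hmono 1 2 (by norm_num) (hbr 1 1 x hx y hy) }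
  have hbrS : ∀ x ∈ F 1, ∀ s ∈ S, ⁅x, s⁆ ∈ S := fun x hx s hs =>
    hFS (hmono _ (1 + (n + 1)) (by omega) (hbr 1 (n + 1) x hx s (hSF _ hs)))
  let I : LieIdeal K L :=
    { S.comap L.toSubmodule.subtype with
      lie_mem := fun {x m} hm => hbrS _ x.2 _ hm }
  have hI : ∀ x : L, x ∈ I ↔ (x : Module.End K V) ∈ S := fun x => Iff.rfl
  have hpow : ∀ (N : ℕ) (x y : L), (((LieAlgebra.ad K L x ^ N) y : L) : Module.End K V) ∈
      F (N + 1) := by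
    intro N x y
    induction N with
    | zero => exact y.2
    | succ N ih =>
      rw [pow_succ', Module.End.mul_apply, LieAlgebra.ad_apply, LieSubalgebra.coe_bracket]
      have := hbr 1 (N + 1) _ x.2 _ ih
      rwa [add_comm 1] at this
  let h : ℕ → L := fun a => if ha : a < n then
    ⟨X (n - 1 - a) (n - a), hXF 1 _ _ (by omega) (by omega) (by omega)⟩ else 0
  have hmem := nestedBracket_mem_of_ad_pow_mem K L V
    (fun x hx => by ext v; exact hx v) I n (fun x y => (hI _).2 (hFS (hpow n x y))) h
    (k := n - 1) (by omega) (by omega)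
  have hval : ∀ a, a < n → ((nestedBracket h a : L) : Module.End K V) -
      c ^ a • X (n - 1 - a) n ∈ S := by
    intro a ha
    induction a with
    | zero => simp [nestedBracket, h, show 0 < n by omega]
    | succ a ih =>
      have ih := ih (by omega)
      have hh : ((h (a + 1) : L) : Module.End K V) = X (n - 1 - (a + 1)) (n - 1 - a) := by
        simp only [h, dif_pos ha]
        congr 1
        omega
      have e1 : ((nestedBracket h (a + 1) : L) : Module.End K V) -
          c ^ (a + 1) • X (n - 1 - (a + 1)) n =
          ⁅((h (a + 1) : L) : Module.End K V),
            ((nestedBracket h a : L) : Module.End K V) - c ^ a • X (n - 1 - a) n⁆ +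
          c ^ a • (X (n - 1 - (a + 1)) (n - 1 - a) * X (n - 1 - a) n -
            X (n - 1 - a) n * X (n - 1 - (a + 1)) (n - 1 - a) - c • X (n - 1 - (a + 1)) n) := by
        simp only [nestedBracket, LieSubalgebra.coe_bracket, hh, lie_sub, lie_smul]
        rw [← Ring.lie_def (X (n - 1 - (a + 1)) (n - 1 - a)), smul_sub, smul_smul, pow_succ]
        abel
      rw [e1]
      exact add_mem (hbrS _ (h (a + 1)).2 _ ih)
        (S.smul_mem _ (hX _ _ _ (by omega) (by omega) le_rfl))
  have h0 := hval (n - 1) (by omega)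
  rw [Nat.sub_self] at h0
  have h1 := sub_mem ((hI _).1 hmem) h0
  rw [sub_sub_cancel] at h1
  simpa [smul_smul, inv_mul_cancel₀ (pow_ne_zero _ hc)] using S.smul_mem (c ^ (n - 1))⁻¹ h1

end UnipotentMatrices

section PadicExponential

open Filter Topology NormedSpace

variable (ℓ : ℕ) [Fact ℓ.Prime] {𝔸 : Type*} [NormedRing 𝔸] [NormedAlgebra ℂ_[ℓ] 𝔸]

theorem PadicComplex.norm_natCast (k : ℕ) : ‖(k : ℂ_[ℓ])‖ = ‖(k : ℚ_[ℓ])‖ := by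
  rw [← PadicComplex.norm_extends' ℓ (k : ℚ_[ℓ])]
  congr 1
  simp

theorem PadicComplex.norm_natCast_le_one (k : ℕ) : ‖(k : ℂ_[ℓ])‖ ≤ 1 := by
  rw [PadicComplex.norm_natCast]
  exact_mod_cast Padic.norm_int_le_one (p := ℓ) (k : ℤ)

theorem PadicComplex.tendsto_prime_pow : Tendsto (fun j : ℕ => (ℓ : ℂ_[ℓ]) ^ j) atTop (𝓝 0) := by
  refine tendsto_pow_atTop_nhds_zero_of_norm_lt_one ?_
  rw [PadicComplex.norm_natCast, Padic.norm_p]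
  exact inv_lt_one_of_one_lt₀ (by exact_mod_cast (Fact.out : ℓ.Prime).one_lt)

theorem PadicComplex.norm_inv_factorial_le (k : ℕ) :
    ‖((k.factorial : ℂ_[ℓ]))⁻¹‖ ≤ (ℓ : ℝ) ^ k := by
  have hℓ : (1 : ℝ) < ℓ := by exact_mod_cast (Fact.out : ℓ.Prime).one_lt
  have h2 : padicValNat ℓ k.factorial ≤ k := by
    have h := sub_one_mul_padicValNat_factorial (p := ℓ) k
    have h3 : 1 ≤ ℓ - 1 := by have := (Fact.out : ℓ.Prime).two_le; omega
    nlinarith [Nat.sub_le k (ℓ.digits k).sum]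
  rw [norm_inv, PadicComplex.norm_natCast, Padic.norm_eq_zpow_neg_valuation
    (by exact_mod_cast k.factorial_ne_zero), Padic.valuation_natCast, zpow_neg, inv_inv,
    zpow_natCast]
  exact pow_le_pow_right₀ hℓ.le h2

theorem norm_expSeries_le (𝕂 𝔸 : Type*) [NontriviallyNormedField 𝕂] [NormedRing 𝔸]
    [NormedAlgebra 𝕂 𝔸] (k : ℕ) :
    ‖expSeries 𝕂 𝔸 k‖ ≤ ‖((k.factorial : 𝕂))⁻¹‖ * max 1 ‖(1 : 𝔸)‖ := by
  refine (ContinuousMultilinearMap.opNorm_smul_le _ _).trans ?_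
  refine mul_le_mul_of_nonneg_left ?_ (norm_nonneg _)
  rcases Nat.eq_zero_or_pos k with rfl | hk
  · rw [ContinuousMultilinearMap.norm_mkPiAlgebraFin_zero]
    exact le_max_right _ _
  · exact (ContinuousMultilinearMap.norm_mkPiAlgebraFin_le_of_pos hk).trans (le_max_left _ _)

theorem padicComplex_expSeries_radius_pos : 0 < (expSeries ℂ_[ℓ] 𝔸).radius := by
  have hℓ : (0 : ℝ) < ℓ := by exact_mod_cast (Fact.out : ℓ.Prime).pos
  refine lt_of_lt_of_le ?_ ((expSeries ℂ_[ℓ] 𝔸).le_radius_of_bound (max 1 ‖(1 : 𝔸)‖)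
    (r := (ℓ : NNReal)⁻¹) fun k => ?_)
  · simp
  · have h2 : ‖expSeries ℂ_[ℓ] 𝔸 k‖ ≤ (ℓ : ℝ) ^ k * max 1 ‖(1 : 𝔸)‖ :=
      (norm_expSeries_le _ _ k).trans (mul_le_mul_of_nonneg_right
        (PadicComplex.norm_inv_factorial_le ℓ k) (by positivity))
    calc ‖expSeries ℂ_[ℓ] 𝔸 k‖ * (((ℓ : NNReal)⁻¹ : NNReal) : ℝ) ^ k
        ≤ ((ℓ : ℝ) ^ k * max 1 ‖(1 : 𝔸)‖) * (((ℓ : NNReal)⁻¹ : NNReal) : ℝ) ^ k := by gcongr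
      _ = max 1 ‖(1 : 𝔸)‖ := by
        push_cast
        rw [mul_right_comm, ← mul_pow, mul_inv_cancel₀ hℓ.ne', one_pow, one_mul]

/-- The sequence `u j` has logarithmic derivative `x` along the scale `ℓ ^ j`. -/
def HasPadicLog (u : ℕ → 𝔸) (x : 𝔸) : Prop :=
  Tendsto (fun j => ((ℓ : ℂ_[ℓ]) ^ j)⁻¹ • (u j - 1)) atTop (𝓝 x)

variable {ℓ}

namespace HasPadicLog

variable {u v : ℕ → 𝔸} {x y : 𝔸}

theorem unique (hx : HasPadicLog ℓ u x) (hy : HasPadicLog ℓ u y) : x = y :=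
  tendsto_nhds_unique hx hy

theorem one : HasPadicLog ℓ (fun _ => (1 : 𝔸)) 0 := by
  simp [HasPadicLog]

theorem tendsto_one (h : HasPadicLog ℓ u x) : Tendsto u atTop (𝓝 1) := by
  have hℓ : (ℓ : ℂ_[ℓ]) ≠ 0 := by exact_mod_cast (Fact.out : ℓ.Prime).ne_zero
  have h1 := ((PadicComplex.tendsto_prime_pow ℓ).smul h).add_const 1
  rw [zero_smul, zero_add] at h1
  refine h1.congr fun j => ?_
  rw [smul_smul, mul_inv_cancel₀ (pow_ne_zero _ hℓ), one_smul, sub_add_cancel]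

theorem mul (hu : HasPadicLog ℓ u x) (hv : HasPadicLog ℓ v y) :
    HasPadicLog ℓ (fun j => u j * v j) (x + y) := by
  have h1 := (Tendsto.mul hu hv.tendsto_one).add hv
  rw [mul_one] at h1
  refine h1.congr fun j => ?_
  rw [smul_mul_assoc, ← smul_add]
  congr 1
  noncomm_ring

theorem pow (hu : HasPadicLog ℓ u x) (k : ℕ) :
    HasPadicLog ℓ (fun j => u j ^ k) ((k : ℂ_[ℓ]) • x) := by
  induction k with
  | zero => simpa using one
  | succ k ih => simpa [pow_succ, add_smul] using ih.mul hu

theorem conj (hu : HasPadicLog ℓ u x) {g h : 𝔸} (hgh : g * h = 1) :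
    HasPadicLog ℓ (fun j => g * u j * h) (g * x * h) := by
  refine ((hu.const_mul g).mul_const h).congr fun j => ?_
  simp only [mul_smul_comm, smul_mul_assoc, mul_sub, sub_mul, mul_one, hgh]

theorem neg_of_mul_eq_one (hu : HasPadicLog ℓ u x) (hv : HasPadicLog ℓ v y)
    (h : ∀ j, u j * v j = 1) : y = -x := by
  have h1 := hu.mul hv
  simp only [h] at h1
  exact (neg_eq_of_add_eq_zero_right (h1.unique one)).symm

/-- The commutator with an element, as a limit of conjugations. -/
theorem tendsto_conj_sub (hu : HasPadicLog ℓ u x) (hv : HasPadicLog ℓ v (-x)) (s : 𝔸) :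
    Tendsto (fun j => ((ℓ : ℂ_[ℓ]) ^ j)⁻¹ • (u j * s * v j - s)) atTop (𝓝 (x * s - s * x)) := by
  have h1 := (Tendsto.mul (Tendsto.mul_const s hu) hv.tendsto_one).add
    (Tendsto.const_mul s hv)
  rw [mul_one, mul_neg, ← sub_eq_add_neg] at h1
  refine h1.congr fun j => ?_
  simp only [smul_mul_assoc, mul_smul_comm, ← smul_add]
  congr 1
  noncomm_ring

theorem mem_of_forall_mem (hu : HasPadicLog ℓ u x) (S : Submodule ℂ_[ℓ] 𝔸)
    (hS : IsClosed (S : Set 𝔸)) (h1 : (1 : 𝔸) ∈ S) (h : ∀ j, u j ∈ S) : x ∈ S :=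
  hS.mem_of_tendsto hu (Eventually.of_forall fun j => S.smul_mem _ (sub_mem (h j) h1))

end HasPadicLog

/-- Elements of an `ℓ`-adic Banach algebra that are close to `1` have a logarithm. -/
theorem exists_padicLog [CompleteSpace 𝔸] : ∃ ε > 0, ∀ u : 𝔸, ‖u - 1‖ < ε →
    ∃ x : 𝔸, HasPadicLog ℓ (fun j => u ^ ℓ ^ j) x ∧ ∀ S : Subalgebra ℂ_[ℓ] 𝔸,
      IsClosed (S : Set 𝔸) → x ∈ S → u ∈ S := by
  have hpos := padicComplex_expSeries_radius_pos ℓ (𝔸 := 𝔸)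
  have hℓ : (ℓ : ℂ_[ℓ]) ≠ 0 := by exact_mod_cast (Fact.out : ℓ.Prime).ne_zero
  have hd : HasStrictFDerivAt (exp : 𝔸 → 𝔸)
      ((ContinuousLinearEquiv.refl ℂ_[ℓ] 𝔸 : 𝔸 ≃L[ℂ_[ℓ]] 𝔸) : 𝔸 →L[ℂ_[ℓ]] 𝔸) 0 :=
    hasStrictFDerivAt_exp_zero_of_radius_pos hpos
  have hmap := hd.map_nhds_eq_of_equiv
  rw [exp_zero] at hmap
  have hball : Metric.eball (0 : 𝔸) (expSeries ℂ_[ℓ] 𝔸).radius ∈ 𝓝 (0 : 𝔸) :=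
    Metric.eball_mem_nhds _ hpos
  have himg : (exp : 𝔸 → 𝔸) '' Metric.eball (0 : 𝔸) (expSeries ℂ_[ℓ] 𝔸).radius ∈ 𝓝 (1 : 𝔸) := by
    rw [← hmap]
    exact image_mem_map hball
  obtain ⟨ε, hε, hsub⟩ := Metric.mem_nhds_iff.1 himg
  refine ⟨ε, hε, fun u hu => ?_⟩
  obtain ⟨x, hx, rfl⟩ := hsub (show u ∈ Metric.ball 1 ε by rwa [Metric.mem_ball, dist_eq_norm])
  have hmem : ∀ k : ℕ, ((k : ℂ_[ℓ]) • x) ∈ Metric.eball (0 : 𝔸) (expSeries ℂ_[ℓ] 𝔸).radius := by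
    intro k
    rw [Metric.mem_eball, edist_zero_right] at hx ⊢
    refine lt_of_le_of_lt ?_ hx
    rw [enorm_le_iff_norm_le, norm_smul]
    exact mul_le_of_le_one_left (norm_nonneg _) (PadicComplex.norm_natCast_le_one ℓ k)
  have hpow : ∀ k : ℕ, exp ((k : ℂ_[ℓ]) • x) = exp x ^ k := by
    intro k
    induction k with
    | zero => simp [exp_zero]
    | succ k ih =>
      rw [Nat.cast_succ, add_smul, one_smul, exp_add_of_commute_of_mem_ball (𝕂 := ℂ_[ℓ])
        ((Commute.refl x).smul_left _) (hmem k) hx, ih, pow_succ]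
  refine ⟨x, ?_, fun S hS hxS => ?_⟩
  · have hnorm : Tendsto (fun j => ‖((ℓ : ℂ_[ℓ]) ^ j)⁻¹‖) atTop atTop := by
      have h1 : (1 : ℝ) < ‖(ℓ : ℂ_[ℓ])‖⁻¹ := by
        rw [PadicComplex.norm_natCast, Padic.norm_p, inv_inv]
        exact_mod_cast (Fact.out : ℓ.Prime).one_lt
      simpa [inv_pow] using tendsto_pow_atTop_atTop_of_one_lt h1
    refine (hd.hasFDerivAt.lim x hnorm).congr fun j => ?_
    simp only [← hpow, zero_add, exp_zero, inv_inv]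
    simp
  · have hsum := expSeries_hasSum_exp_of_mem_ball' (𝕂 := ℂ_[ℓ]) x hx
    refine hS.mem_of_tendsto hsum (Eventually.of_forall fun s => ?_)
    exact S.sum_mem fun k _ => S.smul_mem (S.pow_mem hxS k) _

end PadicExponential

section RationalSteinberg

open Module Filter Topology

theorem corner_mem_of_triangular_relations_matrix {K : Type*} [Field K] [IsAlgClosed K]
    [CharZero K] {n : ℕ} (hn : 2 ≤ n) (S : Subalgebra K (Matrix (Fin n) (Fin n) K))
    (X : ℕ → ℕ → Matrix (Fin n) (Fin n) K) (c : K) (hc : c ≠ 0)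
    (hXS : ∀ i j, i < j → j ≤ n → ∀ s ∈ S, X i j * s - s * X i j ∈ S)
    (hX : ∀ i j l, i < j → j < l → l ≤ n →
      X i j * X j l - X j l * X i j - c • X i l ∈ S)
    (hX' : ∀ i j k l, i < j → j ≤ n → k < l → l ≤ n → j ≠ k → l ≠ i →
      X i j * X k l - X k l * X i j ∈ S) : X 0 n ∈ S := by
  let e : Matrix (Fin n) (Fin n) K ≃ₐ[K] Module.End K (Fin n → K) := Matrix.toLinAlgEquiv'
  have hmem : ∀ x, e x ∈ (Subalgebra.toSubmodule S).map e.toLinearMap ↔ x ∈ S := fun x => by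
    constructor
    · rintro ⟨y, hy, hyx⟩
      rwa [← e.injective hyx]
    · exact fun hx => ⟨x, hx, rfl⟩
  refine (hmem _).1 (corner_mem_of_triangular_relations (K := K) hn (by simp)
    ((Subalgebra.toSubmodule S).map e.toLinearMap) (fun i j => e (X i j)) c hc ?_ ?_ ?_ ?_)
  · rintro _ ⟨s, hs, rfl⟩ _ ⟨t, ht, rfl⟩
    have := (hmem (s * t - t * s)).2 (sub_mem (mul_mem hs ht) (mul_mem ht hs))
    simpa using this
  · rintro i j hij hj _ ⟨s, hs, rfl⟩
    have := (hmem _).2 (hXS i j hij hj s hs)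
    simpa using this
  · intro i j l hij hjl hl
    have := (hmem _).2 (hX i j l hij hjl hl)
    simpa using this
  · intro i j k l hij hj hkl hl h1 h2
    have := (hmem _).2 (hX' i j k l hij hj hkl hl h1 h2)
    simpa using this

/-- Finitely many rationals are integral at some prime. -/
theorem exists_prime_padicNorm_le_one (T : Finset ℚ) :
    ∃ (ℓ : ℕ) (_ : Fact ℓ.Prime), ∀ t ∈ T, ‖((t : ℚ) : ℚ_[ℓ])‖ ≤ 1 := by
  obtain ⟨ℓ, hle, hp⟩ := Nat.exists_infinite_primes (T.sup Rat.den + 1)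
  have hf : Fact ℓ.Prime := ⟨hp⟩
  refine ⟨ℓ, hf, fun t ht => Padic.norm_rat_le_one fun hdvd => ?_⟩
  have h1 := Nat.le_of_dvd t.den_pos hdvd
  have h2 := Finset.le_sup (f := Rat.den) ht
  omega

attribute [local instance] Matrix.linftyOpNormedRing Matrix.linftyOpNormedAlgebra

variable {n : ℕ}

theorem Matrix.linfty_opNorm_lt_of_entries {K : Type*} [NormedField K] {δ ε : ℝ}
    (hδ : 0 ≤ δ) (hε : n * δ < ε) (A : Matrix (Fin n) (Fin n) K)
    (h : ∀ i j, ‖A i j‖ ≤ δ) : ‖A‖ < ε := by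
  refine lt_of_le_of_lt ?_ hε
  rw [Matrix.linfty_opNorm_def]
  have : (Finset.univ.sup fun i => ∑ j, ‖A i j‖₊) ≤ (n : NNReal) * ⟨δ, hδ⟩ := by
    refine Finset.sup_le fun i _ => ?_
    refine (Finset.sum_le_card_nsmul _ _ (⟨δ, hδ⟩ : NNReal) fun j _ => h i j).trans ?_
    simp only [Finset.card_univ, Fintype.card_fin, nsmul_eq_mul]
    exact le_rfl
  exact_mod_cast this

theorem exists_pow_near_one (ℓ : ℕ) [Fact ℓ.Prime] {ε : ℝ} (hε : 0 < ε) :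
    ∃ M : ℕ, 0 < M ∧ ∀ u : (Matrix (Fin n) (Fin n) ℚ)ˣ,
      (∀ i j, ‖(((u : Matrix (Fin n) (Fin n) ℚ) i j : ℚ) : ℚ_[ℓ])‖ ≤ 1) →
      (∀ i j, ‖(((↑u⁻¹ : Matrix (Fin n) (Fin n) ℚ) i j : ℚ) : ℚ_[ℓ])‖ ≤ 1) →
      ‖(algebraMap ℚ ℂ_[ℓ]).mapMatrix ((u : Matrix (Fin n) (Fin n) ℚ) ^ M) - 1‖ < ε := by
  have hℓ1 : (1 : ℝ) < ℓ := by exact_mod_cast (Fact.out : ℓ.Prime).one_lt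
  obtain ⟨k, hk⟩ : ∃ k : ℕ, (n : ℝ) * (ℓ : ℝ) ^ (-k : ℤ) < ε := by
    have h1 : Tendsto (fun k : ℕ => (n : ℝ) * ((ℓ : ℝ)⁻¹) ^ k) atTop (𝓝 ((n : ℝ) * 0)) :=
      (tendsto_pow_atTop_nhds_zero_of_lt_one (by positivity) (inv_lt_one_of_one_lt₀ hℓ1)).const_mul _
    rw [mul_zero] at h1
    obtain ⟨k, hk⟩ := (h1.eventually (gt_mem_nhds hε)).exists
    exact ⟨k, by simpa [inv_pow] using hk⟩
  have : NeZero (ℓ ^ k) := ⟨pow_ne_zero _ (Fact.out : ℓ.Prime).ne_zero⟩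
  refine ⟨Nat.card (Matrix (Fin n) (Fin n) (ZMod (ℓ ^ k)))ˣ, Nat.card_pos, fun u hu hu' => ?_⟩
  set M := Nat.card (Matrix (Fin n) (Fin n) (ZMod (ℓ ^ k)))ˣ
  let A : Matrix (Fin n) (Fin n) ℤ_[ℓ] := Matrix.of fun i j => ⟨_, hu i j⟩
  let B : Matrix (Fin n) (Fin n) ℤ_[ℓ] := Matrix.of fun i j => ⟨_, hu' i j⟩
  let g : Matrix (Fin n) (Fin n) ℤ_[ℓ] →+* Matrix (Fin n) (Fin n) ℚ_[ℓ] :=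
    (PadicInt.Coe.ringHom (p := ℓ)).mapMatrix
  let g' : Matrix (Fin n) (Fin n) ℚ →+* Matrix (Fin n) (Fin n) ℚ_[ℓ] :=
    (algebraMap ℚ ℚ_[ℓ]).mapMatrix
  have hginj : Function.Injective g := fun a b h => by
    ext i j
    exact Subtype.ext (congrFun (congrFun h i) j)
  have hA : g A = g' u := by
    ext i j
    rfl
  have hB : g B = g' ↑u⁻¹ := by
    ext i j
    rfl
  have hAB : A * B = 1 := hginj (by rw [map_mul, hA, hB, ← map_mul, Units.mul_inv, map_one, map_one])
  have hBA : B * A = 1 := hginj (by rw [map_mul, hA, hB, ← map_mul, Units.inv_mul, map_one, map_one])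
  let U : (Matrix (Fin n) (Fin n) ℤ_[ℓ])ˣ := ⟨A, B, hAB, hBA⟩
  have hU : (PadicInt.toZModPow (p := ℓ) k).mapMatrix (A ^ M) =
      (1 : Matrix (Fin n) (Fin n) (ZMod (ℓ ^ k))) := by
    have h1 := pow_card_eq_one' (x := Units.map
      ((PadicInt.toZModPow (p := ℓ) k).mapMatrix (m := Fin n)).toMonoidHom U)
    rw [← map_pow] at h1
    exact congrArg Units.val h1
  have hentry : ∀ i j, ‖(A ^ M - 1) i j‖ ≤ (ℓ : ℝ) ^ (-k : ℤ) := by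
    intro i j
    rw [PadicInt.norm_le_pow_iff_mem_span_pow, ← PadicInt.ker_toZModPow, RingHom.mem_ker]
    have h2 : (PadicInt.toZModPow (p := ℓ) k).mapMatrix (A ^ M - 1) = 0 := by
      rw [map_sub, hU, map_one, sub_self]
    exact congrFun (congrFun h2 i) j
  refine Matrix.linfty_opNorm_lt_of_entries (by positivity) hk _ fun i j => ?_
  have h3 : (((A ^ M - 1) i j : ℤ_[ℓ]) : ℚ_[ℓ]) =
      (algebraMap ℚ ℚ_[ℓ]) (((u : Matrix (Fin n) (Fin n) ℚ) ^ M - 1) i j) := by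
    have h4 : g (A ^ M - 1) = g' ((u : Matrix (Fin n) (Fin n) ℚ) ^ M - 1) := by
      rw [map_sub, map_sub, map_pow, map_pow, hA, map_one, map_one]
    exact congrFun (congrFun h4 i) j
  have h5 : ((algebraMap ℚ ℂ_[ℓ]).mapMatrix ((u : Matrix (Fin n) (Fin n) ℚ) ^ M) - 1) i j =
      algebraMap ℚ_[ℓ] ℂ_[ℓ] (algebraMap ℚ ℚ_[ℓ]
        (((u : Matrix (Fin n) (Fin n) ℚ) ^ M - 1) i j)) := by
    rw [← map_one ((algebraMap ℚ ℂ_[ℓ]).mapMatrix (m := Fin n)), ← map_sub]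
    simp [RingHom.mapMatrix_apply, Matrix.map_apply]
  rw [h5, ← h3]
  refine le_trans (le_of_eq ?_) (hentry i j)
  exact PadicComplex.norm_extends' ℓ _

/-- Membership in a rational subspace of matrices descends from any extension field. -/
theorem mem_of_mapMatrix_mem_span {K : Type*} [Field K] [Algebra ℚ K]
    (S : Submodule ℚ (Matrix (Fin n) (Fin n) ℚ)) (v : Matrix (Fin n) (Fin n) ℚ)
    (hv : (algebraMap ℚ K).mapMatrix v ∈
      Submodule.span K ((algebraMap ℚ K).mapMatrix '' (S : Set (Matrix (Fin n) (Fin n) ℚ)))) :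
    v ∈ S := by
  by_contra hvS
  obtain ⟨f, hfv, hfS⟩ := Submodule.exists_le_ker_of_notMem hvS
  let F : Matrix (Fin n) (Fin n) K →ₗ[K] K :=
    ∑ i, ∑ j, (algebraMap ℚ K (f (Matrix.single i j 1))) •
      (Matrix.entryLinearMap K K i j)
  have hF : ∀ w, F ((algebraMap ℚ K).mapMatrix w) = algebraMap ℚ K (f w) := by
    intro w
    conv_rhs => rw [Matrix.matrix_eq_sum_single w]
    simp only [F, map_sum, LinearMap.sum_apply, LinearMap.smul_apply, RingHom.mapMatrix_apply,
      Matrix.entryLinearMap_apply, Matrix.map_apply, smul_eq_mul]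
    refine Finset.sum_congr rfl fun i _ => Finset.sum_congr rfl fun j _ => ?_
    rw [← map_mul, mul_comm, ← smul_eq_mul, ← map_smul, Matrix.smul_single, smul_eq_mul, mul_one]
  have hker : Submodule.span K ((algebraMap ℚ K).mapMatrix ''
      (S : Set (Matrix (Fin n) (Fin n) ℚ))) ≤ LinearMap.ker F := by
    rw [Submodule.span_le]
    rintro _ ⟨s, hs, rfl⟩
    have := hfS hs
    rw [LinearMap.mem_ker] at this
    rw [SetLike.mem_coe, LinearMap.mem_ker, hF, this, map_zero]
  have := hker hv
  rw [LinearMap.mem_ker, hF] at this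
  exact hfv ((map_eq_zero_iff _ (algebraMap ℚ K).injective).1 this)

theorem exists_padicLog_of_finiteDimensional {ℓ : ℕ} [Fact ℓ.Prime] (𝔸 : Type*) [NormedRing 𝔸]
    [NormedAlgebra ℂ_[ℓ] 𝔸] [FiniteDimensional ℂ_[ℓ] 𝔸] :
    (∀ S : Submodule ℂ_[ℓ] 𝔸, IsClosed (S : Set 𝔸)) ∧
    ∃ ε > 0, ∀ u : 𝔸, ‖u - 1‖ < ε →
    ∃ x : 𝔸, HasPadicLog ℓ (fun j => u ^ ℓ ^ j) x ∧ ∀ S : Subalgebra ℂ_[ℓ] 𝔸,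
      IsClosed (S : Set 𝔸) → x ∈ S → u ∈ S := by
  have := FiniteDimensional.complete ℂ_[ℓ] 𝔸
  exact ⟨fun S => S.closed_of_finiteDimensional, exists_padicLog⟩

/-- Matrices of size `n` normalizing `S` that satisfy, modulo the units of `S`, the relations of the
unipotent elementary matrices of size `n + 1`: the corner element has a power in `S`. -/
theorem exists_pow_mem_of_unipotent_relations (hn : 2 ≤ n)
    (S : Subalgebra ℚ (Matrix (Fin n) (Fin n) ℚ)) (R : ℕ → ℕ → (Matrix (Fin n) (Fin n) ℚ)ˣ)
    (q : ℕ) (hq : q ≠ 0)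
    (hN : ∀ i j, i < j → j ≤ n → ∀ s ∈ S, (R i j : Matrix (Fin n) (Fin n) ℚ) * s *
      (↑(R i j)⁻¹ : Matrix (Fin n) (Fin n) ℚ) ∈ S)
    (h1 : ∀ i j l, i < j → j < l → l ≤ n → ∀ a b : ℕ,
      (((R i j) ^ a * (R j l) ^ b * ((R i j)⁻¹) ^ a * ((R j l)⁻¹) ^ b *
        ((R i l)⁻¹) ^ (q * a * b) : (Matrix (Fin n) (Fin n) ℚ)ˣ) :
          Matrix (Fin n) (Fin n) ℚ) ∈ S)
    (h2 : ∀ i j k l, i < j → j ≤ n → k < l → l ≤ n → j ≠ k → l ≠ i → ∀ a b : ℕ,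
      (((R i j) ^ a * (R k l) ^ b * ((R i j)⁻¹) ^ a * ((R k l)⁻¹) ^ b :
        (Matrix (Fin n) (Fin n) ℚ)ˣ) : Matrix (Fin n) (Fin n) ℚ) ∈ S) :
    ∃ M : ℕ, 0 < M ∧ (R 0 n : Matrix (Fin n) (Fin n) ℚ) ^ M ∈ S := by
  let T : Finset ℚ := ((Finset.range (n + 1) ×ˢ Finset.range (n + 1)) ×ˢ
    (Finset.univ : Finset (Fin n × Fin n))).biUnion fun z =>
      {(R z.1.1 z.1.2 : Matrix (Fin n) (Fin n) ℚ) z.2.1 z.2.2,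
        (↑(R z.1.1 z.1.2)⁻¹ : Matrix (Fin n) (Fin n) ℚ) z.2.1 z.2.2}
  obtain ⟨ℓ, _, hℓ⟩ := exists_prime_padicNorm_le_one T
  have hbound : ∀ i j, i ≤ n → j ≤ n → ∀ a b,
      ‖(((R i j : Matrix (Fin n) (Fin n) ℚ) a b : ℚ) : ℚ_[ℓ])‖ ≤ 1 := fun i j hi hj a b =>
    hℓ _ (Finset.mem_biUnion.2 ⟨((i, j), (a, b)), by simp; omega, by simp⟩)
  have hbound' : ∀ i j, i ≤ n → j ≤ n → ∀ a b,
      ‖(((↑(R i j)⁻¹ : Matrix (Fin n) (Fin n) ℚ) a b : ℚ) : ℚ_[ℓ])‖ ≤ 1 := fun i j hi hj a b =>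
    hℓ _ (Finset.mem_biUnion.2 ⟨((i, j), (a, b)), by simp; omega, by simp⟩)
  obtain ⟨hclosed', ε, hε, hlog⟩ :=
    exists_padicLog_of_finiteDimensional (ℓ := ℓ) (Matrix (Fin n) (Fin n) ℂ_[ℓ])
  obtain ⟨M, hM, hnear⟩ := exists_pow_near_one (n := n) ℓ hε
  let f : Matrix (Fin n) (Fin n) ℚ →+* Matrix (Fin n) (Fin n) ℂ_[ℓ] :=
    (algebraMap ℚ ℂ_[ℓ]).mapMatrix
  have hx : ∀ i j, ∃ x : Matrix (Fin n) (Fin n) ℂ_[ℓ], i ≤ n → j ≤ n →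
      (HasPadicLog ℓ (fun a => f ((R i j : Matrix (Fin n) (Fin n) ℚ) ^ M) ^ ℓ ^ a) x ∧
      HasPadicLog ℓ (fun a => f ((↑(R i j)⁻¹ : Matrix (Fin n) (Fin n) ℚ) ^ M) ^ ℓ ^ a) (-x) ∧
      ∀ S' : Subalgebra ℂ_[ℓ] (Matrix (Fin n) (Fin n) ℂ_[ℓ]), IsClosed (S' : Set (Matrix (Fin n) (Fin n) ℂ_[ℓ])) →
        x ∈ S' →
        f ((R i j : Matrix (Fin n) (Fin n) ℚ) ^ M) ∈ S') := by
    intro i j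
    by_cases hij : i ≤ n ∧ j ≤ n
    swap
    · exact ⟨0, fun hi hj => absurd ⟨hi, hj⟩ hij⟩
    obtain ⟨hi, hj⟩ := hij
    obtain ⟨x, hx, hxS⟩ := hlog _ (hnear (R i j) (hbound i j hi hj) (hbound' i j hi hj))
    obtain ⟨y, hy, -⟩ := hlog _ (hnear (R i j)⁻¹ (hbound' i j hi hj)
      (by rw [inv_inv]; exact hbound i j hi hj))
    refine ⟨x, fun _ _ => ⟨hx, ?_, hxS⟩⟩
    have hyx : y = -x := hx.neg_of_mul_eq_one hy fun a => by
      rw [← map_pow, ← map_pow, ← map_mul]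
      simp only [← Units.val_pow_eq_pow_val, ← Units.val_mul]
      simp
    exact hyx ▸ hy
  choose X hX using hx
  let S' : Subalgebra ℂ_[ℓ] (Matrix (Fin n) (Fin n) ℂ_[ℓ]) :=
    Algebra.adjoin ℂ_[ℓ] (f '' (S : Set (Matrix (Fin n) (Fin n) ℚ)))
  have hspan : Subalgebra.toSubmodule S' =
      Submodule.span ℂ_[ℓ] (f '' (S : Set (Matrix (Fin n) (Fin n) ℚ))) := by
    have : f '' (S : Set (Matrix (Fin n) (Fin n) ℚ)) =
      ((S.toSubmonoid.map f.toMonoidHom : Submonoid _) : Set _) := rfl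
    rw [Algebra.adjoin_eq_span, this, Submonoid.closure_eq]
  have hclosed : IsClosed (S' : Set (Matrix (Fin n) (Fin n) ℂ_[ℓ])) :=
    hclosed' (Subalgebra.toSubmodule S')
  have hfS : ∀ s ∈ S, f s ∈ S' := fun s hs => Algebra.subset_adjoin ⟨s, hs, rfl⟩
  -- conjugation by powers preserves `S`, hence its span
  have hconj : ∀ i j, i < j → j ≤ n → ∀ k : ℕ, ∀ s ∈ S',
      f ((R i j : Matrix (Fin n) (Fin n) ℚ) ^ k) * s *
        f ((↑(R i j)⁻¹ : Matrix (Fin n) (Fin n) ℚ) ^ k) ∈ S' := by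
    intro i j hij hj k
    have hk : ∀ s ∈ S, (R i j : Matrix (Fin n) (Fin n) ℚ) ^ k * s *
        (↑(R i j)⁻¹ : Matrix (Fin n) (Fin n) ℚ) ^ k ∈ S := by
      induction k with
      | zero => simp
      | succ k ih =>
        intro s hs
        have := hN i j hij hj _ (ih s hs)
        rw [pow_succ', pow_succ]
        simpa only [mul_assoc] using this
    intro s hs
    have hs' : s ∈ Submodule.span ℂ_[ℓ] (f '' (S : Set (Matrix (Fin n) (Fin n) ℚ))) := hspan ▸ hs
    induction hs' using Submodule.span_induction with
    | mem x hx =>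
      obtain ⟨t, ht, rfl⟩ := hx
      rw [← map_mul, ← map_mul]
      exact hfS _ (hk t ht)
    | zero => simp
    | add x y hx hy h1 h2 =>
      rw [mul_add, add_mul]
      exact add_mem (h1 (hspan ▸ hx : x ∈ Subalgebra.toSubmodule S'))
        (h2 (hspan ▸ hy : y ∈ Subalgebra.toSubmodule S'))
    | smul c x hx h =>
      rw [mul_smul_comm, smul_mul_assoc]
      exact S'.smul_mem (h (hspan ▸ hx : x ∈ Subalgebra.toSubmodule S')) c
  have hc : ((q * M : ℕ) : ℂ_[ℓ]) ≠ 0 := by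
    exact_mod_cast mul_ne_zero hq hM.ne'
  have hunit : ∀ i j k, f ((R i j : Matrix (Fin n) (Fin n) ℚ) ^ k) *
      f ((↑(R i j)⁻¹ : Matrix (Fin n) (Fin n) ℚ) ^ k) = 1 := by
    intro i j k
    rw [← map_mul, ← Units.val_pow_eq_pow_val, ← Units.val_pow_eq_pow_val, ← Units.val_mul]
    simp [f]
  -- the derivative in the second variable
  have hderiv : ∀ i j k l i' l' : ℕ, i ≤ n → j ≤ n → k ≤ n → l ≤ n → i' ≤ n → l' ≤ n → ∀ a c : ℕ,
      (∀ b : ℕ, (((R i j) ^ (M * a) * (R k l) ^ (M * b) * ((R i j)⁻¹) ^ (M * a) *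
        ((R k l)⁻¹) ^ (M * b) * ((R i' l')⁻¹) ^ (M * b * c) : (Matrix (Fin n) (Fin n) ℚ)ˣ) :
          Matrix (Fin n) (Fin n) ℚ) ∈ S) →
      f ((R i j : Matrix (Fin n) (Fin n) ℚ) ^ (M * a)) * X k l *
        f ((↑(R i j)⁻¹ : Matrix (Fin n) (Fin n) ℚ) ^ (M * a)) - X k l - (c : ℂ_[ℓ]) • X i' l' ∈ S' := by
    intro i j k l i' l' hi hj hk hl hi' hl' a c h
    have hlim := (((hX k l hk hl).1.conj (hunit i j (M * a))).mul (hX k l hk hl).2.1).mul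
      ((hX i' l' hi' hl').2.1.pow c)
    rw [smul_neg, ← sub_eq_add_neg, ← sub_eq_add_neg] at hlim
    refine hlim.mem_of_forall_mem (Subalgebra.toSubmodule S') hclosed S'.one_mem fun b => ?_
    have := hfS _ (h (ℓ ^ b))
    rw [Subalgebra.mem_toSubmodule]
    simpa only [Units.val_mul, Units.val_pow_eq_pow_val, map_mul, map_pow, ← pow_mul, mul_assoc]
      using this
  have hderiv2 : ∀ i j k l i' l' : ℕ, i < j → j ≤ n → k ≤ n → l ≤ n → i' ≤ n → l' ≤ n → ∀ c : ℕ,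
      (∀ a b : ℕ, (((R i j) ^ (M * a) * (R k l) ^ (M * b) * ((R i j)⁻¹) ^ (M * a) *
        ((R k l)⁻¹) ^ (M * b) * ((R i' l')⁻¹) ^ (M * b * (a * c)) : (Matrix (Fin n) (Fin n) ℚ)ˣ) :
          Matrix (Fin n) (Fin n) ℚ) ∈ S) →
      X i j * X k l - X k l * X i j - (c : ℂ_[ℓ]) • X i' l' ∈ S' := by
    intro i j k l i' l' hij hj hk hl hi' hl' c h
    have hi : i ≤ n := by omega
    have hℓ0 : (ℓ : ℂ_[ℓ]) ≠ 0 := by exact_mod_cast (Fact.out : ℓ.Prime).ne_zero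
    have hlim := ((hX i j hi hj).1.tendsto_conj_sub (hX i j hi hj).2.1 (X k l)).sub_const
      ((c : ℂ_[ℓ]) • X i' l')
    refine hclosed.mem_of_tendsto hlim (Eventually.of_forall fun a => ?_)
    have hmem := hderiv i j k l i' l' hi hj hk hl hi' hl' (ℓ ^ a) (ℓ ^ a * c)
      (fun b => h (ℓ ^ a) b)
    have hmem2 := S'.smul_mem hmem (((ℓ : ℂ_[ℓ]) ^ a)⁻¹)
    rw [smul_sub, smul_smul, Nat.cast_mul, Nat.cast_pow, inv_mul_cancel_left₀ (pow_ne_zero _ hℓ0)]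
      at hmem2
    rw [SetLike.mem_coe]
    simpa only [pow_mul, map_pow] using hmem2
  have hcorner : X 0 n ∈ S' := by
    refine corner_mem_of_triangular_relations_matrix hn S' X _ hc ?_ ?_ ?_
    · intro i j hij hj s hs
      have hi : i ≤ n := by omega
      refine hclosed.mem_of_tendsto
        ((hX i j hi hj).1.tendsto_conj_sub (hX i j hi hj).2.1 s)
        (Eventually.of_forall fun a => S'.smul_mem (sub_mem ?_ hs) _)
      simpa only [← map_pow, ← pow_mul] using hconj i j hij hj (M * ℓ ^ a) s hs
    · intro i j l hij hjl hl
      refine hderiv2 i j j l i l hij (by omega) (by omega) hl (by omega) hl _ fun a b => ?_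
      have := h1 i j l hij hjl hl (M * a) (M * b)
      rwa [show q * (M * a) * (M * b) = M * b * (a * (q * M)) by ring] at this
    · intro i j k l hij hj hkl hl hjk hli
      have := hderiv2 i j k l 0 0 hij hj (by omega) hl (by omega) (by omega) 0 fun a b => by
        simpa using h2 i j k l hij hj hkl hl hjk hli (M * a) (M * b)
      simpa using this
  refine ⟨M, hM, mem_of_mapMatrix_mem_span (K := ℂ_[ℓ]) (Subalgebra.toSubmodule S) _ ?_⟩
  have hfin := (hX 0 n (by omega) le_rfl).2.2 S' hclosed hcorner
  rw [← Subalgebra.mem_toSubmodule, hspan] at hfin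
  exact hfin

end RationalSteinberg

section RelativePropertyT

open WeakDual Filter Topology

/-- The coordinate functions on the two-dimensional torus. -/
noncomputable def torusFst : C(Circle × Circle, ℂ) := ⟨fun z => z.1, by fun_prop⟩

/-- The coordinate functions on the two-dimensional torus. -/
noncomputable def torusSnd : C(Circle × Circle, ℂ) := ⟨fun z => z.2, by fun_prop⟩

theorem exists_starAlgHom_torus_comm {A : Type*} [CommCStarAlgebra A] {u v : A}
    (hu : u ∈ unitary A) (hv : v ∈ unitary A) :
    ∃ π : C(Circle × Circle, ℂ) →⋆ₐ[ℂ] A, π torusFst = u ∧ π torusSnd = v := by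
  have hmem : ∀ w ∈ unitary A, ∀ χ : characterSpace ℂ A, χ w ∈ Submonoid.unitSphere ℂ := by
    intro w hw χ
    have h1 : star (χ w) * χ w = 1 := by
      rw [← map_star, ← map_mul, (Unitary.mem_iff.1 hw).1, map_one]
    rw [Submonoid.unitSphere, ← SetLike.mem_coe]
    have h2 : ‖star (χ w) * χ w‖ = 1 := by rw [h1, norm_one]
    rw [norm_mul, norm_star] at h2
    simp only [Submonoid.coe_set_mk, Subsemigroup.coe_set_mk, mem_sphere_iff_norm, sub_zero]
    nlinarith [norm_nonneg (χ w)]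
  let g : C(characterSpace ℂ A, Circle × Circle) :=
    ⟨fun χ => (⟨χ u, hmem u hu χ⟩, ⟨χ v, hmem v hv χ⟩), by
      refine Continuous.prodMk (Continuous.subtype_mk ?_ _) (Continuous.subtype_mk ?_ _)
      · exact (gelfandTransform ℂ A u).continuous
      · exact (gelfandTransform ℂ A v).continuous⟩
  refine ⟨(gelfandStarTransform A).symm.toStarAlgHom.comp (ContinuousMap.compStarAlgHom' ℂ ℂ g),
    ?_, ?_⟩
  · change (gelfandStarTransform A).symm _ = u
    rw [StarAlgEquiv.symm_apply_eq]
    ext χ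
    rfl
  · change (gelfandStarTransform A).symm _ = v
    rw [StarAlgEquiv.symm_apply_eq]
    ext χ
    rfl

theorem exists_starAlgHom_torus {A : Type*} [CStarAlgebra A] {u v : A}
    (hu : u ∈ unitary A) (hv : v ∈ unitary A) (huv : u * v = v * u) :
    ∃ π : C(Circle × Circle, ℂ) →⋆ₐ[ℂ] A, π torusFst = u ∧ π torusSnd = v := by
  let S₀ : StarSubalgebra ℂ A := StarAlgebra.adjoin ℂ {u, v}
  have huv' : Commute u v := huv
  have hstar : ∀ w ∈ unitary A, ∀ x, Commute w x → Commute (star w) x := by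
    intro w hw x h
    have h2 : star w = ↑((Unitary.toUnits ⟨w, hw⟩)⁻¹ : Aˣ) := by
      rw [← map_inv, Unitary.val_toUnits_apply]
      rfl
    rw [h2]
    exact Commute.units_inv_left h
  have hS₀ : ∀ x y : S₀, x * y = y * x := by
    have := StarAlgebra.isMulCommutative_adjoin ℂ (s := {u, v})
      (by
        rintro a (rfl | rfl) b (rfl | rfl)
        · rfl
        · exact huv
        · exact huv.symm
        · rfl)
      (by
        rintro a (rfl | rfl) b (rfl | rfl)
        · exact ((hstar _ hu _ (Commute.refl _)).symm).eq
        · exact ((hstar _ hv _ huv'.symm).symm).eq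
        · exact ((hstar _ hu _ huv').symm).eq
        · exact ((hstar _ hv _ (Commute.refl _)).symm).eq)
    exact fun x y => mul_comm' x y
  let S : StarSubalgebra ℂ A := S₀.topologicalClosure
  have hcl : IsClosed (S : Set A) := S₀.isClosed_topologicalClosure
  let iC : CStarAlgebra S := StarSubalgebra.cstarAlgebra S
  let iR : CommRing S := S₀.commRingTopologicalClosure hS₀
  let iCC : CommCStarAlgebra S := { iC with mul_comm := iR.mul_comm }
  have huS : u ∈ S := S₀.le_topologicalClosure (StarAlgebra.subset_adjoin ℂ _ (by simp))
  have hvS : v ∈ S := S₀.le_topologicalClosure (StarAlgebra.subset_adjoin ℂ _ (by simp))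
  obtain ⟨π, h1, h2⟩ := exists_starAlgHom_torus_comm (A := S) (u := ⟨u, huS⟩) (v := ⟨v, hvS⟩)
    (Unitary.mem_iff.2 ⟨Subtype.ext (Unitary.mem_iff.1 hu).1, Subtype.ext (Unitary.mem_iff.1 hu).2⟩)
    (Unitary.mem_iff.2 ⟨Subtype.ext (Unitary.mem_iff.1 hv).1, Subtype.ext (Unitary.mem_iff.1 hv).2⟩)
  refine ⟨S.subtype.comp π, ?_, ?_⟩
  · simp [h1]
  · simp [h2]

end RelativePropertyT

section RelativePropertyT

open Filter Topology ContinuousMap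

theorem starAlgHom_torus_ext {A : Type*} [CStarAlgebra A] {π π' : C(Circle × Circle, ℂ) →⋆ₐ[ℂ] A}
    (h1 : π torusFst = π' torusFst) (h2 : π torusSnd = π' torusSnd) : π = π' := by
  have hc : ∀ π : C(Circle × Circle, ℂ) →⋆ₐ[ℂ] A, Continuous π := fun π =>
    AddMonoidHomClass.continuous_of_bound π 1 fun f => by
      simpa only [one_mul] using NonUnitalStarAlgHom.norm_apply_le π f
  have htop : (StarAlgHom.equalizer π π').topologicalClosure = ⊤ := by
    refine ContinuousMap.starSubalgebra_topologicalClosure_eq_top_of_separatesPoints _ ?_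
    intro z w hzw
    by_cases h : z.1 = w.1
    · exact ⟨_, ⟨torusSnd, h2, rfl⟩, fun h' => hzw (Prod.ext h (Subtype.ext h'))⟩
    · exact ⟨_, ⟨torusFst, h1, rfl⟩, fun h' => h (Subtype.ext h')⟩
  have hcl : IsClosed (StarAlgHom.equalizer π π' : Set C(Circle × Circle, ℂ)) :=
    isClosed_eq (hc π) (hc π')
  ext1 f
  have hf : f ∈ (StarAlgHom.equalizer π π').topologicalClosure := htop ▸ StarSubalgebra.mem_top
  rwa [← SetLike.mem_coe, StarSubalgebra.topologicalClosure_coe, hcl.closure_eq] at hf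

variable {K : Type*} [TopologicalSpace K] [CompactSpace K]
  {H : Type*} [NormedAddCommGroup H] [InnerProductSpace ℂ H] [CompleteSpace H]

/-- The inclusion of real-valued in complex-valued continuous functions. -/
noncomputable def realToComplex (K : Type*) [TopologicalSpace K] : C(K, ℝ) →ₐ[ℝ] C(K, ℂ) :=
  AlgHom.compLeftContinuous ℝ Complex.ofRealAm Complex.continuous_ofReal

theorem realToComplex_apply (g : C(K, ℝ)) (z : K) : realToComplex K g z = g z := rfl

/-- The functional `g ↦ ⟪π(g) ξ, ξ⟫` on real continuous functions, which represents the spectral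
measure of the vector `ξ`. -/
noncomputable def spectralFunctional (π : C(K, ℂ) →⋆ₐ[ℂ] (H →L[ℂ] H)) (ξ : H) :
    C(K, ℝ) →ₗ[ℝ] ℝ where
  toFun g := (inner ℂ ξ (π (realToComplex K g) ξ)).re
  map_add' f g := by simp
  map_smul' c g := by
    have : realToComplex K (c • g) = (c : ℂ) • realToComplex K g := by
      ext z; simp [realToComplex_apply]
    rw [this, map_smul, _root_.smul_apply, inner_smul_right]
    simp

variable (π : C(K, ℂ) →⋆ₐ[ℂ] (H →L[ℂ] H)) (ξ : H)

theorem inner_map_star_mul_self (f : C(K, ℂ)) :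
    inner ℂ ξ (π (star f * f) ξ) = ((‖π f ξ‖ ^ 2 : ℝ) : ℂ) := by
  rw [map_mul, map_star, mul_apply_eq_comp, ContinuousLinearMap.star_eq_adjoint,
    ContinuousLinearMap.adjoint_inner_right, inner_self_eq_norm_sq_to_K]
  norm_cast

theorem spectralFunctional_eq_norm_sq (f : C(K, ℂ)) (g : C(K, ℝ)) (h : ∀ z, g z = ‖f z‖ ^ 2) :
    spectralFunctional π ξ g = ‖π f ξ‖ ^ 2 := by
  have : realToComplex K g = star f * f := by
    ext z
    rw [realToComplex_apply, h, ContinuousMap.mul_apply, ContinuousMap.star_apply,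
      RCLike.star_def, ← Complex.normSq_eq_conj_mul_self, Complex.normSq_eq_norm_sq]
  change (inner ℂ ξ (π (realToComplex K g) ξ)).re = _
  rw [this, inner_map_star_mul_self, Complex.ofReal_re]

theorem spectralFunctional_nonneg (g : C(K, ℝ)) (hg : ∀ z, 0 ≤ g z) :
    0 ≤ spectralFunctional π ξ g := by
  rw [spectralFunctional_eq_norm_sq π ξ (realToComplex K ⟨fun z => √(g z), by fun_prop⟩) g]
  · positivity
  · intro z
    simp [realToComplex_apply, Real.sq_sqrt (hg z)]

theorem spectralFunctional_mono {f g : C(K, ℝ)} (h : ∀ z, f z ≤ g z) :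
    spectralFunctional π ξ f ≤ spectralFunctional π ξ g := by
  have := spectralFunctional_nonneg π ξ (g - f) fun z => by simpa using h z
  rw [map_sub] at this
  linarith

theorem spectralFunctional_one : spectralFunctional π ξ 1 = ‖ξ‖ ^ 2 := by
  rw [spectralFunctional_eq_norm_sq π ξ 1 1 (by simp), map_one]
  rfl

theorem spectralFunctional_sub_le (η : H) (g : C(K, ℝ)) (hg : ∀ z, |g z| ≤ 1) :
    spectralFunctional π ξ g ≤ spectralFunctional π η g + ‖ξ - η‖ * (‖ξ‖ + ‖η‖) := by
  set T := π (realToComplex K g) with hT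
  have hTn : ‖T‖ ≤ 1 := by
    refine (NonUnitalStarAlgHom.norm_apply_le π _).trans ?_
    rw [ContinuousMap.norm_le _ zero_le_one]
    intro z
    rw [realToComplex_apply, Complex.norm_real]
    exact hg z
  have hTle : ∀ x, ‖T x‖ ≤ ‖x‖ := fun x =>
    (T.le_opNorm x).trans (mul_le_of_le_one_left (norm_nonneg _) hTn)
  have hsplit : inner ℂ ξ (T ξ) - inner ℂ η (T η) =
      inner ℂ (ξ - η) (T ξ) + inner ℂ η (T (ξ - η)) := by
    rw [inner_sub_left, map_sub, inner_sub_right]; ring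
  have hre : (inner ℂ ξ (T ξ)).re - (inner ℂ η (T η)).re ≤ ‖ξ - η‖ * ‖ξ‖ + ‖η‖ * ‖ξ - η‖ := by
    rw [← Complex.sub_re, hsplit]
    refine (Complex.re_le_norm _).trans ((norm_add_le _ _).trans (add_le_add ?_ ?_))
    · exact (norm_inner_le_norm _ _).trans (by gcongr; exact hTle _)
    · exact (norm_inner_le_norm _ _).trans (by gcongr; exact hTle _)
  change (inner ℂ ξ (T ξ)).re ≤ (inner ℂ η (T η)).re + _
  nlinarith

theorem spectralFunctional_comp {W : H →L[ℂ] H} (hW : W ∈ unitary (H →L[ℂ] H)) (e : C(K, K))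
    (h : ∀ f, W * π f = π (f.comp e) * W) (g : C(K, ℝ)) :
    spectralFunctional π (W ξ) (g.comp e) = spectralFunctional π ξ g := by
  change (inner ℂ (W ξ) (π (realToComplex K (g.comp e)) (W ξ))).re =
    (inner ℂ ξ (π (realToComplex K g) ξ)).re
  have h1 : π (realToComplex K (g.comp e)) (W ξ) = W (π (realToComplex K g) ξ) := by
    have := congrArg (fun T : H →L[ℂ] H => T ξ) (h (realToComplex K g))
    exact this.symm
  rw [h1, ← ContinuousLinearMap.adjoint_inner_right, ← ContinuousLinearMap.star_eq_adjoint,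
    ← mul_apply_eq_comp, (Unitary.mem_iff.1 hW).1, one_apply_eq_self]

theorem norm_unitary_pow_sub_le {W : H →L[ℂ] H} (hW : W ∈ unitary (H →L[ℂ] H)) (k : ℕ) :
    ‖(W ^ k) ξ - ξ‖ ≤ k * ‖W ξ - ξ‖ := by
  induction k with
  | zero => simp
  | succ k ih =>
    have hiso : ∀ x, ‖W x‖ = ‖x‖ := by
      intro x
      have h : inner ℂ (W x) (W x) = inner ℂ x x := by
        rw [← ContinuousLinearMap.adjoint_inner_right, ← ContinuousLinearMap.star_eq_adjoint,
          ← mul_apply_eq_comp, (Unitary.mem_iff.1 hW).1, one_apply_eq_self]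
      rw [inner_self_eq_norm_sq_to_K, inner_self_eq_norm_sq_to_K] at h
      have h' : ‖W x‖ ^ 2 = ‖x‖ ^ 2 := by exact_mod_cast h
      exact (pow_left_inj₀ (norm_nonneg _) (norm_nonneg _) two_ne_zero).1 h'
    have : (W ^ (k + 1)) ξ - ξ = W ((W ^ k) ξ - ξ) + (W ξ - ξ) := by
      rw [pow_succ', mul_apply_eq_comp, map_sub]; abel
    rw [this]
    refine (norm_add_le _ _).trans ?_
    rw [hiso, Nat.cast_add_one, add_mul, one_mul]
    exact add_le_add ih le_rfl

theorem Circle.norm_pow_sub_one_sub_le (z : Circle) (k : ℕ) :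
    ‖(z : ℂ) ^ k - 1 - k * ((z : ℂ) - 1)‖ ≤ (k : ℝ) ^ 2 * ‖(z : ℂ) - 1‖ ^ 2 := by
  induction k with
  | zero => simp
  | succ k ih =>
    have : (z : ℂ) ^ (k + 1) - 1 - ((k + 1 : ℕ) : ℂ) * ((z : ℂ) - 1) =
      z * ((z : ℂ) ^ k - 1 - k * ((z : ℂ) - 1)) + k * ((z : ℂ) - 1) ^ 2 := by push_cast; ring
    rw [this]
    refine (norm_add_le _ _).trans ?_
    rw [norm_mul, norm_mul, norm_pow, Circle.norm_coe, one_mul, Complex.norm_natCast]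
    push_cast
    nlinarith [sq_nonneg ‖(z : ℂ) - 1‖]

/-- A bump function supported on the sector `{|z₂ - 1| < 6/5 |z₁ - 1|}` near the origin of the torus
and away from the origin itself. -/
noncomputable def sectorBump (r s : ℝ) : C(Circle × Circle, ℝ) :=
  ⟨fun z => max 0 (min 1 (min ((6 / 5 * ‖(z.1 : ℂ) - 1‖ - ‖(z.2 : ℂ) - 1‖) / (s / 5))
    (2 - ‖(z.1 : ℂ) - 1‖ / r))), by fun_prop⟩

theorem sectorBump_nonneg (r s : ℝ) (z) : 0 ≤ sectorBump r s z := le_max_left _ _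

theorem sectorBump_le_one (r s : ℝ) (z) : sectorBump r s z ≤ 1 :=
  max_le zero_le_one (min_le_left _ _)

theorem sectorBump_eq_one {r s : ℝ} (hr : 0 < r) (hs : 0 < s) {z : Circle × Circle}
    (h1 : ‖(z.2 : ℂ) - 1‖ ≤ ‖(z.1 : ℂ) - 1‖) (h2 : s ≤ ‖(z.1 : ℂ) - 1‖)
    (h3 : ‖(z.1 : ℂ) - 1‖ ≤ r) : sectorBump r s z = 1 := by
  have e1 : 1 ≤ (6 / 5 * ‖(z.1 : ℂ) - 1‖ - ‖(z.2 : ℂ) - 1‖) / (s / 5) := by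
    rw [le_div_iff₀ (by positivity)]; linarith
  have e2 : 1 ≤ 2 - ‖(z.1 : ℂ) - 1‖ / r := by
    have : ‖(z.1 : ℂ) - 1‖ / r ≤ 1 := (div_le_one hr).2 h3
    linarith
  change max 0 (min 1 (min _ _)) = _
  rw [min_eq_left (le_min e1 e2), max_eq_right zero_le_one]

theorem lt_of_sectorBump_ne_zero {r s : ℝ} (hr : 0 < r) (hs : 0 < s) {z : Circle × Circle}
    (h : sectorBump r s z ≠ 0) :
    ‖(z.2 : ℂ) - 1‖ < 6 / 5 * ‖(z.1 : ℂ) - 1‖ ∧ ‖(z.1 : ℂ) - 1‖ < 2 * r := by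
  have h0 : 0 < sectorBump r s z := lt_of_le_of_ne (sectorBump_nonneg r s z) h.symm
  have h1 : 0 < min 1 (min ((6 / 5 * ‖(z.1 : ℂ) - 1‖ - ‖(z.2 : ℂ) - 1‖) / (s / 5))
    (2 - ‖(z.1 : ℂ) - 1‖ / r)) := by
    by_contra h2
    exact h0.ne' (max_eq_left (not_lt.1 h2))
  have h2 := (lt_min_iff.1 (lt_min_iff.1 h1).2)
  have h3 := (div_pos_iff_of_pos_right (by positivity)).1 h2.1
  have h4 : ‖(z.1 : ℂ) - 1‖ / r < 2 := by linarith [h2.2]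
  rw [div_lt_iff₀ hr] at h4
  exact ⟨by linarith, h4⟩

/-- The shear of the torus. -/
noncomputable def torusShear (k : ℕ) : C(Circle × Circle, Circle × Circle) :=
  ⟨fun z => (z.1, z.2 * z.1 ^ k), by fun_prop⟩

theorem sum_sectorBump_shear_le_one {J : ℕ} (hJ : 0 < J) {s : ℝ} (hs : 0 < s)
    (z : Circle × Circle) :
    ∑ a ∈ Finset.range J, sectorBump (1 / (36 * J)) s (torusShear (3 * a) z) ≤ 1 := by
  have hJ' : (0 : ℝ) < J := by exact_mod_cast hJ
  have hr : (0 : ℝ) < 1 / (36 * J) := by positivity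
  by_cases hne : ∃ a ∈ Finset.range J, sectorBump (1 / (36 * J)) s (torusShear (3 * a) z) ≠ 0
  swap
  · push Not at hne
    rw [Finset.sum_eq_zero hne]
    exact zero_le_one
  obtain ⟨a, ha, hane⟩ := hne
  rw [Finset.sum_eq_single_of_mem a ha]
  · exact sectorBump_le_one _ _ _
  intro b hb hba
  by_contra hbne
  wlog hlt : a < b generalizing a b
  · exact this b hb hbne a ha hba.symm hane (by omega)
  obtain ⟨a1, a2⟩ := lt_of_sectorBump_ne_zero hr hs hane
  obtain ⟨b1, -⟩ := lt_of_sectorBump_ne_zero hr hs hbne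
  obtain ⟨d, rfl⟩ := Nat.exists_eq_add_of_lt hlt
  set k := 3 * (d + 1) with hk
  change ‖((z.2 * z.1 ^ (3 * a) : Circle) : ℂ) - 1‖ < 6 / 5 * ‖(z.1 : ℂ) - 1‖ at a1
  change ‖((z.2 * z.1 ^ (3 * (a + d + 1)) : Circle) : ℂ) - 1‖ < 6 / 5 * ‖(z.1 : ℂ) - 1‖ at b1
  change ‖(z.1 : ℂ) - 1‖ < 2 * (1 / (36 * J)) at a2
  set w : Circle := z.2 * z.1 ^ (3 * a) with hw
  rw [show z.2 * z.1 ^ (3 * (a + d + 1)) = w * z.1 ^ k by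
    rw [hw, hk, mul_assoc, ← pow_add]; congr 2; ring] at b1
  have hup : ‖(z.1 : ℂ) ^ k - 1‖ < 12 / 5 * ‖(z.1 : ℂ) - 1‖ := by
    have h1 : ‖(z.1 : ℂ) ^ k - 1‖ = ‖(w : ℂ) * ((z.1 : ℂ) ^ k - 1)‖ := by
      rw [norm_mul, Circle.norm_coe, one_mul]
    have h2 : (w : ℂ) * ((z.1 : ℂ) ^ k - 1) = (((w * z.1 ^ k : Circle) : ℂ) - 1) - (w - 1) := by
      push_cast; ring
    rw [h1, h2]
    refine (norm_sub_le _ _).trans_lt ?_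
    linarith
  have hlow := Circle.norm_pow_sub_one_sub_le z.1 k
  have hk3 : (3 : ℝ) ≤ k := by rw [hk]; push_cast; linarith [(Nat.cast_nonneg d : (0 : ℝ) ≤ d)]
  have hkJ : (k : ℝ) ≤ 3 * J := by
    have : d + 1 ≤ J := by have := Finset.mem_range.1 hb; omega
    rw [hk]
    exact_mod_cast Nat.mul_le_mul_left 3 this
  set x := ‖(z.1 : ℂ) - 1‖ with hx
  have hx0 : 0 ≤ x := norm_nonneg _
  have hkx : k * x ≤ 1 / 6 := by
    have : x * (18 * J) < 1 := by
      rw [show (2 : ℝ) * (1 / (36 * J)) = 1 / (18 * J) by field_simp; norm_num] at a2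
      rwa [lt_div_iff₀ (by positivity)] at a2
    nlinarith
  have hnorm : (k : ℝ) * x ≤ ‖(z.1 : ℂ) ^ k - 1‖ + (k : ℝ) ^ 2 * x ^ 2 := by
    have h1 : ‖(k : ℂ) * ((z.1 : ℂ) - 1)‖ = k * x := by rw [norm_mul, Complex.norm_natCast]
    rw [← h1]
    have h2 : (k : ℂ) * ((z.1 : ℂ) - 1) = ((z.1 : ℂ) ^ k - 1) -
      ((z.1 : ℂ) ^ k - 1 - k * ((z.1 : ℂ) - 1)) := by ring
    rw [h2]
    exact (norm_sub_le _ _).trans (add_le_add le_rfl hlow)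
  have hx1 : 0 < x := by
    by_contra hx1
    have : x = 0 := le_antisymm (not_lt.1 hx1) hx0
    rw [this] at hup
    have := norm_nonneg ((z.1 : ℂ) ^ k - 1)
    linarith
  have h1 : (k : ℝ) ^ 2 * x ^ 2 ≤ 1 / 6 * (k * x) := by
    rw [← mul_pow, sq]
    exact mul_le_mul_of_nonneg_right hkx (by positivity)
  have h2 : 3 * x ≤ k * x := mul_le_mul_of_nonneg_right hk3 hx0
  linarith

end RelativePropertyT

section RelativePropertyT

open Filter Topology ContinuousMap

variable {H : Type*} [NormedAddCommGroup H] [InnerProductSpace ℂ H] [CompleteSpace H]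

theorem Circle.norm_pow_sub_one_le (z : Circle) (k : ℕ) :
    ‖(z : ℂ) ^ k - 1‖ ≤ k * ‖(z : ℂ) - 1‖ := by
  induction k with
  | zero => simp
  | succ k ih =>
    have : (z : ℂ) ^ (k + 1) - 1 = z * ((z : ℂ) ^ k - 1) + (z - 1) := by ring
    rw [this]
    refine (norm_add_le _ _).trans ?_
    rw [norm_mul, Circle.norm_coe, one_mul]
    push_cast
    linarith

theorem intertwine_torusShear (π : C(Circle × Circle, ℂ) →⋆ₐ[ℂ] (H →L[ℂ] H)) {W : H →L[ℂ] H}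
    (hW : W ∈ unitary (H →L[ℂ] H)) (h1 : W * π torusFst = π torusFst * W)
    (h2 : W * π torusSnd = π torusSnd * π torusFst * W) (k : ℕ) (f : C(Circle × Circle, ℂ)) :
    W ^ k * π f = π (f.comp (torusShear k)) * W ^ k := by
  have hone : ∀ f, W * π f = π (f.comp (torusShear 1)) * W := by
    have key : (Unitary.conjStarAlgAut ℂ (H →L[ℂ] H) ⟨W, hW⟩ : _ →⋆ₐ[ℂ] _).comp π =
        π.comp (ContinuousMap.compStarAlgHom' ℂ ℂ (torusShear 1)) := by
      refine starAlgHom_torus_ext ?_ ?_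
      · change W * π torusFst * star W = π (torusFst.comp (torusShear 1))
        rw [h1, mul_assoc, (Unitary.mem_iff.1 hW).2, mul_one]
        rfl
      · change W * π torusSnd * star W = π (torusSnd.comp (torusShear 1))
        rw [h2, mul_assoc, (Unitary.mem_iff.1 hW).2, mul_one, ← map_mul]
        congr 1
        ext z
        simp [torusSnd, torusFst, torusShear]
    intro f
    have := congrArg (fun φ : C(Circle × Circle, ℂ) →⋆ₐ[ℂ] (H →L[ℂ] H) => φ f) key
    change W * π f * star W = π (f.comp (torusShear 1)) at this
    rw [← this, mul_assoc, (Unitary.mem_iff.1 hW).1, mul_one]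
  induction k generalizing f with
  | zero =>
    rw [pow_zero, one_mul, mul_one]
    congr 1
    ext z
    simp [torusShear]
  | succ k ih =>
    rw [pow_succ', mul_assoc, ih, ← mul_assoc, hone, mul_assoc]
    congr 2
    ext z
    simp [torusShear, mul_assoc, pow_succ']

theorem spectralFunctional_sectorBump_le (π : C(Circle × Circle, ℂ) →⋆ₐ[ℂ] (H →L[ℂ] H))
    {W : H →L[ℂ] H} (hW : W ∈ unitary (H →L[ℂ] H)) (h1 : W * π torusFst = π torusFst * W)
    (h2 : W * π torusSnd = π torusSnd * π torusFst * W) {ξ : H} (hξ : ‖ξ‖ = 1) {J : ℕ} (hJ : 0 < J)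
    {s : ℝ} (hs : 0 < s) :
    spectralFunctional π ξ (sectorBump (1 / (36 * J)) s) ≤ 1 / J + 6 * J * ‖W ξ - ξ‖ := by
  have hJ' : (0 : ℝ) < J := by exact_mod_cast hJ
  set g := sectorBump (1 / (36 * J)) s with hg
  have habs : ∀ z, |g z| ≤ 1 := fun z => by
    rw [abs_of_nonneg (sectorBump_nonneg _ _ _)]; exact sectorBump_le_one _ _ _
  have hstep : ∀ a ∈ Finset.range J, spectralFunctional π ξ g ≤
      spectralFunctional π ξ (g.comp (torusShear (3 * a))) + 6 * J * ‖W ξ - ξ‖ := by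
    intro a ha
    have hWk : W ^ (3 * a) ∈ unitary (H →L[ℂ] H) := pow_mem hW _
    have hnorm : ‖(W ^ (3 * a)) ξ‖ = 1 := by
      rw [← hξ]
      have h : inner ℂ ((W ^ (3 * a)) ξ) ((W ^ (3 * a)) ξ) = inner ℂ ξ ξ := by
        rw [← ContinuousLinearMap.adjoint_inner_right, ← ContinuousLinearMap.star_eq_adjoint,
          ← mul_apply_eq_comp, (Unitary.mem_iff.1 hWk).1, one_apply_eq_self]
      rw [inner_self_eq_norm_sq_to_K, inner_self_eq_norm_sq_to_K] at h
      exact (pow_left_inj₀ (norm_nonneg _) (norm_nonneg _) two_ne_zero).1 (by exact_mod_cast h)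
    rw [← spectralFunctional_comp π ξ hWk _ (intertwine_torusShear π hW h1 h2 _) g]
    have habs' : ∀ z, |g.comp (torusShear (3 * a)) z| ≤ 1 := fun z => habs (torusShear (3 * a) z)
    refine (spectralFunctional_sub_le π ((W ^ (3 * a)) ξ) ξ _ habs').trans ?_
    clear_value g
    rw [hnorm, hξ]
    have h3 := norm_unitary_pow_sub_le ξ hW (3 * a)
    have h4 : (a : ℝ) ≤ J := by exact_mod_cast (Finset.mem_range.1 ha).le
    rw [Nat.cast_mul, Nat.cast_ofNat] at h3
    have h5 := mul_le_mul_of_nonneg_right h4 (norm_nonneg (W ξ - ξ))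
    linarith
  have hsum := Finset.sum_le_sum hstep
  rw [Finset.sum_const, Finset.card_range, Finset.sum_add_distrib, Finset.sum_const,
    Finset.card_range, ← map_sum, nsmul_eq_mul, nsmul_eq_mul] at hsum
  have hle : spectralFunctional π ξ (∑ a ∈ Finset.range J, g.comp (torusShear (3 * a))) ≤ 1 := by
    refine (spectralFunctional_mono π ξ (g := 1) fun z => ?_).trans
      (by rw [spectralFunctional_one, hξ, one_pow])
    rw [ContinuousMap.sum_apply]
    exact sum_sectorBump_shear_le_one hJ hs z
  rw [← mul_le_mul_iff_right₀ hJ']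
  rw [mul_add, mul_one_div_cancel hJ'.ne']
  linarith

/-- Quantitative relative property (T) for the pair `(ℤ² ⋊ SL₂(ℤ), ℤ²)`. -/
theorem norm_pow_sub_sq_le {u v W W' : H →L[ℂ] H} (hu : u ∈ unitary (H →L[ℂ] H))
    (hv : v ∈ unitary (H →L[ℂ] H)) (hW : W ∈ unitary (H →L[ℂ] H)) (hW' : W' ∈ unitary (H →L[ℂ] H))
    (huv : u * v = v * u) (hWu : W * u = u * W) (hWv : W * v = v * u * W)
    (hWv' : W' * v = v * W') (hWu' : W' * u = u * v * W') {ξ : H} (hξ : ‖ξ‖ = 1) {J : ℕ}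
    (hJ : 0 < J) (a : ℕ) :
    ‖(u ^ a) ξ - ξ‖ ^ 2 ≤ 4 * (2 / J + 6 * J * ‖W ξ - ξ‖ + 6 * J * ‖W' ξ - ξ‖ +
      (36 * J) ^ 2 * (‖u ξ - ξ‖ ^ 2 + ‖v ξ - ξ‖ ^ 2)) := by
  have hJ' : (0 : ℝ) < J := by exact_mod_cast hJ
  obtain ⟨π, rfl, rfl⟩ := exists_starAlgHom_torus hu hv huv
  let swap : C(Circle × Circle, Circle × Circle) := ⟨Prod.swap, continuous_swap⟩
  let π' := π.comp (ContinuousMap.compStarAlgHom' ℂ ℂ swap)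
  have hfst : π' torusFst = π torusSnd := rfl
  have hsnd : π' torusSnd = π torusFst := rfl
  have hsf : ∀ g, spectralFunctional π' ξ g = spectralFunctional π ξ (g.comp swap) := fun _ => rfl
  refine le_of_forall_pos_le_add fun η hη => ?_
  obtain ⟨s, hs, hs1, hsη⟩ : ∃ s : ℝ, 0 < s ∧ s ≤ 1 ∧ (a : ℝ) ^ 2 * s ≤ η := by
    refine ⟨min 1 (η / (a ^ 2 + 1)), by positivity, min_le_left _ _, ?_⟩
    calc (a : ℝ) ^ 2 * min 1 (η / (a ^ 2 + 1)) ≤ (a ^ 2 + 1) * (η / (a ^ 2 + 1)) := by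
          gcongr
          · linarith
          · exact min_le_right _ _
      _ = η := by field_simp
  have b1 := spectralFunctional_sectorBump_le π hW hWu hWv hξ hJ hs
  have b2 := spectralFunctional_sectorBump_le π' hW' (by rw [hfst]; exact hWv')
    (by rw [hfst, hsnd]; exact hWu') hξ hJ hs
  rw [hsf] at b2
  let n1 : C(Circle × Circle, ℝ) := ⟨fun z => ‖(z.1 : ℂ) - 1‖ ^ 2, by fun_prop⟩
  let n2 : C(Circle × Circle, ℝ) := ⟨fun z => ‖(z.2 : ℂ) - 1‖ ^ 2, by fun_prop⟩
  let na : C(Circle × Circle, ℝ) := ⟨fun z => ‖(z.1 : ℂ) ^ a - 1‖ ^ 2, by fun_prop⟩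
  have e1 : spectralFunctional π ξ n1 = ‖π torusFst ξ - ξ‖ ^ 2 := by
    rw [spectralFunctional_eq_norm_sq π ξ (torusFst - 1) n1 fun z => rfl]
    simp
  have e2 : spectralFunctional π ξ n2 = ‖π torusSnd ξ - ξ‖ ^ 2 := by
    rw [spectralFunctional_eq_norm_sq π ξ (torusSnd - 1) n2 fun z => rfl]
    simp
  have ea : spectralFunctional π ξ na = ‖(π torusFst ^ a) ξ - ξ‖ ^ 2 := by
    rw [spectralFunctional_eq_norm_sq π ξ (torusFst ^ a - 1) na fun z => rfl, map_sub, map_pow,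
      map_one]
    rfl
  have hbound : spectralFunctional π ξ na ≤ spectralFunctional π ξ (η • (1 : C(Circle × Circle, ℝ)) +
      (4 : ℝ) • (sectorBump (1 / (36 * J)) s + (sectorBump (1 / (36 * J)) s).comp swap +
        ((36 * J : ℝ) ^ 2) • (n1 + n2))) := by
    refine spectralFunctional_mono π ξ fun z => ?_
    have hA := sectorBump_nonneg (1 / (36 * J)) s z
    have hA' := sectorBump_nonneg (1 / (36 * J)) s (swap z)
    have hr : (0 : ℝ) < 1 / (36 * J) := by positivity
    change ‖(z.1 : ℂ) ^ a - 1‖ ^ 2 ≤ η * 1 + 4 * (sectorBump (1 / (36 * J)) s z +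
      sectorBump (1 / (36 * J)) s (swap z) +
        (36 * J) ^ 2 * (‖(z.1 : ℂ) - 1‖ ^ 2 + ‖(z.2 : ℂ) - 1‖ ^ 2))
    set x := ‖(z.1 : ℂ) - 1‖ with hx
    set y := ‖(z.2 : ℂ) - 1‖ with hy
    have hx0 : 0 ≤ x := norm_nonneg _
    have hy0 : 0 ≤ y := norm_nonneg _
    have h2 : ‖(z.1 : ℂ) ^ a - 1‖ ≤ 2 := by
      refine (norm_sub_le _ _).trans ?_
      rw [norm_pow, Circle.norm_coe, norm_one, one_pow]; norm_num
    have h4 : ‖(z.1 : ℂ) ^ a - 1‖ ^ 2 ≤ 4 := by nlinarith [norm_nonneg ((z.1 : ℂ) ^ a - 1)]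
    have hJx : (0 : ℝ) ≤ (36 * J) ^ 2 * x ^ 2 := by positivity
    have hJy : (0 : ℝ) ≤ (36 * J) ^ 2 * y ^ 2 := by positivity
    have hfar : ∀ t : ℝ, 1 / (36 * J) < t → 1 ≤ (36 * J : ℝ) ^ 2 * t ^ 2 := by
      intro t ht
      rw [div_lt_iff₀ (by positivity)] at ht
      rw [← mul_pow]
      exact one_le_pow₀ (by linarith)
    by_cases hxr : 1 / (36 * J) < x
    · linarith [hfar x hxr]
    by_cases hyr : 1 / (36 * J) < y
    · linarith [hfar y hyr]
    push Not at hxr hyr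
    by_cases hxs : x < s
    · have hpow : ‖(z.1 : ℂ) ^ a - 1‖ ≤ a * x := Circle.norm_pow_sub_one_le _ _
      have : ‖(z.1 : ℂ) ^ a - 1‖ ^ 2 ≤ (a * x) ^ 2 := by gcongr
      have h6 : (a * x) ^ 2 ≤ a ^ 2 * s := by
        rw [mul_pow]
        have : x ^ 2 ≤ s := by nlinarith
        gcongr
      linarith
    push Not at hxs
    rcases le_total y x with hyx | hyx
    · rw [sectorBump_eq_one hr hs hyx hxs hxr]; linarith
    · rw [sectorBump_eq_one (z := swap z) hr hs hyx (hxs.trans hyx) hyr]; linarith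
  rw [ea] at hbound
  refine hbound.trans ?_
  simp only [map_add, map_smul, smul_eq_mul, e1, e2, spectralFunctional_one, hξ]
  have : (2 : ℝ) / J = 1 / J + 1 / J := by ring
  rw [this]
  linarith

/-- Uniform version: vectors almost fixed by the generators are almost fixed by all the powers
of `u`. -/
theorem exists_norm_pow_sub_le {δ : ℝ} (hδ : 0 < δ) : ∃ ε > 0, ∀ {H : Type*}
    [NormedAddCommGroup H] [InnerProductSpace ℂ H] [CompleteSpace H] {u v W W' : H →L[ℂ] H},
    u ∈ unitary (H →L[ℂ] H) → v ∈ unitary (H →L[ℂ] H) → W ∈ unitary (H →L[ℂ] H) →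
    W' ∈ unitary (H →L[ℂ] H) → u * v = v * u → W * u = u * W → W * v = v * u * W →
    W' * v = v * W' → W' * u = u * v * W' → ∀ ξ : H, ‖ξ‖ = 1 → ‖u ξ - ξ‖ ≤ ε → ‖v ξ - ξ‖ ≤ ε →
    ‖W ξ - ξ‖ ≤ ε → ‖W' ξ - ξ‖ ≤ ε → ∀ a : ℕ, ‖(u ^ a) ξ - ξ‖ ≤ δ := by
  obtain ⟨J, hJ⟩ := exists_nat_gt (16 / δ ^ 2)
  have hJ' : (0 : ℝ) < J := lt_trans (by positivity) hJ
  have hJ0 : 0 < J := by exact_mod_cast hJ'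
  set C : ℝ := 12 * J + 2 * (36 * J) ^ 2 with hC
  have hCpos : 0 < C := by positivity
  refine ⟨min 1 (δ ^ 2 / (8 * C)), by positivity, ?_⟩
  intro H _ _ _ u v W W' hu hv hW hW' huv h1 h2 h3 h4 ξ hξ hu1 hv1 hW1 hW1' a
  have key := norm_pow_sub_sq_le hu hv hW hW' huv h1 h2 h3 h4 hξ hJ0 a
  set ε := min 1 (δ ^ 2 / (8 * C)) with hε
  have hε0 : 0 < ε := by positivity
  have hε1 : ε ≤ 1 := min_le_left _ _
  have hε2 : C * ε ≤ δ ^ 2 / 8 := by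
    calc C * ε ≤ C * (δ ^ 2 / (8 * C)) := by gcongr; exact min_le_right _ _
      _ = δ ^ 2 / 8 := by field_simp
  have hsq : ∀ t : ℝ, 0 ≤ t → t ≤ ε → t ^ 2 ≤ ε := fun t h0 ht => by nlinarith
  have s1 := hsq _ (norm_nonneg _) hu1
  have s2 := hsq _ (norm_nonneg _) hv1
  have hJδ : 2 / (J : ℝ) ≤ δ ^ 2 / 8 := by
    rw [div_lt_iff₀ (by positivity)] at hJ
    rw [div_le_iff₀ hJ']
    linarith
  have hfin : ‖(u ^ a) ξ - ξ‖ ^ 2 ≤ δ ^ 2 := by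
    refine key.trans ?_
    have t1 : 6 * J * ‖W ξ - ξ‖ ≤ 6 * J * ε := by gcongr
    have t2 : 6 * J * ‖W' ξ - ξ‖ ≤ 6 * J * ε := by gcongr
    have t3 : (36 * J : ℝ) ^ 2 * (‖u ξ - ξ‖ ^ 2 + ‖v ξ - ξ‖ ^ 2) ≤ (36 * J) ^ 2 * (ε + ε) := by
      gcongr
    have : C * ε = 6 * J * ε + 6 * J * ε + (36 * J) ^ 2 * (ε + ε) := by rw [hC]; ring
    linarith
  exact (pow_le_pow_iff_left₀ (norm_nonneg _) hδ.le two_ne_zero).1 hfin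

end RelativePropertyT

section MassTransport

open MeasureTheory ProbabilityTheory

variable {X Z W H : Type*} [MeasurableSpace X] [StandardBorelSpace X] [Nonempty X]
  [MeasurableSpace Z] [MeasurableEq Z] [MeasurableSpace W] [MeasurableEq W]
  [Group H] [Countable H]

lemma ae_condDistrib_fiber (μ : Measure X) [IsFiniteMeasure μ] {Θ : X → Z} (hΘ : Measurable Θ) :
    ∀ᵐ z ∂(μ.map Θ), ∀ᵐ y ∂(condDistrib id Θ μ z), Θ y = z := by
  apply Measure.ae_ae_of_ae_compProd (p := fun q : Z × X => Θ q.2 = q.1)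
  rw [compProd_map_condDistrib aemeasurable_id]
  rw [ae_map_iff (hΘ.prodMk measurable_id).aemeasurable]
  · simp
  · exact measurableSet_eq_fun (hΘ.comp measurable_snd) measurable_fst

lemma measurable_kernel_fiber {X Z W : Type*} [MeasurableSpace X] [MeasurableSpace Z]
    [MeasurableSpace W] [MeasurableEq W] {κ : Kernel Z X} [IsSFiniteKernel κ] {L : X → W}
    (hL : Measurable L) : Measurable fun q : Z × X => κ q.1 {y | L y = L q.2} := by
  have h := Kernel.measurable_kernel_prodMk_left (κ := κ.comap (Prod.fst : Z × X → Z)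
    measurable_fst) (t := {r : (Z × X) × X | L r.2 = L r.1.2})
    (measurableSet_eq_fun (hL.comp measurable_snd) (hL.comp (measurable_snd.comp measurable_fst)))
  exact h

lemma ae_condDistrib_class_pos (μ : Measure X) [IsFiniteMeasure μ] {Θ : X → Z}
    (hΘ : Measurable Θ) {L : X → W} (hL : Measurable L)
    (hfib : ∀ x, ∃ T : Set W, T.Countable ∧ ∀ y, Θ y = Θ x → L y ∈ T) :
    ∀ᵐ x ∂μ, condDistrib id Θ μ (Θ x) {y | L y = L x} ≠ 0 := by
  have hmeas : MeasurableSet {q : Z × X | condDistrib id Θ μ q.1 {y | L y = L q.2} ≠ 0} :=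
    (measurable_kernel_fiber hL) (measurableSet_singleton 0).compl
  have key : ∀ᵐ q ∂((μ.map Θ) ⊗ₘ condDistrib id Θ μ),
      condDistrib id Θ μ q.1 {y | L y = L q.2} ≠ 0 := by
    rw [Measure.ae_compProd_iff hmeas]
    filter_upwards [ae_condDistrib_fiber μ hΘ] with z hz
    by_cases hx : ∃ x, Θ x = z
    · obtain ⟨x, rfl⟩ := hx
      obtain ⟨T, hT, hTx⟩ := hfib x
      have hnull : ∀ᵐ y ∂(condDistrib id Θ μ (Θ x)),
          ∀ t ∈ T, L y = t → condDistrib id Θ μ (Θ x) {y | L y = t} ≠ 0 := by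
        rw [ae_ball_iff hT]
        intro t _
        by_cases h0 : condDistrib id Θ μ (Θ x) {y | L y = t} = 0
        · have : ∀ᵐ y ∂(condDistrib id Θ μ (Θ x)), ¬ L y = t := by
            rw [ae_iff]; simpa using h0
          filter_upwards [this] with y hy h using absurd h hy
        · exact Filter.Eventually.of_forall fun _ _ => h0
      filter_upwards [hz, hnull] with y hy hn
      exact hn _ (hTx y hy) rfl
    · filter_upwards [hz] with y hy using absurd ⟨y, hy⟩ hx
  rw [compProd_map_condDistrib aemeasurable_id,
    ae_map_iff (hΘ.prodMk measurable_id).aemeasurable hmeas] at key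
  exact key

/-- Mass transport: if the fibres of `Θ` meet only countably many classes of `L`, and a countable
group moves almost every point essentially freely across the classes of `L`, then almost every
point returns to its own fibre of `Θ` only finitely often. -/
lemma ae_finite_return (μ : Measure X) [IsFiniteMeasure μ] {T : H → X → X}
    (hT1 : ∀ x, T 1 x = x) (hTmul : ∀ g h x, T (g * h) x = T g (T h x))
    (hTμ : ∀ h, MeasurePreserving (T h) μ μ)
    {Θ : X → Z} (hΘ : Measurable Θ) {L : X → W} (hL : Measurable L)
    (hfib : ∀ x, ∃ T : Set W, T.Countable ∧ ∀ y, Θ y = Θ x → L y ∈ T)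
    (c : H) (hfree : ∀ᵐ x ∂μ, ∀ h h', L (T h x) = L (T h' x) → h' = h ∨ h' = c * h) :
    ∀ᵐ x ∂μ, {h | Θ (T h x) = Θ x}.Finite := by
  classical
  set κ := condDistrib id Θ μ with hκ
  set a : X → ENNReal := fun x => κ (Θ x) {y | L y = L x} with ha
  have ham : Measurable a := (measurable_kernel_fiber hL).comp (hΘ.prodMk measurable_id)
  set C : H → Set X := fun h => {x | Θ (T h x) = Θ x} with hC
  have hCm : ∀ h, MeasurableSet (C h) := fun h =>
    measurableSet_eq_fun (hΘ.comp (hTμ h).measurable) hΘ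
  have hswap : ∀ h, ∫⁻ x, (C h).indicator a x ∂μ
      = ∫⁻ x, (C h⁻¹).indicator (fun x => a (T h⁻¹ x)) x ∂μ := by
    intro h
    rw [← (hTμ h⁻¹).lintegral_comp (ham.indicator (hCm h))]
    congr 1; ext x
    have : T h⁻¹ x ∈ C h ↔ x ∈ C h⁻¹ := by
      simp only [hC, Set.mem_ofPred_eq, ← hTmul, mul_inv_cancel, hT1]
      exact eq_comm
    by_cases hx : x ∈ C h⁻¹
    · rw [Set.indicator_of_mem hx, Set.indicator_of_mem (this.2 hx)]
    · rw [Set.indicator_of_notMem hx, Set.indicator_of_notMem (fun h => hx (this.1 h))]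
  have hbound : ∀ᵐ x ∂μ, ∑' h : H, (C h).indicator (fun x => a (T h x)) x ≤ 2 := by
    filter_upwards [hfree] with x hx
    calc ∑' h : H, (C h).indicator (fun x => a (T h x)) x
        ≤ ∑' h : H, κ (Θ x) {y | L y = L (T h x)} := by
          refine ENNReal.tsum_le_tsum fun h => ?_
          by_cases hxc : x ∈ C h
          · rw [Set.indicator_of_mem hxc, ha]
            simp only
            rw [show Θ (T h x) = Θ x from hxc]
          · rw [Set.indicator_of_notMem hxc]; exact zero_le
      _ = ∑' h : H, ∫⁻ y, {y | L y = L (T h x)}.indicator 1 y ∂(κ (Θ x)) := by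
          congr 1; ext h
          rw [lintegral_indicator_one]
          exact hL (measurableSet_singleton _)
      _ = ∫⁻ y, ∑' h : H, {y | L y = L (T h x)}.indicator 1 y ∂(κ (Θ x)) := by
          rw [lintegral_tsum]
          exact fun h => (measurable_one.indicator (hL (measurableSet_singleton _))).aemeasurable
      _ ≤ ∫⁻ _, 2 ∂(κ (Θ x)) := by
          refine lintegral_mono fun y => ?_
          by_cases hex : ∃ h₀, L y = L (T h₀ x)
          · obtain ⟨h₀, hh₀⟩ := hex
            rw [tsum_eq_sum (s := {h₀, c * h₀})]
            · refine (Finset.sum_le_card_nsmul _ _ 1 fun h _ => ?_).trans ?_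
              · exact Set.indicator_le_self' (by simp) y
              · rw [nsmul_one]
                exact_mod_cast Finset.card_le_two
            · intro h hh
              refine Set.indicator_of_notMem (fun hy => hh ?_) _
              have := hx h₀ h (hh₀.symm.trans hy)
              simpa using this
          · have : ∀ h : H, ({y | L y = L (T h x)} : Set X).indicator (1 : X → ENNReal) y = 0 :=
              fun h => Set.indicator_of_notMem (s := {y | L y = L (T h x)})
                (fun hy => hex ⟨h, hy⟩) _
            simp [this]
      _ ≤ 2 := by simp [hκ]
  have hbound : ∫⁻ x, a x * ∑' h : H, (C h).indicator 1 x ∂μ ≠ ⊤ := by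
    have h1 : ∫⁻ x, a x * ∑' h : H, (C h).indicator 1 x ∂μ
        = ∑' h : H, ∫⁻ x, (C h).indicator a x ∂μ := by
      rw [← lintegral_tsum fun h => (ham.indicator (hCm h)).aemeasurable]
      congr 1; ext x
      rw [← ENNReal.tsum_mul_left]
      congr 1; ext h
      by_cases hx : x ∈ C h <;> simp [hx]
    rw [h1]
    simp_rw [hswap]
    have hinv := (Equiv.inv H).tsum_eq
      (fun h => ∫⁻ x, (C h).indicator (fun x => a (T h x)) x ∂μ)
    simp only [Equiv.inv_apply] at hinv
    rw [hinv, ← lintegral_tsum (f := fun h x => (C h).indicator (fun x => a (T h x)) x) fun h =>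
        ((ham.comp (hTμ h).measurable).indicator (hCm h)).aemeasurable]
    refine ne_top_of_le_ne_top ?_ (lintegral_mono_ae hbound)
    simpa using ENNReal.mul_ne_top (by simp) (measure_ne_top μ _)
  have hm : Measurable fun x => a x * ∑' h : H, (C h).indicator (1 : X → ENNReal) x :=
    ham.mul (Measurable.tsum fun h => measurable_one.indicator (hCm h))
  filter_upwards [ae_lt_top hm hbound, ae_condDistrib_class_pos μ hΘ hL hfib] with x hx hx0
  have hne : ∑' h : H, (C h).indicator (1 : X → ENNReal) x ≠ ⊤ := by
    intro htop
    rw [htop, ENNReal.mul_top hx0] at hx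
    exact lt_irrefl _ hx
  refine (ENNReal.finite_const_le_of_tsum_ne_top hne one_ne_zero).subset fun h hh => ?_
  change 1 ≤ (C h).indicator (1 : X → ENNReal) x
  rw [Set.indicator_of_mem (show x ∈ C h from hh)]
  rfl

end MassTransport

section ReturnFraction

open MeasureTheory

lemma false_of_five_mul_le {m I I' : ENNReal} (hm : m ≠ ⊤) (hm0 : m ≠ 0)
    (h1 : 5 * I ≤ m + 5 * (m / 20)) (h2 : 5 * I' ≤ m + 5 * (m / 20)) (h3 : m ≤ I + I') :
    False := by
  have hlt : m + 5 * (m / 20) < ⊤ := ENNReal.add_lt_top.2 ⟨hm.lt_top,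
    ENNReal.mul_lt_top (by simp) (ENNReal.div_lt_top hm (by norm_num))⟩
  have hIt : I ≠ ⊤ := by
    rintro rfl
    rw [ENNReal.mul_top (by norm_num)] at h1
    exact absurd h1 (not_le.2 hlt)
  have hIt' : I' ≠ ⊤ := by
    rintro rfl
    rw [ENNReal.mul_top (by norm_num)] at h2
    exact absurd h2 (not_le.2 hlt)
  lift I to NNReal using hIt
  lift I' to NNReal using hIt'
  lift m to NNReal using hm
  have hdiv : (m : ENNReal) / 20 = ((m / 20 : NNReal) : ENNReal) := by
    rw [ENNReal.coe_div (by norm_num)]; simp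
  rw [hdiv] at h1 h2
  norm_cast at h1 h2 h3 hm0
  have hy : 0 < (m : ℝ) := by exact_mod_cast pos_iff_ne_zero.2 hm0
  have h1' : 5 * (I : ℝ) ≤ m + 5 * (m / 20) := by exact_mod_cast h1
  have h2' : 5 * (I' : ℝ) ≤ m + 5 * (m / 20) := by exact_mod_cast h2
  have h3' : (m : ℝ) ≤ I + I' := by exact_mod_cast h3
  linarith

variable {X Z W H : Type*}

open Classical in
/-- The number of elements of `A` that return the point `x` to its own fibre of `Θ`. -/
noncomputable def returnCount (T : H → X → X) (Θ : X → Z) (A : Set H) (x : X) : ENNReal :=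
  ∑' h : H, if Θ (T h x) = Θ x ∧ h ∈ A then 1 else 0

lemma measurable_returnCount [Countable H] [MeasurableSpace X] [MeasurableSpace Z] [MeasurableEq Z]
    {T : H → X → X} (hT : ∀ h, Measurable (T h)) {Θ : X → Z} (hΘ : Measurable Θ) (A : Set H) :
    Measurable (returnCount T Θ A) := by
  classical
  refine Measurable.tsum fun h => Measurable.ite ?_ measurable_const measurable_const
  by_cases hA : h ∈ A
  · simpa [hA] using measurableSet_eq_fun (hΘ.comp (hT h)) hΘ
  · simp [hA]

lemma measurable_returnFraction [Countable H] [MeasurableSpace X] [MeasurableSpace Z]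
    [MeasurableEq Z] {T : H → X → X} (hT : ∀ h, Measurable (T h)) {Θ : X → Z} (hΘ : Measurable Θ)
    (A : Set H) : Measurable fun x => returnCount T Θ A x / returnCount T Θ Set.univ x :=
  (measurable_returnCount hT hΘ A).div (measurable_returnCount hT hΘ Set.univ)

lemma returnCount_translate [Group H] {T : H → X → X}
    (hTmul : ∀ g h x, T (g * h) x = T g (T h x)) {Θ : X → Z} (A : Set H) {u : H} {x : X}
    (hx : Θ (T u x) = Θ x) :
    returnCount T Θ A (T u x) = returnCount T Θ {h | h * u⁻¹ ∈ A} x := by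
  classical
  unfold returnCount
  rw [← (Equiv.mulRight u).tsum_eq
    (fun h => if Θ (T h x) = Θ x ∧ h ∈ {h | h * u⁻¹ ∈ A} then (1 : ENNReal) else 0)]
  simp [hTmul, hx]

lemma sum_returnCount_le {T : H → X → X} {Θ : X → Z} {ι : Type*} [Fintype ι] (A : ι → Set H)
    (hA : ∀ h i j, h ∈ A i → h ∈ A j → i = j) (x : X) :
    ∑ i, returnCount T Θ (A i) x ≤ returnCount T Θ Set.univ x := by
  classical
  unfold returnCount
  rw [← Summable.tsum_finsetSum fun _ _ => ENNReal.summable]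
  refine ENNReal.tsum_le_tsum fun h => ?_
  by_cases hex : ∃ i, h ∈ A i ∧ Θ (T h x) = Θ x
  · obtain ⟨i, hi, hx⟩ := hex
    rw [Finset.sum_eq_single i]
    · simp [hi, hx]
    · intro j _ hj
      rw [if_neg]
      rintro ⟨-, h'⟩
      exact hj (hA h j i h' hi)
    · simp
  · rw [Finset.sum_eq_zero]
    · exact zero_le
    · intro i _
      rw [if_neg]
      rintro ⟨h1, h2⟩
      exact hex ⟨i, h2, h1⟩

lemma returnCount_univ_le_add {T : H → X → X} {Θ : X → Z} {A A' : Set H}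
    (hA : ∀ h, h ∈ A ∨ h ∈ A') (x : X) :
    returnCount T Θ Set.univ x ≤ returnCount T Θ A x + returnCount T Θ A' x := by
  classical
  unfold returnCount
  rw [← ENNReal.tsum_add]
  refine ENNReal.tsum_le_tsum fun h => ?_
  by_cases hx : Θ (T h x) = Θ x
  · rcases hA h with h1 | h1 <;> simp [hx, h1]
  · simp [hx]

lemma returnCount_ne_top {T : H → X → X} {Θ : X → Z} {A : Set H} {x : X}
    (hx : {h | Θ (T h x) = Θ x}.Finite) : returnCount T Θ A x ≠ ⊤ := by
  classical
  rw [returnCount, tsum_eq_sum (s := hx.toFinset)]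
  · refine ENNReal.sum_ne_top.2 fun h _ => ?_
    split_ifs <;> simp
  · intro h hh
    rw [if_neg]
    rintro ⟨h1, -⟩
    exact hh (by simpa using h1)

lemma returnCount_mono {T : H → X → X} {Θ : X → Z} {A A' : Set H} (hA : A ⊆ A') (x : X) :
    returnCount T Θ A x ≤ returnCount T Θ A' x := by
  classical
  refine ENNReal.tsum_le_tsum fun h => ?_
  split_ifs with h1 h2
  · exact le_rfl
  · exact absurd ⟨h1.1, hA h1.2⟩ h2
  · exact zero_le
  · exact le_rfl

variable [Group H] [Countable H] [MeasurableSpace X] [MeasurableSpace Z] [MeasurableEq Z]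

lemma lintegral_returnFraction_le {μ : Measure X} [IsFiniteMeasure μ] {T : H → X → X}
    (hTmul : ∀ g h x, T (g * h) x = T g (T h x))
    (hTμ : ∀ h, MeasurePreserving (T h) μ μ) {Θ : X → Z} (hΘ : Measurable Θ)
    {Y : Set X} (hY : MeasurableSet Y) {u : H} (hu : ∀ x, T u x ∈ Y ↔ x ∈ Y) (A : Set H) :
    ∫⁻ x in Y, returnCount T Θ A x / returnCount T Θ Set.univ x ∂μ ≤
      ∫⁻ x in Y, returnCount T Θ {h | h * u⁻¹ ∈ A} x / returnCount T Θ Set.univ x ∂μ +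
        μ {x | x ∈ Y ∧ Θ (T u x) ≠ Θ x} := by
  classical
  have hT : ∀ h, Measurable (T h) := fun h => (hTμ h).measurable
  set D : Set X := {x | Θ (T u x) ≠ Θ x} with hD
  have hDm : MeasurableSet D := (measurableSet_eq_fun (hΘ.comp (hT u)) hΘ).compl
  have hYpre : T u ⁻¹' Y = Y := by ext x; exact hu x
  have hmp : MeasurePreserving (T u) (μ.restrict Y) (μ.restrict Y) := by
    have := (hTμ u).restrict_preimage hY
    rwa [hYpre] at this
  rw [← hmp.lintegral_comp (measurable_returnFraction hT hΘ A)]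
  have hDY : μ {x | x ∈ Y ∧ Θ (T u x) ≠ Θ x} = ∫⁻ x in Y, D.indicator 1 x ∂μ := by
    rw [lintegral_indicator_one hDm, Measure.restrict_apply hDm, Set.inter_comm]
    rfl
  rw [hDY, ← lintegral_add_right _ (measurable_one.indicator hDm)]
  refine lintegral_mono fun x => ?_
  by_cases hx : x ∈ D
  · rw [Set.indicator_of_mem hx]
    refine le_add_left ?_
    exact ENNReal.div_le_of_le_mul (by simpa using returnCount_mono (Set.subset_univ A) _)
  · rw [Set.indicator_of_notMem hx, add_zero]
    have hx' : Θ (T u x) = Θ x := by simpa [hD] using hx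
    rw [returnCount_translate hTmul A hx', returnCount_translate hTmul Set.univ hx']
    simp

lemma five_mul_lintegral_returnFraction_le {μ : Measure X} [IsFiniteMeasure μ] {T : H → X → X}
    (hTmul : ∀ g h x, T (g * h) x = T g (T h x))
    (hTμ : ∀ h, MeasurePreserving (T h) μ μ) {Θ : X → Z} (hΘ : Measurable Θ)
    {Y : Set X} (hY : MeasurableSet Y) {u : Fin 5 → H} (hu : ∀ i x, T (u i) x ∈ Y ↔ x ∈ Y)
    {A : Set H} (hA : ∀ h i j, h * (u i)⁻¹ ∈ A → h * (u j)⁻¹ ∈ A → i = j) {ε : ENNReal}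
    (hε : ∀ i, μ {x | x ∈ Y ∧ Θ (T (u i) x) ≠ Θ x} ≤ ε) :
    5 * ∫⁻ x in Y, returnCount T Θ A x / returnCount T Θ Set.univ x ∂μ ≤ μ Y + 5 * ε := by
  have hT : ∀ h, Measurable (T h) := fun h => (hTμ h).measurable
  calc 5 * ∫⁻ x in Y, returnCount T Θ A x / returnCount T Θ Set.univ x ∂μ
      = ∑ _i : Fin 5, ∫⁻ x in Y, returnCount T Θ A x / returnCount T Θ Set.univ x ∂μ := by simp
    _ ≤ ∑ i : Fin 5, (∫⁻ x in Y, returnCount T Θ {h | h * (u i)⁻¹ ∈ A} x /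
          returnCount T Θ Set.univ x ∂μ + ε) :=
        Finset.sum_le_sum fun i _ =>
          (lintegral_returnFraction_le hTmul hTμ hΘ hY (hu i) A).trans (by gcongr; exact hε i)
    _ = (∑ i : Fin 5, ∫⁻ x in Y, returnCount T Θ {h | h * (u i)⁻¹ ∈ A} x /
          returnCount T Θ Set.univ x ∂μ) + 5 * ε := by rw [Finset.sum_add_distrib]; simp
    _ ≤ μ Y + 5 * ε := by
        gcongr
        rw [← lintegral_finsetSum _ fun i _ => measurable_returnFraction hT hΘ _]
        calc _ ≤ ∫⁻ _ in Y, 1 ∂μ := by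
              refine lintegral_mono fun x => ?_
              simp only [div_eq_mul_inv]
              rw [← Finset.sum_mul, ← div_eq_mul_inv]
              refine ENNReal.div_le_of_le_mul ?_
              rw [one_mul]
              exact sum_returnCount_le (fun i => {h | h * (u i)⁻¹ ∈ A})
                (fun h i j hi hj => hA h i j hi hj) x
          _ = μ Y := by simp

lemma exists_forall_measure_ne_le {ι : Type*} [Finite ι] {μ : Measure X} [IsFiniteMeasure μ]
    {Θ : ℕ → X → Z} (hΘ : ∀ k, Measurable (Θ k))
    (hmono : ∀ k x y, Θ k x = Θ k y → Θ (k + 1) x = Θ (k + 1) y)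
    {Y : Set X} (hY : MeasurableSet Y) {T : ι → X → X} (hT : ∀ i, Measurable (T i))
    {δ ε : ENNReal} (hδ : δ < ε)
    (h : ∀ i, μ {x | x ∈ Y ∧ ∀ k, Θ k (T i x) ≠ Θ k x} ≤ δ) :
    ∃ k, ∀ i, μ {x | x ∈ Y ∧ Θ k (T i x) ≠ Θ k x} ≤ ε := by
  have hm : ∀ i k, MeasurableSet {x | x ∈ Y ∧ Θ k (T i x) ≠ Θ k x} := fun i k =>
    hY.inter (measurableSet_eq_fun ((hΘ k).comp (hT i)) (hΘ k)).compl
  have key : ∀ i, ∀ᶠ k in Filter.atTop, μ {x | x ∈ Y ∧ Θ k (T i x) ≠ Θ k x} ≤ ε := by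
    intro i
    have hanti : Antitone fun k => {x | x ∈ Y ∧ Θ k (T i x) ≠ Θ k x} :=
      antitone_nat_of_succ_le fun k x hx => ⟨hx.1, fun he => hx.2 (hmono _ _ _ he)⟩
    have ht := tendsto_measure_iInter_atTop (μ := μ)
      (fun k => (hm i k).nullMeasurableSet) hanti ⟨0, measure_ne_top _ _⟩
    have hlt : μ (⋂ k, {x | x ∈ Y ∧ Θ k (T i x) ≠ Θ k x}) < ε := by
      refine lt_of_le_of_lt (measure_mono ?_) ((h i).trans_lt hδ)
      intro x hx
      rw [Set.mem_iInter] at hx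
      exact ⟨(hx 0).1, fun k => (hx k).2⟩
    exact (ht.eventually (gt_mem_nhds hlt)).mono fun k hk => le_of_lt hk
  exact (Filter.eventually_all.2 key).exists

/-- A family of coarser and coarser countable-to-one invariants cannot be almost preserved by
elements that translate each of two sets covering the group to disjoint copies. -/
theorem false_of_almost_invariant [StandardBorelSpace X] [Nonempty X]
    [MeasurableSpace W] [MeasurableEq W]
    (μ : Measure X) [IsFiniteMeasure μ] {T : H → X → X}
    (hT1 : ∀ x, T 1 x = x) (hTmul : ∀ g h x, T (g * h) x = T g (T h x))
    (hTμ : ∀ h, MeasurePreserving (T h) μ μ)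
    {Θ : ℕ → X → Z} (hΘ : ∀ k, Measurable (Θ k))
    (hmono : ∀ k x y, Θ k x = Θ k y → Θ (k + 1) x = Θ (k + 1) y)
    {L : X → W} (hL : Measurable L)
    (hfib : ∀ k x, ∃ T : Set W, T.Countable ∧ ∀ y, Θ k y = Θ k x → L y ∈ T)
    (c : H) (hfree : ∀ᵐ x ∂μ, ∀ h h', L (T h x) = L (T h' x) → h' = h ∨ h' = c * h)
    {Y : Set X} (hY : MeasurableSet Y) (hY0 : μ Y ≠ 0)
    {A A' : Set H} (hAA' : ∀ h, h ∈ A ∨ h ∈ A') {u u' : Fin 5 → H}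
    (hu : ∀ i x, T (u i) x ∈ Y ↔ x ∈ Y) (hu' : ∀ i x, T (u' i) x ∈ Y ↔ x ∈ Y)
    (hA : ∀ h i j, h * (u i)⁻¹ ∈ A → h * (u j)⁻¹ ∈ A → i = j)
    (hA' : ∀ h i j, h * (u' i)⁻¹ ∈ A' → h * (u' j)⁻¹ ∈ A' → i = j)
    (hε : ∀ i, μ {x | x ∈ Y ∧ ∀ k, Θ k (T (u i) x) ≠ Θ k x} ≤ μ Y / 40)
    (hε' : ∀ i, μ {x | x ∈ Y ∧ ∀ k, Θ k (T (u' i) x) ≠ Θ k x} ≤ μ Y / 40) : False := by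
  have hYt : μ Y ≠ ⊤ := measure_ne_top μ Y
  have hT : ∀ h, Measurable (T h) := fun h => (hTμ h).measurable
  obtain ⟨k, hk⟩ := exists_forall_measure_ne_le (μ := μ) hΘ hmono hY
    (T := fun i : Fin 5 ⊕ Fin 5 => T (Sum.elim u u' i)) (fun i => hT _)
    (δ := μ Y / 40) (ε := μ Y / 20)
    (ENNReal.div_lt_div_left hY0 hYt (by norm_num)) (by
      rintro (i | i)
      · exact hε i
      · exact hε' i)
  have hfin := ae_finite_return μ hT1 hTmul hTμ (hΘ k) hL (hfib k) c hfree
  have h1 := five_mul_lintegral_returnFraction_le hTmul hTμ (hΘ k) hY hu hA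
    (fun i => hk (Sum.inl i))
  have h2 := five_mul_lintegral_returnFraction_le hTmul hTμ (hΘ k) hY hu' hA'
    (fun i => hk (Sum.inr i))
  have h3 : μ Y ≤ ∫⁻ x in Y, returnCount T (Θ k) A x / returnCount T (Θ k) Set.univ x ∂μ +
      ∫⁻ x in Y, returnCount T (Θ k) A' x / returnCount T (Θ k) Set.univ x ∂μ := by
    rw [← lintegral_add_left (measurable_returnFraction hT (hΘ k) A)]
    calc μ Y = ∫⁻ _ in Y, 1 ∂μ := by simp
      _ ≤ _ := by
        refine lintegral_mono_ae (ae_restrict_of_ae ?_)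
        filter_upwards [hfin] with x hx
        rw [← ENNReal.add_div, ENNReal.le_div_iff_mul_le, one_mul]
        · exact returnCount_univ_le_add hAA' x
        · left
          refine (lt_of_lt_of_le one_pos ?_).ne'
          refine le_trans ?_ (ENNReal.le_tsum (1 : H))
          simp [hT1]
        · left
          exact returnCount_ne_top hx
  exact false_of_five_mul_le hYt hY0 h1 h2 h3

end ReturnFraction

section InvariantVectors

open MeasureTheory

/-- Vectors almost fixed by the generators are close to vectors fixed by `u`. -/
theorem exists_fixed_near {δ : ℝ} (hδ : 0 < δ) : ∃ ε > 0, ∀ {H : Type*}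
    [NormedAddCommGroup H] [InnerProductSpace ℂ H] [CompleteSpace H] {u v W W' : H →L[ℂ] H},
    u ∈ unitary (H →L[ℂ] H) → v ∈ unitary (H →L[ℂ] H) → W ∈ unitary (H →L[ℂ] H) →
    W' ∈ unitary (H →L[ℂ] H) → u * v = v * u → W * u = u * W → W * v = v * u * W →
    W' * v = v * W' → W' * u = u * v * W' → ∀ ξ : H, ‖u ξ - ξ‖ ≤ ε * ‖ξ‖ →
    ‖v ξ - ξ‖ ≤ ε * ‖ξ‖ → ‖W ξ - ξ‖ ≤ ε * ‖ξ‖ → ‖W' ξ - ξ‖ ≤ ε * ‖ξ‖ →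
    ∃ ξ' : H, u ξ' = ξ' ∧ ‖ξ - ξ'‖ ≤ δ * ‖ξ‖ := by
  obtain ⟨ε, hε, key⟩ := exists_norm_pow_sub_le hδ
  refine ⟨ε, hε, ?_⟩
  intro H _ _ _ u v W W' hu hv hW hW' huv h1 h2 h3 h4 ξ hu1 hv1 hW1 hW1'
  rcases eq_or_ne ξ 0 with rfl | hξ
  · exact ⟨0, by simp⟩
  have hn : 0 < ‖ξ‖ := norm_pos_iff.2 hξ
  have hscale : ∀ U : H →L[ℂ] H, ‖U ((‖ξ‖ : ℂ)⁻¹ • ξ) - (‖ξ‖ : ℂ)⁻¹ • ξ‖ = ‖ξ‖⁻¹ * ‖U ξ - ξ‖ := by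
    intro U
    rw [map_smul, ← smul_sub, norm_smul]
    simp
  have hle : ∀ U : H →L[ℂ] H, ‖U ξ - ξ‖ ≤ ε * ‖ξ‖ →
      ‖U ((‖ξ‖ : ℂ)⁻¹ • ξ) - (‖ξ‖ : ℂ)⁻¹ • ξ‖ ≤ ε := by
    intro U hU
    rw [hscale, inv_mul_le_iff₀ hn, mul_comm]
    exact hU
  have hpow : ∀ a : ℕ, ‖(u ^ a) ξ - ξ‖ ≤ δ * ‖ξ‖ := by
    intro a
    have := key hu hv hW hW' huv h1 h2 h3 h4 ((‖ξ‖ : ℂ)⁻¹ • ξ)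
      (by rw [norm_smul]; simp [hn.ne']) (hle u hu1) (hle v hv1) (hle W hW1) (hle W' hW1') a
    rw [hscale, inv_mul_le_iff₀ hn, mul_comm] at this
    exact this
  have hnorm : ‖u‖ ≤ 1 := by
    refine ContinuousLinearMap.opNorm_le_bound _ zero_le_one fun x => ?_
    rw [one_mul]
    exact (Unitary.norm_map ⟨u, hu⟩ x).le
  have ht := ContinuousLinearMap.tendsto_birkhoffAverage_orthogonalProjection u hnorm ξ
  set ξ' := (u.eqLocus (1 : H →L[ℂ] H)).orthogonalProjectionOnto ξ
  refine ⟨ξ', ξ'.2, ?_⟩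
  have hb : ∀ N : ℕ, 0 < N → ‖ξ - birkhoffAverage ℂ u _root_.id N ξ‖ ≤ δ * ‖ξ‖ := by
    intro N hN
    have hN' : (N : ℂ) ≠ 0 := by exact_mod_cast hN.ne'
    have : ξ - birkhoffAverage ℂ u _root_.id N ξ
        = (N : ℂ)⁻¹ • ∑ k ∈ Finset.range N, (ξ - (u ^ k) ξ) := by
      rw [birkhoffAverage, birkhoffSum, Finset.sum_sub_distrib, smul_sub]
      congr 1
      · simp [← Nat.cast_smul_eq_nsmul ℂ, smul_smul, hN']
      · congr 1
        refine Finset.sum_congr rfl fun k _ => ?_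
        rw [_root_.id, FunLike.coe_pow_eq_iterate]
    rw [this, norm_smul]
    calc _ ≤ ‖(N : ℂ)⁻¹‖ * ∑ k ∈ Finset.range N, (δ * ‖ξ‖) := by
          gcongr
          refine (norm_sum_le _ _).trans (Finset.sum_le_sum fun k _ => ?_)
          rw [norm_sub_rev]
          exact hpow k
      _ = δ * ‖ξ‖ := by
          have : (N : ℝ) ≠ 0 := by exact_mod_cast hN.ne'
          simp
          field_simp
  exact le_of_tendsto (tendsto_const_nhds.sub ht).norm
    ((Filter.eventually_gt_atTop 0).mono fun N hN => hb N hN)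

end InvariantVectors

section SkewProduct

open MeasureTheory

variable {Q Γ Λ : Type*} [MeasurableSpace Q] [Group Γ] [Group Λ]

/-- The action of `γ` on `Q × Λ` twisted by a pair of cocycles. -/
def skewMap (S : Γ → Q → Q) (w₁ w₂ : Γ → Q → Λ) (γ : Γ) (p : Q × Λ) : Q × Λ :=
  (S γ p.1, w₂ γ p.1 * p.2 * (w₁ γ p.1)⁻¹)

variable {ν : Measure Q} [IsFiniteMeasure ν] {S : Γ → Q → Q} {w₁ w₂ : Γ → Q → Λ}

lemma skewMap_mul (hmul : ∀ g h q, S (g * h) q = S g (S h q))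
    (hw₁ : ∀ g h q, w₁ (g * h) q = w₁ g (S h q) * w₁ h q)
    (hw₂ : ∀ g h q, w₂ (g * h) q = w₂ g (S h q) * w₂ h q) (g h : Γ) :
    skewMap S w₁ w₂ (g * h) = skewMap S w₁ w₂ g ∘ skewMap S w₁ w₂ h := by
  ext1 p
  simp only [skewMap, hmul, hw₁, hw₂, Function.comp_apply, mul_inv_rev, mul_assoc]

lemma skewMap_one (hone : ∀ q, S 1 q = q)
    (hw₁ : ∀ g h q, w₁ (g * h) q = w₁ g (S h q) * w₁ h q)
    (hw₂ : ∀ g h q, w₂ (g * h) q = w₂ g (S h q) * w₂ h q) :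
    skewMap S w₁ w₂ 1 = id := by
  ext1 p
  have h1 : w₁ 1 p.1 = 1 := by simpa [hone] using hw₁ 1 1 p.1
  have h2 : w₂ 1 p.1 = 1 := by simpa [hone] using hw₂ 1 1 p.1
  simp [skewMap, hone, h1, h2]

variable [MeasurableSpace Λ] [DiscreteMeasurableSpace Λ] [Countable Λ]

lemma measurePreserving_skewMap (hS : ∀ γ, MeasurePreserving (S γ) ν ν)
    (hw₁ : ∀ γ, Measurable (w₁ γ)) (hw₂ : ∀ γ, Measurable (w₂ γ)) (γ : Γ) :
    MeasurePreserving (skewMap S w₁ w₂ γ) (ν.prod Measure.count) (ν.prod Measure.count) := by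
  refine (hS γ).skew_product (g := fun q l => w₂ γ q * l * (w₁ γ q)⁻¹) ?_ ?_
  · have : Measurable fun t : Λ × Λ × Λ => t.1 * t.2.1 * t.2.2⁻¹ := Measurable.of_discrete
    exact this.comp (((hw₂ γ).comp measurable_fst).prodMk
      (measurable_snd.prodMk ((hw₁ γ).comp measurable_fst)))
  · refine Filter.Eventually.of_forall fun q => ?_
    let e : Λ ≃ᵐ Λ :=
      { ((Equiv.mulLeft (w₂ γ q)).trans (Equiv.mulRight (w₁ γ q)⁻¹)) with
        measurable_toFun := Measurable.of_discrete
        measurable_invFun := Measurable.of_discrete }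
    change Measure.map e Measure.count = _
    ext s hs
    rw [e.map_apply, ← e.image_symm, Measure.count_injective_image e.symm.injective]

lemma prod_count_graph {P : Set Q} (hP : MeasurableSet P) {s : Q → Λ} (hs : Measurable s) :
    (ν.prod Measure.count) {p : Q × Λ | p.1 ∈ P ∧ p.2 = s p.1} = ν P := by
  have hm : MeasurableSet {p : Q × Λ | p.1 ∈ P ∧ p.2 = s p.1} :=
    (measurable_fst hP).inter (measurableSet_eq_fun measurable_snd (hs.comp measurable_fst))
  rw [Measure.prod_apply hm, ← lintegral_indicator_one hP]
  refine lintegral_congr fun q => ?_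
  by_cases hq : q ∈ P
  · have : Prod.mk q ⁻¹' {p : Q × Λ | p.1 ∈ P ∧ p.2 = s p.1} = {s q} := by
      ext l; simp [hq]
    rw [this, Set.indicator_of_mem hq, Measure.count_singleton]
    rfl
  · have : Prod.mk q ⁻¹' {p : Q × Λ | p.1 ∈ P ∧ p.2 = s p.1} = ∅ := by
      ext l; simp [hq]
    rw [this, Set.indicator_of_notMem hq, measure_empty]

lemma measurableSet_cocycle_ne (hw₁ : ∀ γ, Measurable (w₁ γ)) (hw₂ : ∀ γ, Measurable (w₂ γ))
    (γ : Γ) : MeasurableSet {q | w₁ γ q ≠ w₂ γ q} :=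
  (measurableSet_eq_fun (hw₁ γ) (hw₂ γ)).compl

end SkewProduct

section DefectMeasure

open MeasureTheory

variable {Q Γ Λ : Type*} [MeasurableSpace Q] [Group Γ] [Group Λ]
  [MeasurableSpace Λ] [DiscreteMeasurableSpace Λ] [Countable Λ]

/-- The unitary operator on `L²` induced by an invertible measure preserving map. -/
lemma compMeasurePreserving_mem_unitary {α : Type*} [MeasurableSpace α] {ρ : Measure α}
    {f g : α → α} (hf : MeasurePreserving f ρ ρ) (hg : MeasurePreserving g ρ ρ)
    (hfg : f ∘ g = id) (hgf : g ∘ f = id) :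
    (Lp.compMeasurePreservingₗᵢ (E := ℂ) (p := 2) ℂ f hf).toContinuousLinearMap ∈
      unitary (Lp ℂ 2 ρ →L[ℂ] Lp ℂ 2 ρ) := by
  have h1 : ∀ x : Lp ℂ 2 ρ, Lp.compMeasurePreserving g hg (Lp.compMeasurePreserving f hf x) = x := by
    intro x
    rw [← Lp.compMeasurePreserving_comp_apply]
    simp only [hfg, Lp.compMeasurePreserving_id_apply]
  have h2 : ∀ x : Lp ℂ 2 ρ, Lp.compMeasurePreserving f hf (Lp.compMeasurePreserving g hg x) = x := by
    intro x
    rw [← Lp.compMeasurePreserving_comp_apply]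
    simp only [hgf, Lp.compMeasurePreserving_id_apply]
  let e : Lp ℂ 2 ρ ≃ₗᵢ[ℂ] Lp ℂ 2 ρ :=
    { (Lp.compMeasurePreservingₗᵢ (E := ℂ) (p := 2) ℂ f hf) with
      invFun := Lp.compMeasurePreserving g hg
      left_inv := h1
      right_inv := h2 }
  exact (Unitary.linearIsometryEquiv.symm e).2

lemma norm_indicatorConstLp_one_sq {α : Type*} [MeasurableSpace α] {ρ : Measure α} {s : Set α}
    (hs : MeasurableSet s) (hρ : ρ s ≠ ⊤) :
    ‖indicatorConstLp 2 hs hρ (1 : ℂ)‖ ^ 2 = ρ.real s := by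
  rw [norm_indicatorConstLp (by norm_num) (by norm_num), norm_one, one_mul, ← Real.rpow_natCast,
    ← Real.rpow_mul measureReal_nonneg]
  simp

lemma enorm_Lp_two_sq {α : Type*} [MeasurableSpace α] {ρ : Measure α} (f : Lp ℂ 2 ρ) :
    ‖f‖ₑ ^ 2 = ∫⁻ x, ‖f x‖ₑ ^ 2 ∂ρ := by
  have := eLpNorm_nnreal_pow_eq_lintegral (μ := ρ) (f := (f : α → ℂ)) (p := 2) two_ne_zero
  rw [Lp.enorm_def]
  simpa using this

lemma enorm_sub_sq_le (a b : ℂ) : ‖a - b‖ₑ ^ 2 ≤ 2 * ‖a‖ₑ ^ 2 + 2 * ‖b‖ₑ ^ 2 := by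
  have h : ‖a - b‖ ^ 2 ≤ 2 * ‖a‖ ^ 2 + 2 * ‖b‖ ^ 2 := by
    have := norm_sub_le a b
    nlinarith [sq_nonneg (‖a‖ - ‖b‖), norm_nonneg (a - b), norm_nonneg a, norm_nonneg b]
  have h' : ‖a - b‖₊ ^ 2 ≤ 2 * ‖a‖₊ ^ 2 + 2 * ‖b‖₊ ^ 2 := by exact_mod_cast h
  simp only [enorm_eq_nnnorm]
  exact_mod_cast h'

/-- If two cocycles agree up to a small set on four elements satisfying the relations of
`SL₂ ⋉ ℤ²`, their disagreement along the powers of `u` is dominated by a small measure. -/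
theorem exists_defect_measure {δ : ℝ} (hδ : 0 < δ) : ∃ ε > 0,
    ∀ {Q : Type*} {Γ Λ : Type*} [MeasurableSpace Q] [Group Γ] [Group Λ]
    [MeasurableSpace Λ] [DiscreteMeasurableSpace Λ] [Countable Λ]
    {ν : Measure Q} [IsFiniteMeasure ν] {S : Γ → Q → Q} {w₁ w₂ : Γ → Q → Λ},
    (∀ q, S 1 q = q) → (∀ g h q, S (g * h) q = S g (S h q)) →
    (∀ γ, MeasurePreserving (S γ) ν ν) →
    (∀ γ, Measurable (w₁ γ)) → (∀ γ, Measurable (w₂ γ)) →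
    (∀ g h q, w₁ (g * h) q = w₁ g (S h q) * w₁ h q) →
    (∀ g h q, w₂ (g * h) q = w₂ g (S h q) * w₂ h q) →
    ∀ u v W W' : Γ, u * v = v * u → W * u = u * W → v * W = W * u * v → W' * v = v * W' →
    u * W' = W' * v * u →
    (∀ γ ∈ ({u, v, W, W'} : Set Γ), ν.real {q | w₁ γ q ≠ w₂ γ q} ≤ ε * ν.real Set.univ) →
    ∃ m : Measure Q, m Set.univ ≤ ENNReal.ofReal δ * ν Set.univ ∧
      ∀ (a : ℕ) (B : Set Q), MeasurableSet B → (∀ q, S (u ^ a) q ∈ B ↔ q ∈ B) →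
        ν {q | q ∈ B ∧ w₁ (u ^ a) q ≠ w₂ (u ^ a) q} ≤ 4 * m B := by
  obtain ⟨ε, hε, key⟩ := exists_fixed_near (Real.sqrt_pos.2 hδ)
  refine ⟨ε ^ 2 / 2, by positivity, ?_⟩
  intro Q Γ Λ _ _ _ _ _ _ ν _ S w₁ w₂ hone hmul hS hw₁ hw₂ hc₁ hc₂ u v W W' huv h1 h2 h3 h4 hsmall
  set ρ := ν.prod (Measure.count : Measure Λ) with hρ
  have hT := fun γ => measurePreserving_skewMap hS hw₁ hw₂ γ
  have hTmul := fun g h => skewMap_mul hmul hc₁ hc₂ g h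
  have hTone := skewMap_one hone hc₁ hc₂
  set V : Γ → Lp ℂ 2 ρ →L[ℂ] Lp ℂ 2 ρ := fun γ =>
    (Lp.compMeasurePreservingₗᵢ (E := ℂ) (p := 2) ℂ (skewMap S w₁ w₂ γ) (hT γ)).toContinuousLinearMap
    with hV
  have hVu : ∀ γ, V γ ∈ unitary (Lp ℂ 2 ρ →L[ℂ] Lp ℂ 2 ρ) := fun γ =>
    compMeasurePreserving_mem_unitary (hT γ) (hT γ⁻¹)
      (by rw [← hTmul, mul_inv_cancel, hTone]) (by rw [← hTmul, inv_mul_cancel, hTone])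
  have hVmul : ∀ g h, V g * V h = V (h * g) := by
    intro g h
    ext1 x
    change Lp.compMeasurePreserving _ (hT g) (Lp.compMeasurePreserving _ (hT h) x)
      = Lp.compMeasurePreserving _ (hT (h * g)) x
    rw [← Lp.compMeasurePreserving_comp_apply]
    simp only [hTmul]
  set E : Set (Q × Λ) := {p | p.1 ∈ (Set.univ : Set Q) ∧ p.2 = (fun _ => 1 : Q → Λ) p.1} with hE
  have hEm : MeasurableSet E :=
    (measurable_fst MeasurableSet.univ).inter (measurableSet_eq_fun measurable_snd measurable_const)
  have hρE : ρ E = ν Set.univ := prod_count_graph MeasurableSet.univ measurable_const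
  have hEfin : ρ E ≠ ⊤ := by rw [hρE]; exact measure_ne_top _ _
  set ξ := indicatorConstLp 2 hEm hEfin (1 : ℂ) with hξ
  have hξn : ‖ξ‖ ^ 2 = ν.real Set.univ := by
    rw [hξ, norm_indicatorConstLp_one_sq, measureReal_def, hρE, measureReal_def]
  have hVξ : ∀ γ, ν.real {q | w₁ γ q ≠ w₂ γ q} ≤ ε ^ 2 / 2 * ν.real Set.univ →
      ‖V γ ξ - ξ‖ ≤ ε * ‖ξ‖ := by
    intro γ hγ
    have e1 : V γ ξ = indicatorConstLp 2 ((hT γ).measurable hEm)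
        (by rwa [(hT γ).measure_preimage hEm.nullMeasurableSet]) (1 : ℂ) :=
      Lp.indicatorConstLp_compMeasurePreserving hEm hEfin (1 : ℂ) (hT γ)
    rw [← dist_eq_norm, e1, hξ, dist_indicatorConstLp_eq_norm]
    refine (pow_le_pow_iff_left₀ (norm_nonneg _) (by positivity) two_ne_zero).1 ?_
    rw [norm_indicatorConstLp_one_sq, mul_pow, hξn]
    have hD := measurableSet_cocycle_ne hw₁ hw₂ γ
    have hsub : symmDiff (skewMap S w₁ w₂ γ ⁻¹' E) E ⊆
        {p : Q × Λ | p.1 ∈ {q | w₁ γ q ≠ w₂ γ q} ∧ p.2 = (fun _ => 1 : Q → Λ) p.1} ∪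
        {p : Q × Λ | p.1 ∈ {q | w₁ γ q ≠ w₂ γ q} ∧ p.2 = (w₂ γ p.1)⁻¹ * w₁ γ p.1} := by
      rintro ⟨q, l⟩ hp
      have hpre : (q, l) ∈ skewMap S w₁ w₂ γ ⁻¹' E ↔ l = (w₂ γ q)⁻¹ * w₁ γ q := by
        simp only [hE, skewMap, Set.mem_preimage, Set.mem_ofPred_eq, Set.mem_univ, true_and]
        rw [mul_inv_eq_one, eq_inv_mul_iff_mul_eq]
      have hE' : (q, l) ∈ E ↔ l = 1 := by simp [hE]
      rw [Set.mem_symmDiff, hpre, hE'] at hp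
      have hne : w₁ γ q ≠ w₂ γ q := by
        intro he
        simp [he] at hp
      rcases hp with hp | hp
      · exact Or.inr ⟨hne, hp.1⟩
      · exact Or.inl ⟨hne, hp.1⟩
    have hle : ρ (symmDiff (skewMap S w₁ w₂ γ ⁻¹' E) E) ≤ ν {q | w₁ γ q ≠ w₂ γ q}
        + ν {q | w₁ γ q ≠ w₂ γ q} := by
      refine (measure_mono hsub).trans ((measure_union_le _ _).trans ?_)
      have hm : Measurable fun t : Λ × Λ => t.1⁻¹ * t.2 := Measurable.of_discrete
      exact (add_le_add (prod_count_graph hD measurable_const).le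
        (prod_count_graph hD (hm.comp ((hw₂ γ).prodMk (hw₁ γ)))).le)
    have : ρ.real (symmDiff (skewMap S w₁ w₂ γ ⁻¹' E) E) ≤ ν.real {q | w₁ γ q ≠ w₂ γ q}
        + ν.real {q | w₁ γ q ≠ w₂ γ q} := by
      simp only [measureReal_def]
      rw [← ENNReal.toReal_add (measure_ne_top _ _) (measure_ne_top _ _)]
      exact ENNReal.toReal_mono (by simp) hle
    linarith
  obtain ⟨ξ', hξ', hnear⟩ := key (hVu u) (hVu v) (hVu W) (hVu W')
    (by rw [hVmul, hVmul, huv]) (by rw [hVmul, hVmul, h1])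
    (by rw [hVmul, hVmul, hVmul, h2, mul_assoc]) (by rw [hVmul, hVmul, h3])
    (by rw [hVmul, hVmul, hVmul, h4, mul_assoc]) ξ
    (hVξ u (hsmall u (by simp))) (hVξ v (hsmall v (by simp)))
    (hVξ W (hsmall W (by simp))) (hVξ W' (hsmall W' (by simp)))
  set f : Lp ℂ 2 ρ := ξ - ξ' with hf
  refine ⟨(ρ.withDensity fun p => ‖f p‖ₑ ^ 2).map Prod.fst, ?_, ?_⟩
  · rw [Measure.map_apply measurable_fst MeasurableSet.univ, Set.preimage_univ,
      withDensity_apply _ MeasurableSet.univ, setLIntegral_univ, ← enorm_Lp_two_sq]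
    have hsq : ‖f‖ ^ 2 ≤ δ * ν.real Set.univ := by
      calc ‖f‖ ^ 2 ≤ (Real.sqrt δ * ‖ξ‖) ^ 2 := by gcongr
        _ = _ := by rw [mul_pow, Real.sq_sqrt hδ.le, hξn]
    rw [← ofReal_norm, ← ENNReal.ofReal_pow (norm_nonneg _)]
    refine (ENNReal.ofReal_le_ofReal hsq).trans ?_
    rw [ENNReal.ofReal_mul hδ.le, measureReal_def, ENNReal.ofReal_toReal (measure_ne_top _ _)]
  · intro a B hB hBinv
    set t := skewMap S w₁ w₂ (u ^ a) with ht
    have hB' : MeasurableSet (Prod.fst ⁻¹' B : Set (Q × Λ)) := measurable_fst hB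
    rw [Measure.map_apply measurable_fst hB, withDensity_apply _ hB']
    have hVpow : ∀ a : ℕ, V (u ^ a) ξ' = ξ' := by
      intro a
      induction a with
      | zero =>
        change Lp.compMeasurePreserving _ (hT (u ^ 0)) ξ' = ξ'
        simp only [pow_zero, hTone, Lp.compMeasurePreserving_id_apply]
      | succ a ih => rw [pow_succ', ← hVmul, mul_apply_eq_comp, hξ', ih]
    have hfix : ∀ᵐ p ∂ρ, ξ' (t p) = ξ' p := by
      have h := Lp.coeFn_compMeasurePreserving ξ' (hT (u ^ a))
      have h' : Lp.compMeasurePreserving _ (hT (u ^ a)) ξ' = ξ' := hVpow a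
      rw [h'] at h
      filter_upwards [h] with p hp using hp.symm
    have hξae : ∀ᵐ p ∂ρ, ξ p = E.indicator (fun _ => (1 : ℂ)) p := indicatorConstLp_coeFn
    have hfae : ∀ᵐ p ∂ρ, f p = ξ p - ξ' p := Lp.coeFn_sub ξ ξ'
    have htq := (hT (u ^ a)).quasiMeasurePreserving
    set D : Set Q := {q | q ∈ B ∧ w₁ (u ^ a) q ≠ w₂ (u ^ a) q} with hD
    have hDm : MeasurableSet D := hB.inter (measurableSet_cocycle_ne hw₁ hw₂ _)
    set G : Set (Q × Λ) := {p | p.1 ∈ D ∧ p.2 = (fun _ => 1 : Q → Λ) p.1} with hG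
    have hGm : MeasurableSet G := (measurable_fst hDm).inter
      (measurableSet_eq_fun measurable_snd measurable_const)
    have hGρ : ρ G = ν D := prod_count_graph hDm measurable_const
    have hfm : Measurable fun p => ‖f p‖ₑ ^ 2 :=
      ((Lp.stronglyMeasurable f).measurable.enorm).pow_const 2
    have htm : Measurable t := (hT (u ^ a)).measurable
    have hpre : t ⁻¹' (Prod.fst ⁻¹' B) = Prod.fst ⁻¹' B := by
      ext p
      exact hBinv p.1
    have hcomp : ∫⁻ p in Prod.fst ⁻¹' B, ‖f (t p)‖ₑ ^ 2 ∂ρ = ∫⁻ p in Prod.fst ⁻¹' B, ‖f p‖ₑ ^ 2 ∂ρ := by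
      have := (hT (u ^ a)).setLIntegral_comp_preimage hB' hfm
      rwa [← ht, hpre] at this
    calc ν D = ∫⁻ p in G, 1 ∂ρ := by rw [setLIntegral_one, hGρ]
      _ ≤ ∫⁻ p in G, (2 * ‖f (t p)‖ₑ ^ 2 + 2 * ‖f p‖ₑ ^ 2) ∂ρ := by
        refine setLIntegral_mono_ae' hGm ?_
        filter_upwards [hfix, hξae, hfae, htq.ae hξae, htq.ae hfae] with p h1 h2 h3 h4 h5 hpG
        have hpE : p ∈ E := ⟨trivial, hpG.2⟩
        have htE : t p ∉ E := by
          rintro ⟨-, h⟩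
          have hp2 : p.2 = 1 := hpG.2
          change w₂ (u ^ a) p.1 * p.2 * (w₁ (u ^ a) p.1)⁻¹ = 1 at h
          rw [hp2, mul_one, mul_inv_eq_one] at h
          exact hpG.1.2 h.symm
        have := enorm_sub_sq_le (f (t p)) (f p)
        rw [h5, h3, h4, h2, h1, Set.indicator_of_mem hpE, Set.indicator_of_notMem htE] at this
        rw [h5, h3, h4, h2, h1, Set.indicator_of_mem hpE, Set.indicator_of_notMem htE]
        refine le_trans ?_ this
        have : (0 - ξ' p - (1 - ξ' p)) = -1 := by ring
        rw [this]
        simp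
      _ ≤ ∫⁻ p in Prod.fst ⁻¹' B, (2 * ‖f (t p)‖ₑ ^ 2 + 2 * ‖f p‖ₑ ^ 2) ∂ρ :=
        lintegral_mono_set fun p hp => hp.1.1
      _ = 4 * ∫⁻ p in Prod.fst ⁻¹' B, ‖f p‖ₑ ^ 2 ∂ρ := by
        have hfm' : Measurable fun p => ‖f (t p)‖ₑ ^ 2 := hfm.comp htm
        rw [lintegral_add_left (hfm'.const_mul 2), lintegral_const_mul _ hfm',
          lintegral_const_mul _ hfm, hcomp, ← add_mul]
        norm_num

end DefectMeasure

section FiniteQuotients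

open MeasureTheory
open scoped ENNReal

variable {X : Type*} [MeasurableSpace X] {μ : Measure X} [IsFiniteMeasure μ]
  {ι : Type*} [Fintype ι] {c : X → ι}

/-- Pairs of points in the same fibre of `c`. -/
def fibrePairs {X ι : Type*} (c : X → ι) : Set (X × X) := {q | c q.1 = c q.2}

lemma measurableSet_preimage_of_fibres (hc : ∀ i, MeasurableSet (c ⁻¹' {i}))
    (E : Set ι) : MeasurableSet (c ⁻¹' E) := by
  have : c ⁻¹' E = ⋃ i ∈ E, c ⁻¹' {i} := by ext x; simp
  rw [this]
  exact MeasurableSet.biUnion (Set.to_countable _) fun i _ => hc i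

lemma fibrePairs_eq_iUnion (c : X → ι) :
    fibrePairs c = ⋃ i, (c ⁻¹' {i}) ×ˢ (c ⁻¹' {i}) := by
  ext ⟨x, y⟩
  simp [fibrePairs, eq_comm]

lemma measurableSet_fibrePairs (hc : ∀ i, MeasurableSet (c ⁻¹' {i})) :
    MeasurableSet (fibrePairs c) := by
  rw [fibrePairs_eq_iUnion]
  exact MeasurableSet.iUnion fun i => (hc i).prod (hc i)

lemma pairwise_disjoint_fibre_squares (c : X → ι) :
    Pairwise (Function.onFun Disjoint fun i => (c ⁻¹' {i}) ×ˢ (c ⁻¹' {i})) := by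
  intro i j hij
  refine Set.disjoint_left.2 ?_
  rintro ⟨x, y⟩ ⟨h1, -⟩ ⟨h2, -⟩
  exact hij (h1.symm.trans h2)

lemma prod_fibrePairs (hc : ∀ i, MeasurableSet (c ⁻¹' {i})) :
    (μ.prod μ) (fibrePairs c) = ∑ i, μ (c ⁻¹' {i}) ^ 2 := by
  rw [fibrePairs_eq_iUnion, measure_iUnion (pairwise_disjoint_fibre_squares c)
    fun i => (hc i).prod (hc i), tsum_fintype]
  simp [Measure.prod_prod, sq]

lemma sq_measure_univ_le (hc : ∀ i, MeasurableSet (c ⁻¹' {i})) :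
    μ Set.univ ^ 2 ≤ Fintype.card ι * (μ.prod μ) (fibrePairs c) := by
  have h1 : μ Set.univ = ∑ i, μ (c ⁻¹' {i}) := by
    have : (Set.univ : Set X) = ⋃ i, c ⁻¹' {i} := by ext x; simp
    rw [this, measure_iUnion _ hc, tsum_fintype]
    intro i j hij
    exact Disjoint.preimage c (by simpa using hij)
  rw [prod_fibrePairs hc, h1]
  have h2 := sq_sum_le_card_mul_sum_sq (s := (Finset.univ : Finset ι))
    (f := fun i => (μ (c ⁻¹' {i})).toNNReal)
  have h3 : ∀ i, ((μ (c ⁻¹' {i})).toNNReal : ℝ≥0∞) = μ (c ⁻¹' {i}) := fun i =>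
    ENNReal.coe_toNNReal (measure_ne_top _ _)
  have h4 := ENNReal.coe_le_coe.2 h2
  push_cast at h4
  simpa [h3] using h4

lemma card_mul_prod_le (hc : ∀ i, MeasurableSet (c ⁻¹' {i}))
    (hcard : ∀ i, Fintype.card ι * μ (c ⁻¹' {i}) ≤ 1) {D : Set X} (hD : MeasurableSet D) :
    Fintype.card ι * (μ.prod μ) {q | q ∈ fibrePairs c ∧ q.1 ∈ D} ≤ μ D := by
  have hm : MeasurableSet {q : X × X | q ∈ fibrePairs c ∧ q.1 ∈ D} :=
    (measurableSet_fibrePairs hc).inter (measurable_fst hD)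
  rw [Measure.prod_apply hm, ← lintegral_const_mul' _ _ (by simp), ← lintegral_indicator_one hD]
  refine lintegral_mono fun x => ?_
  by_cases hx : x ∈ D
  · rw [Set.indicator_of_mem hx]
    refine le_trans ?_ (hcard (c x))
    gcongr
    rintro y ⟨hy, -⟩
    exact hy.symm
  · have : Prod.mk x ⁻¹' {q : X × X | q ∈ fibrePairs c ∧ q.1 ∈ D} = ∅ := by
      ext y; simp [hx]
    simp [this]

lemma card_mul_prod_le' (hc : ∀ i, MeasurableSet (c ⁻¹' {i}))
    (hcard : ∀ i, Fintype.card ι * μ (c ⁻¹' {i}) ≤ 1) {D : Set X} (hD : MeasurableSet D) :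
    Fintype.card ι * (μ.prod μ) {q | q ∈ fibrePairs c ∧ q.2 ∈ D} ≤ μ D := by
  refine le_trans (le_of_eq ?_) (card_mul_prod_le hc hcard hD)
  have hm : MeasurableSet {q : X × X | q ∈ fibrePairs c ∧ q.1 ∈ D} :=
    (measurableSet_fibrePairs hc).inter (measurable_fst hD)
  rw [← Measure.measurePreserving_swap.measure_preimage hm.nullMeasurableSet]
  congr 2
  ext q
  simp [fibrePairs, eq_comm]

lemma card_mul_prod_split_le (hc : ∀ i, MeasurableSet (c ⁻¹' {i}))
    (hcard : ∀ i, Fintype.card ι * μ (c ⁻¹' {i}) ≤ 1) {D : Set X} (hD : MeasurableSet D)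
    (E : Set ι) :
    Fintype.card ι * (μ.prod μ) {q | q ∈ fibrePairs c ∧ q.1 ∈ D ∧ q.2 ∉ D}
      ≤ 2 * μ (symmDiff D (c ⁻¹' E)) := by
  have hS : MeasurableSet (symmDiff D (c ⁻¹' E)) :=
    hD.symmDiff (measurableSet_preimage_of_fibres hc E)
  calc _ ≤ Fintype.card ι * ((μ.prod μ) {q | q ∈ fibrePairs c ∧ q.1 ∈ symmDiff D (c ⁻¹' E)}
        + (μ.prod μ) {q | q ∈ fibrePairs c ∧ q.2 ∈ symmDiff D (c ⁻¹' E)}) := by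
        gcongr
        refine le_trans (measure_mono ?_) (measure_union_le _ _)
        rintro ⟨x, y⟩ ⟨h, hx, hy⟩
        have h' : c x = c y := h
        by_cases hxE : c x ∈ E
        · exact Or.inr ⟨h, Or.inr ⟨by simpa [← h'] using hxE, hy⟩⟩
        · exact Or.inl ⟨h, Or.inl ⟨hx, by simpa using hxE⟩⟩
    _ ≤ _ := by
      rw [mul_add, two_mul]
      exact add_le_add (card_mul_prod_le hc hcard hS) (card_mul_prod_le' hc hcard hS)

end FiniteQuotients

section Approximation

open MeasureTheory
open scoped ENNReal

variable {X : Type*} [MeasurableSpace X] {μ : Measure X} [IsFiniteMeasure μ]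
  {ι : ℕ → Type*} [∀ k, Fintype (ι k)] {c : ∀ k, X → ι k}

/-- Measurable sets are approximated by unions of fibres of the maps `c k`. -/
def ApproximatedBy (μ : Measure X) (c : ∀ k, X → ι k) : Prop :=
  ∀ D, MeasurableSet D → ∀ ε : ℝ≥0∞, ε ≠ 0 → ∃ K, ∀ k ≥ K, ∃ E : Set (ι k),
    μ (symmDiff D (c k ⁻¹' E)) ≤ ε

lemma exists_finset_measure_notMem_le {Λ : Type*} [Countable Λ] [MeasurableSpace Λ]
    [DiscreteMeasurableSpace Λ] {w : X → Λ} (hw : Measurable w) {ε : ℝ≥0∞} (hε : ε ≠ 0) :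
    ∃ F : Finset Λ, μ {x | w x ∉ F} ≤ ε := by
  classical
  have hs : ∀ F : Finset Λ, MeasurableSet {x | w x ∉ F} := fun F =>
    hw (MeasurableSet.of_discrete (s := {l | l ∉ F}))
  have hanti : Antitone fun F : Finset Λ => {x | w x ∉ F} := fun F G h x hx hF => hx (h hF)
  have ht := tendsto_measure_iInter_atTop (μ := μ) (fun F => (hs F).nullMeasurableSet) hanti
    ⟨∅, measure_ne_top _ _⟩
  have he : (⋂ F : Finset Λ, {x | w x ∉ F}) = ∅ := by
    ext x
    simp only [Set.mem_iInter, Set.mem_ofPred_eq, Set.mem_empty_iff_false, iff_false, not_forall,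
      not_not]
    exact ⟨{w x}, by simp⟩
  rw [he, measure_empty] at ht
  exact ((ht.eventually (ge_mem_nhds (pos_iff_ne_zero.2 hε))).exists)

lemma exists_forall_ge_finset {α : Type*} (F : Finset α) {P : α → ℕ → Prop}
    (h : ∀ a, ∃ K, ∀ k ≥ K, P a k) : ∃ K, ∀ k ≥ K, ∀ a ∈ F, P a k := by
  choose K hK using h
  exact ⟨F.sup K, fun k hk a ha => hK a k ((Finset.le_sup ha).trans hk)⟩

theorem exists_card_mul_prod_ne_le (hc : ∀ k i, MeasurableSet (c k ⁻¹' {i}))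
    (hcard : ∀ k i, Fintype.card (ι k) * μ (c k ⁻¹' {i}) ≤ 1) (happ : ApproximatedBy μ c)
    {Λ : Type*} [Countable Λ] [MeasurableSpace Λ] [DiscreteMeasurableSpace Λ] {w : X → Λ}
    (hw : Measurable w) {ε : ℝ≥0∞} (hε : ε ≠ 0) : ∃ K, ∀ k ≥ K,
      Fintype.card (ι k) * (μ.prod μ) {q | q ∈ fibrePairs (c k) ∧ w q.1 ≠ w q.2} ≤ ε := by
  have hε2 : ε / 2 ≠ 0 := (ENNReal.half_pos hε).ne'
  obtain ⟨F, hF⟩ := exists_finset_measure_notMem_le (μ := μ) hw hε2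
  set η : ℝ≥0∞ := ε / 2 / (2 * (F.card + 1)) with hη
  have hη0 : η ≠ 0 := by
    rw [hη]
    exact (ENNReal.div_pos hε2 (by finiteness)).ne'
  obtain ⟨K, hK⟩ := exists_forall_ge_finset F fun l =>
    happ (w ⁻¹' {l}) (hw (measurableSet_singleton l)) η hη0
  refine ⟨K, fun k hk => ?_⟩
  have hsub : {q : X × X | q ∈ fibrePairs (c k) ∧ w q.1 ≠ w q.2} ⊆
      {q | q ∈ fibrePairs (c k) ∧ q.1 ∈ {x | w x ∉ F}} ∪
      ⋃ l ∈ F, {q | q ∈ fibrePairs (c k) ∧ q.1 ∈ w ⁻¹' {l} ∧ q.2 ∉ w ⁻¹' {l}} := by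
    rintro ⟨x, y⟩ ⟨h, hne⟩
    by_cases hx : w x ∈ F
    · refine Or.inr (Set.mem_biUnion hx ⟨h, rfl, fun hy => hne ?_⟩)
      exact hy.symm
    · exact Or.inl ⟨h, hx⟩
  have hFm : MeasurableSet {x | w x ∉ F} := hw (MeasurableSet.of_discrete (s := {l | l ∉ F}))
  calc _ ≤ Fintype.card (ι k) * ((μ.prod μ) {q | q ∈ fibrePairs (c k) ∧ q.1 ∈ {x | w x ∉ F}} +
        ∑ l ∈ F, (μ.prod μ) {q | q ∈ fibrePairs (c k) ∧ q.1 ∈ w ⁻¹' {l} ∧ q.2 ∉ w ⁻¹' {l}}) := by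
        gcongr
        exact (measure_mono hsub).trans ((measure_union_le _ _).trans
          (add_le_add_right (measure_biUnion_finset_le _ _) _))
    _ ≤ ε / 2 + ∑ l ∈ F, 2 * η := by
      rw [mul_add, Finset.mul_sum]
      refine add_le_add ((card_mul_prod_le (hc k) (hcard k) hFm).trans hF)
        (Finset.sum_le_sum fun l hl => ?_)
      obtain ⟨E, hE⟩ := hK k hk l hl
      refine (card_mul_prod_split_le (hc k) (hcard k) (hw (measurableSet_singleton l)) E).trans ?_
      gcongr
    _ ≤ ε / 2 + ε / 2 := by
      gcongr
      rw [Finset.sum_const, nsmul_eq_mul]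
      calc (F.card : ℝ≥0∞) * (2 * η) ≤ (2 * (F.card + 1)) * η := by
            rw [← mul_assoc, mul_comm (F.card : ℝ≥0∞)]; gcongr; exact le_self_add
        _ ≤ ε / 2 := ENNReal.mul_div_le
    _ = ε := ENNReal.add_halves ε

end Approximation

section Rigidity

open MeasureTheory
open scoped ENNReal

lemma ENNReal.exists_ofReal_mul_pos_le {κ : ℝ≥0∞} (hκ : κ ≠ 0) (N : ℕ) :
    ∃ δ : ℝ, 0 < δ ∧ N * ENNReal.ofReal δ ≤ κ := by
  have h : κ / (N + 1) ≠ 0 := (ENNReal.div_pos hκ (by finiteness)).ne'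
  obtain ⟨r, hr0, hr⟩ := ENNReal.lt_iff_exists_nnreal_btwn.1 (pos_iff_ne_zero.2 h)
  refine ⟨r, by exact_mod_cast hr0, ?_⟩
  rw [ENNReal.ofReal_coe_nnreal]
  calc (N : ℝ≥0∞) * r ≤ (N + 1) * (κ / (N + 1)) := by gcongr; exact le_self_add
    _ ≤ κ := ENNReal.mul_div_le

lemma exists_index_le_mul {ι : Type*} [Fintype ι] {f g : ι → ℝ≥0∞} {κ : ℝ≥0∞}
    (hle : ∑ i, f i ≤ κ * ∑ i, g i) (hg : ∑ i, g i ≠ 0) :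
    ∃ i, g i ≠ 0 ∧ f i ≤ κ * g i := by
  classical
  by_contra! h
  have hne : (Finset.univ.filter fun i => g i ≠ 0).Nonempty := by
    by_contra hn
    rw [Finset.not_nonempty_iff_eq_empty, Finset.filter_eq_empty_iff] at hn
    exact hg (Finset.sum_eq_zero fun i hi => by simpa using hn hi)
  have h1 : ∑ i ∈ Finset.univ.filter (fun i => g i ≠ 0), κ * g i <
      ∑ i ∈ Finset.univ.filter (fun i => g i ≠ 0), f i :=
    ENNReal.sum_lt_sum_of_nonempty hne fun i hi => h i (Finset.mem_filter.1 hi).2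
  have h2 : ∑ i ∈ Finset.univ.filter (fun i => g i ≠ 0), f i ≤ ∑ i, f i :=
    Finset.sum_le_univ_sum_of_nonneg fun _ => zero_le
  have h3 : ∑ i ∈ Finset.univ.filter (fun i => g i ≠ 0), κ * g i = κ * ∑ i, g i := by
    rw [Finset.mul_sum, Finset.sum_filter_of_ne]
    intro i _ hi h0
    simp [h0] at hi
  rw [h3] at h1
  exact absurd (h1.trans_le h2) (not_lt.2 hle)

variable {X : Type*} [MeasurableSpace X] {μ : Measure X} [IsFiniteMeasure μ]

lemma exists_section_le {B : Set X} (hB : MeasurableSet B) (hB0 : μ B ≠ 0) {P : Set (X × X)}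
    (hP : MeasurableSet P) {κ : ℝ≥0∞}
    (h : (μ.prod μ) {q | q ∈ B ×ˢ B ∧ q ∈ P} ≤ κ * μ B ^ 2) :
    ∃ x ∈ B, μ {y | y ∈ B ∧ (x, y) ∈ P} ≤ κ * μ B := by
  by_contra! hcon
  have hm : MeasurableSet {q | q ∈ B ×ˢ B ∧ q ∈ P} := (hB.prod hB).inter hP
  rw [Measure.prod_apply hm] at h
  have h1 : ∫⁻ x in B, κ * μ B ∂μ < ∫⁻ x in B, μ (Prod.mk x ⁻¹' {q | q ∈ B ×ˢ B ∧ q ∈ P}) ∂μ := by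
    refine setLIntegral_strict_mono hB hB0 (measurable_measure_prodMk_left hm) ?_ ?_
    · rw [setLIntegral_const]
      have : ∃ x, x ∈ B := nonempty_of_measure_ne_zero hB0
      obtain ⟨x, hx⟩ := this
      exact ENNReal.mul_ne_top ((hcon x hx).trans_le le_top).ne (measure_ne_top _ _)
    · refine Filter.Eventually.of_forall fun x hx => (hcon x hx).trans_le (measure_mono ?_)
      rintro y ⟨hy, hyP⟩
      exact ⟨⟨hx, hy⟩, hyP⟩
  rw [setLIntegral_const, mul_assoc, ← sq] at h1
  exact absurd (h1.trans_le (setLIntegral_le_lintegral _ _)) (not_lt.2 h)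

variable {Γ Λ : Type*} [Group Γ] [Group Λ]
  [MeasurableSpace Λ] [DiscreteMeasurableSpace Λ] [Countable Λ]
  {ι : ℕ → Type*} [∀ k, Fintype (ι k)] {c : ∀ k, X → ι k}
  {T : Γ → X → X} {w : Γ → X → Λ}

/-- Cocycles of a profinite action into a countable group are nearly constant, on a fibre of
some finite quotient, along powers of elements with relative property (T). -/
theorem exists_fibre_nearly_constant (hμ : μ ≠ 0) (hc : ∀ k i, MeasurableSet (c k ⁻¹' {i}))
    (hcard : ∀ k i, Fintype.card (ι k) * μ (c k ⁻¹' {i}) ≤ 1) (happ : ApproximatedBy μ c)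
    (hone : ∀ x, T 1 x = x) (hmul : ∀ g h x, T (g * h) x = T g (T h x))
    (hT : ∀ γ, MeasurePreserving (T γ) μ μ)
    (hcT : ∀ k γ x y, c k x = c k y → c k (T γ x) = c k (T γ y))
    (hw : ∀ γ, Measurable (w γ)) (hwc : ∀ g h x, w (g * h) x = w g (T h x) * w h x)
    {J : Type*} [Fintype J] (u v W W' : J → Γ)
    (h1 : ∀ j, u j * v j = v j * u j) (h2 : ∀ j, W j * u j = u j * W j)
    (h3 : ∀ j, v j * W j = W j * u j * v j) (h4 : ∀ j, W' j * v j = v j * W' j)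
    (h5 : ∀ j, u j * W' j = W' j * v j * u j) {κ : ℝ≥0∞} (hκ : κ ≠ 0) :
    ∃ k, ∃ b : ι k, μ (c k ⁻¹' {b}) ≠ 0 ∧ ∀ j (a : ℕ), (∀ x, c k (T (u j ^ a) x) = c k x) →
      ∃ l : Λ, μ {x | x ∈ c k ⁻¹' {b} ∧ w (u j ^ a) x ≠ l} ≤ κ * μ (c k ⁻¹' {b}) := by
  classical
  obtain ⟨δ, hδ, hδκ⟩ := ENNReal.exists_ofReal_mul_pos_le hκ (4 * Fintype.card J)
  obtain ⟨ε, hε, key⟩ := exists_defect_measure hδ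
  have hμu : μ Set.univ ≠ 0 := by simpa using hμ
  set η : ℝ≥0∞ := ENNReal.ofReal ε * μ Set.univ ^ 2 with hη
  have hη0 : η ≠ 0 := mul_ne_zero (by simpa using hε) (pow_ne_zero _ hμu)
  set F : Finset Γ := Finset.univ.biUnion fun j => {u j, v j, W j, W' j} with hF
  obtain ⟨k, hk⟩ := exists_forall_ge_finset F fun γ =>
    exists_card_mul_prod_ne_le hc hcard happ (hw γ) hη0
  have hk := hk k le_rfl
  have hN : (Fintype.card (ι k) : ℝ≥0∞) ≠ 0 := by
    obtain ⟨x, -⟩ := nonempty_of_measure_ne_zero hμu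
    have : Nonempty (ι k) := ⟨c k x⟩
    simp
  set P := fibrePairs (c k) with hPdef
  have hP : MeasurableSet P := measurableSet_fibrePairs (hc k)
  set ν := (μ.prod μ).restrict P with hν
  set S : Γ → X × X → X × X := fun γ => Prod.map (T γ) (T γ) with hSdef
  have hSP : ∀ γ, S γ ⁻¹' P = P := by
    intro γ
    ext ⟨x, y⟩
    refine ⟨fun h => ?_, fun h => hcT k γ x y h⟩
    have := hcT k γ⁻¹ (T γ x) (T γ y) h
    rwa [← hmul, ← hmul, inv_mul_cancel, hone, hone] at this
  have hS : ∀ γ, MeasurePreserving (S γ) ν ν := by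
    intro γ
    have := ((hT γ).prod (hT γ)).restrict_preimage hP
    rwa [show Prod.map (T γ) (T γ) ⁻¹' P = P from hSP γ] at this
  have hνu : ν Set.univ = ∑ i, μ (c k ⁻¹' {i}) ^ 2 := by
    rw [hν, Measure.restrict_apply_univ, prod_fibrePairs (hc k)]
  have hνcs : μ Set.univ ^ 2 ≤ Fintype.card (ι k) * ν Set.univ := by
    rw [hν, Measure.restrict_apply_univ]
    exact sq_measure_univ_le (hc k)
  have hνapp : ∀ s : Set (X × X), MeasurableSet s → ν s = (μ.prod μ) {q | q ∈ P ∧ q ∈ s} := by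
    intro s hs
    rw [hν, Measure.restrict_apply hs, Set.inter_comm]
    rfl
  have hwm : ∀ γ, MeasurableSet {q : X × X | w γ q.1 ≠ w γ q.2} := fun γ =>
    (measurableSet_eq_fun ((hw γ).comp measurable_fst) ((hw γ).comp measurable_snd)).compl
  have hsmall : ∀ j, ∀ γ ∈ ({u j, v j, W j, W' j} : Set Γ),
      ν.real {q | w γ q.1 ≠ w γ q.2} ≤ ε * ν.real Set.univ := by
    intro j γ hγ
    have hγF : γ ∈ F := Finset.mem_biUnion.2 ⟨j, Finset.mem_univ _, by simpa using hγ⟩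
    have hle : ν {q | w γ q.1 ≠ w γ q.2} ≤ ENNReal.ofReal ε * ν Set.univ := by
      refine (ENNReal.mul_le_mul_iff_right hN (by simp)).1 ?_
      rw [hνapp _ (hwm γ)]
      refine (hk γ hγF).trans ?_
      rw [hη, mul_left_comm]
      gcongr
    rw [measureReal_def, measureReal_def]
    refine (ENNReal.toReal_mono (by finiteness) hle).trans ?_
    rw [ENNReal.toReal_mul, ENNReal.toReal_ofReal hε.le]
  choose m hm1 hm2 using fun j => key (Q := X × X) (Γ := Γ) (Λ := Λ) (ν := ν) (S := S)
    (w₁ := fun γ q => w γ q.1) (w₂ := fun γ q => w γ q.2)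
    (fun q => Prod.ext (hone _) (hone _)) (fun g h q => Prod.ext (hmul _ _ _) (hmul _ _ _)) hS
    (fun γ => (hw γ).comp measurable_fst) (fun γ => (hw γ).comp measurable_snd)
    (fun g h q => hwc g h q.1) (fun g h q => hwc g h q.2) (u j) (v j) (W j) (W' j)
    (h1 j) (h2 j) (h3 j) (h4 j) (h5 j) (hsmall j)
  set sq : ι k → Set (X × X) := fun b => (c k ⁻¹' {b}) ×ˢ (c k ⁻¹' {b}) with hsq
  have hsqm : ∀ b, MeasurableSet (sq b) := fun b => (hc k b).prod (hc k b)
  have htot : ∑ b, ∑ j, 4 * m j (sq b) ≤ κ * ∑ b, μ (c k ⁻¹' {b}) ^ 2 := by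
    rw [Finset.sum_comm]
    calc ∑ j, ∑ b, 4 * m j (sq b) ≤ ∑ j : J, 4 * (ENNReal.ofReal δ * ν Set.univ) := by
          refine Finset.sum_le_sum fun j _ => ?_
          rw [← Finset.mul_sum]
          gcongr
          refine le_trans ?_ (hm1 j)
          rw [← tsum_fintype (L := .unconditional _), ← measure_iUnion (pairwise_disjoint_fibre_squares (c k)) hsqm]
          exact measure_mono (Set.subset_univ _)
      _ = ((4 * Fintype.card J : ℕ) * ENNReal.ofReal δ) * ν Set.univ := by
        simp; ring
      _ ≤ κ * ∑ b, μ (c k ⁻¹' {b}) ^ 2 := by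
        rw [hνu]; gcongr
  obtain ⟨b, hb0, hb⟩ := exists_index_le_mul htot
    (by
      rw [← hνu]
      intro h0
      rw [h0, mul_zero] at hνcs
      exact hμu (by simpa using hνcs))
  have hb0' : μ (c k ⁻¹' {b}) ≠ 0 := fun h => hb0 (by simp [h])
  refine ⟨k, b, hb0', fun j a hja => ?_⟩
  have hinv : ∀ q, S (u j ^ a) q ∈ sq b ↔ q ∈ sq b := by
    intro q
    simp [hSdef, hsq, hja]
  have h := hm2 j a (sq b) (hsqm b) hinv
  have h' : 4 * m j (sq b) ≤ κ * μ (c k ⁻¹' {b}) ^ 2 :=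
    (Finset.single_le_sum (f := fun j => 4 * m j (sq b)) (fun _ _ => zero_le)
      (Finset.mem_univ j)).trans hb
  rw [hνapp {q | q ∈ sq b ∧ w (u j ^ a) q.1 ≠ w (u j ^ a) q.2} ((hsqm b).inter (hwm _))] at h
  obtain ⟨x, -, hx⟩ := exists_section_le (hc k b) hb0' (hwm (u j ^ a)) (κ := κ) (by
    refine le_trans (measure_mono ?_) (h.trans h')
    rintro ⟨x, y⟩ ⟨hq, hne⟩
    exact ⟨hq.1.trans hq.2.symm, hq, hne⟩)
  refine ⟨w (u j ^ a) x, le_trans (measure_mono ?_) hx⟩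
  rintro y ⟨hy, hne⟩
  exact ⟨hy, fun h => hne h.symm⟩

end Rigidity

section Elementary

open Matrix

variable {ι : Type*} [Fintype ι] [DecidableEq ι]

/-- The elementary matrix `1 + b E_ij` (the identity if `i = j`). -/
def elemSL (i j : ι) (b : ℤ) : SpecialLinearGroup ι ℤ :=
  if h : i ≠ j then SpecialLinearGroup.transvection h b else 1

lemma elemSL_coe {i j : ι} (h : i ≠ j) (b : ℤ) :
    SpecialLinearGroup.coeMonoidHom (elemSL i j b) = 1 + Matrix.single i j b := by
  rw [elemSL, dif_pos h]
  rfl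

lemma elemSL_mul {i j : ι} (h : i ≠ j) (a b : ℤ) :
    elemSL i j a * elemSL i j b = elemSL i j (a + b) := by
  apply SpecialLinearGroup.coeMonoidHom_injective
  rw [map_mul, elemSL_coe h, elemSL_coe h, elemSL_coe h]
  simp [mul_add, add_mul, h.symm, Matrix.single_add, add_assoc]

lemma elemSL_zero (i j : ι) : elemSL i j 0 = 1 := by
  by_cases h : i ≠ j
  · apply SpecialLinearGroup.coeMonoidHom_injective
    rw [elemSL_coe h]
    simp
  · rw [elemSL, dif_neg h]

lemma elemSL_pow {i j : ι} (h : i ≠ j) (a : ℤ) (k : ℕ) :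
    elemSL i j a ^ k = elemSL i j (k * a) := by
  induction k with
  | zero => simp [elemSL_zero]
  | succ k ih => rw [pow_succ, ih, elemSL_mul h]; push_cast; ring_nf

lemma elemSL_inv {i j : ι} (h : i ≠ j) (a : ℤ) : (elemSL i j a)⁻¹ = elemSL i j (-a) := by
  rw [inv_eq_iff_mul_eq_one, elemSL_mul h, add_neg_cancel, elemSL_zero]

lemma elemSL_commute {i j k l : ι} (hij : i ≠ j) (hkl : k ≠ l) (hjk : j ≠ k) (hli : l ≠ i)
    (a b : ℤ) : elemSL i j a * elemSL k l b = elemSL k l b * elemSL i j a := by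
  apply SpecialLinearGroup.coeMonoidHom_injective
  rw [map_mul, map_mul, elemSL_coe hij, elemSL_coe hkl]
  simp [mul_add, add_mul, hjk, hli]
  abel

lemma elemSL_mul_comm_corner {i j l : ι} (hij : i ≠ j) (hjl : j ≠ l) (hil : i ≠ l) (a b : ℤ) :
    elemSL i j a * elemSL j l b = elemSL i l (a * b) * elemSL j l b * elemSL i j a := by
  apply SpecialLinearGroup.coeMonoidHom_injective
  simp only [map_mul, elemSL_coe hij, elemSL_coe hjl, elemSL_coe hil]
  simp [mul_add, add_mul, hjl.symm, hil.symm]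
  abel

end Elementary

section RootGroups

open MeasureTheory Matrix
open scoped ENNReal

variable {n : ℕ} {Λ : Type*} [Group Λ] {S : Subalgebra ℚ (Matrix (Fin n) (Fin n) ℚ)}
  {N : Subgroup (Matrix (Fin n) (Fin n) ℚ)ˣ}

lemma exists_perm_map_pair {i j : Fin (n + 1)} (hij : i ≠ j) (hn : 1 ≤ n) :
    ∃ σ : Equiv.Perm (Fin (n + 1)), σ (Fin.ofNat (n + 1) 0) = i ∧ σ (Fin.ofNat (n + 1) n) = j := by
  have h0n : Fin.ofNat (n + 1) 0 ≠ Fin.ofNat (n + 1) n := by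
    intro h
    have := congrArg Fin.val h
    simp [Fin.ofNat, Nat.mod_eq_of_lt (Nat.lt_succ_self n)] at this
    omega
  set τ := Equiv.swap (Fin.ofNat (n + 1) 0) i
  refine ⟨τ.trans (Equiv.swap (τ (Fin.ofNat (n + 1) n)) j), ?_, ?_⟩
  · rw [Equiv.trans_apply, Equiv.swap_apply_left]
    refine Equiv.swap_apply_of_ne_of_ne ?_ hij
    intro h
    apply h0n
    apply τ.injective
    rw [Equiv.swap_apply_left]
    exact h
  · simp

lemma ofNat_ne_ofNat {i j : ℕ} (hi : i ≤ n) (hj : j ≤ n) (h : i ≠ j) :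
    Fin.ofNat (n + 1) i ≠ Fin.ofNat (n + 1) j := by
  intro he
  have := congrArg Fin.val he
  simp only [Fin.ofNat, Nat.mod_eq_of_lt (Nat.lt_succ_of_le hi),
    Nat.mod_eq_of_lt (Nat.lt_succ_of_le hj)] at this
  exact h this

/-- A family of elements satisfying the Steinberg relations of type `A_n`, in a quotient of a
group of `n × n` matrices by the units of a normalized subalgebra, is torsion. -/
theorem exists_pow_eq_one_of_steinberg_relations (hn : 1 ≤ n)
    (hN : ∀ g ∈ N, ∀ s ∈ S, (g : Matrix (Fin n) (Fin n) ℚ) * s *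
      (↑g⁻¹ : Matrix (Fin n) (Fin n) ℚ) ∈ S)
    (π : N →* Λ) (hπ : Function.Surjective π)
    (hker : ∀ g : N, π g = 1 ↔ ((g : (Matrix (Fin n) (Fin n) ℚ)ˣ) : Matrix _ _ ℚ) ∈ S)
    {r : Fin (n + 1) → Fin (n + 1) → Λ} {q : ℕ} (hq : q ≠ 0)
    (hr1 : ∀ i j l, i ≠ j → j ≠ l → i ≠ l → ∀ a b : ℕ, r i j ^ a * r j l ^ b * (r i j)⁻¹ ^ a *
      (r j l)⁻¹ ^ b * (r i l)⁻¹ ^ (q * a * b) = 1)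
    (hr2 : ∀ i j k l, i ≠ j → k ≠ l → j ≠ k → l ≠ i → ∀ a b : ℕ, r i j ^ a * r k l ^ b *
      (r i j)⁻¹ ^ a * (r k l)⁻¹ ^ b = 1) {i j : Fin (n + 1)} (hij : i ≠ j) :
    ∃ M : ℕ, 0 < M ∧ r i j ^ M = 1 := by
  choose R hR using fun i j => hπ (r i j)
  rcases hn.eq_or_lt with rfl | hn
  · refine ⟨1, one_pos, ?_⟩
    rw [pow_one, ← hR, hker]
    have : ((R i j : (Matrix (Fin 1) (Fin 1) ℚ)ˣ) : Matrix (Fin 1) (Fin 1) ℚ) =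
        algebraMap ℚ _ (((R i j : (Matrix (Fin 1) (Fin 1) ℚ)ˣ) : Matrix (Fin 1) (Fin 1) ℚ) 0 0) := by
      ext a b
      rw [Subsingleton.elim a 0, Subsingleton.elim b 0]
      simp [Matrix.algebraMap_matrix_apply]
    rw [this]
    exact S.algebraMap_mem _
  obtain ⟨σ, h0, h1⟩ := exists_perm_map_pair hij hn.le
  have hne : ∀ {i j : ℕ}, i ≤ n → j ≤ n → i ≠ j →
      σ (Fin.ofNat (n + 1) i) ≠ σ (Fin.ofNat (n + 1) j) := fun hi hj h he =>
    ofNat_ne_ofNat hi hj h (σ.injective he)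
  obtain ⟨M, hM, hMS⟩ := exists_pow_mem_of_unipotent_relations hn S
    (fun i j => (R (σ (Fin.ofNat (n + 1) i)) (σ (Fin.ofNat (n + 1) j)) :
      (Matrix (Fin n) (Fin n) ℚ)ˣ)) q hq (fun i j _ _ s hs => hN _ (SetLike.coe_mem _) s hs)
    (fun i j l hij hjl hl a b => by
      have := hr1 _ _ _ (hne (by omega) (by omega) hij.ne) (hne (by omega) hl hjl.ne)
        (hne (by omega) hl (hij.trans hjl).ne) a b
      rw [← hR, ← hR, ← hR] at this
      simp only [← map_pow, ← map_inv, ← map_mul] at this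
      rw [hker] at this
      exact_mod_cast this)
    (fun i j k l hij hj hkl hl hjk hli a b => by
      have := hr2 _ _ _ _ (hne (by omega) hj hij.ne) (hne (by omega) hl hkl.ne)
        (hne hj (by omega) hjk) (hne hl (by omega) hli) a b
      rw [← hR, ← hR] at this
      simp only [← map_pow, ← map_inv, ← map_mul] at this
      rw [hker] at this
      exact_mod_cast this)
  refine ⟨M, hM, ?_⟩
  rw [h0, h1] at hMS
  rw [← hR, ← map_pow, hker]
  exact_mod_cast hMS

end RootGroups

section NearConstant

open MeasureTheory Matrix
open scoped ENNReal

variable {X : Type*} [MeasurableSpace X] {μ : Measure X} [IsFiniteMeasure μ] {B : Set X}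
  {Γ Λ : Type*} [Group Γ] [Group Λ] {T : Γ → X → X} {w : Γ → X → Λ}

/-- `f` equals `l` on `B`, up to a set of relative measure at most `t`. -/
def NearConst (μ : Measure X) (B : Set X) (f : X → Λ) (l : Λ) (t : ℝ≥0∞) : Prop :=
  μ {x | x ∈ B ∧ f x ≠ l} ≤ t * μ B

lemma NearConst.unique (hB0 : μ B ≠ 0) {f : X → Λ} {l l' : Λ} {t t' : ℝ≥0∞}
    (h : NearConst μ B f l t) (h' : NearConst μ B f l' t') (ht : t + t' < 1) : l = l' := by
  by_contra hne
  have hsub : B ⊆ {x | x ∈ B ∧ f x ≠ l} ∪ {x | x ∈ B ∧ f x ≠ l'} := by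
    intro x hx
    by_cases hfx : f x = l
    · exact Or.inr ⟨hx, fun h => hne (hfx.symm.trans h)⟩
    · exact Or.inl ⟨hx, hfx⟩
  have h1 : μ B ≤ (t + t') * μ B := by
    rw [add_mul]
    exact (measure_mono hsub).trans ((measure_union_le _ _).trans (add_le_add h h'))
  have h2 : (t + t') * μ B < 1 * μ B :=
    ENNReal.mul_lt_mul_left hB0 (measure_ne_top _ _) ht
  rw [one_mul] at h2
  exact absurd h1 (not_le.2 h2)

lemma NearConst.mul {g h : Γ} (hmul : w (g * h) = fun x => w g (T h x) * w h x)
    (hT : MeasurePreserving (T h) μ μ) (hB : MeasurableSet B)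
    [MeasurableSpace Λ] [DiscreteMeasurableSpace Λ] (hw : Measurable (w g))
    (hTB : ∀ x, T h x ∈ B ↔ x ∈ B) {l l' : Λ} {t t' : ℝ≥0∞}
    (h1 : NearConst μ B (w g) l t) (h2 : NearConst μ B (w h) l' t') :
    NearConst μ B (w (g * h)) (l * l') (t + t') := by
  have hsub : {x | x ∈ B ∧ w (g * h) x ≠ l * l'} ⊆
      T h ⁻¹' {x | x ∈ B ∧ w g x ≠ l} ∪ {x | x ∈ B ∧ w h x ≠ l'} := by
    rintro x ⟨hx, hne⟩
    by_cases hx' : w h x = l'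
    · refine Or.inl ⟨(hTB x).2 hx, fun he => hne ?_⟩
      rw [hmul]
      exact congrArg₂ _ he hx'
    · exact Or.inr ⟨hx, hx'⟩
  have hm : MeasurableSet {x | x ∈ B ∧ w g x ≠ l} :=
    hB.inter (hw (MeasurableSet.of_discrete (s := {l}ᶜ)))
  unfold NearConst
  rw [add_mul]
  refine (measure_mono hsub).trans ((measure_union_le _ _).trans (add_le_add ?_ h2))
  rwa [hT.measure_preimage hm.nullMeasurableSet]

lemma NearConst.inv {g : Γ} (hone : w 1 = fun _ => 1)
    (hmul : w (g * g⁻¹) = fun x => w g (T g⁻¹ x) * w g⁻¹ x)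
    (hT : MeasurePreserving (T g⁻¹) μ μ) (hB : MeasurableSet B)
    [MeasurableSpace Λ] [DiscreteMeasurableSpace Λ] (hw : Measurable (w g))
    (hTB : ∀ x, T g⁻¹ x ∈ B ↔ x ∈ B) {l : Λ} {t : ℝ≥0∞}
    (h1 : NearConst μ B (w g) l t) : NearConst μ B (w g⁻¹) l⁻¹ t := by
  have hm : MeasurableSet {x | x ∈ B ∧ w g x ≠ l} :=
    hB.inter (hw (MeasurableSet.of_discrete (s := {l}ᶜ)))
  refine le_trans (measure_mono ?_)
    ((hT.measure_preimage hm.nullMeasurableSet).le.trans h1)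
  rintro x ⟨hx, hne⟩
  refine ⟨(hTB x).2 hx, fun he => hne ?_⟩
  have := congrFun hmul x
  rw [mul_inv_cancel, hone] at this
  simp only [he] at this
  exact (inv_eq_of_mul_eq_one_right this.symm).symm

end NearConstant

section RigidFibre

open MeasureTheory Matrix
open scoped ENNReal

variable {n : ℕ} {Λ : Type*} [Group Λ] [MeasurableSpace Λ] [DiscreteMeasurableSpace Λ] [Countable Λ]
  {S : Subalgebra ℚ (Matrix (Fin n) (Fin n) ℚ)} {N : Subgroup (Matrix (Fin n) (Fin n) ℚ)ˣ}
  {X : Type*} [MeasurableSpace X] {μ : Measure X} [IsFiniteMeasure μ]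
  {ι : ℕ → Type*} [∀ k, Fintype (ι k)] {c : ∀ k, X → ι k}
  {T : SpecialLinearGroup (Fin (n + 1)) ℤ → X → X}
  {w : SpecialLinearGroup (Fin (n + 1)) ℤ → X → Λ}

lemma forall_near_pow {B : Set X} (hB : MeasurableSet B) (hB0 : μ B ≠ 0)
    (hone : ∀ x, T 1 x = x) (hmul : ∀ g h x, T (g * h) x = T g (T h x))
    (hT : ∀ γ, MeasurePreserving (T γ) μ μ)
    (hw : ∀ γ, Measurable (w γ)) (hwc : ∀ g h x, w (g * h) x = w g (T h x) * w h x)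
    {q : ℕ} {κ : ℝ≥0∞} (hκ : 5 * κ < 1)
    (hinv : ∀ i j, i ≠ j → ∀ (a : ℤ) x, T (elemSL i j (q * a)) x ∈ B ↔ x ∈ B)
    (hnear : ∀ i j, i ≠ j → ∀ a : ℕ, ∃ l, NearConst μ B (w (elemSL i j (q * a))) l κ) :
    ∃ r : Fin (n + 1) → Fin (n + 1) → Λ,
      (∀ i j, i ≠ j → ∀ a : ℕ, NearConst μ B (w (elemSL i j (q * a))) (r i j ^ a) κ) ∧
      (∀ i j l, i ≠ j → j ≠ l → i ≠ l → ∀ a b : ℕ, r i j ^ a * r j l ^ b * (r i j)⁻¹ ^ a *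
        (r j l)⁻¹ ^ b * (r i l)⁻¹ ^ (q * a * b) = 1) ∧
      ∀ i j k l, i ≠ j → k ≠ l → j ≠ k → l ≠ i → ∀ a b : ℕ, r i j ^ a * r k l ^ b *
        (r i j)⁻¹ ^ a * (r k l)⁻¹ ^ b = 1 := by
  have hw1 : w 1 = fun _ => 1 := by
    funext x
    simpa [hone] using hwc 1 1 x
  set Nr : SpecialLinearGroup (Fin (n + 1)) ℤ → Λ → ℝ≥0∞ → Prop := fun γ l t =>
    (∀ x, T γ x ∈ B ↔ x ∈ B) ∧ NearConst μ B (w γ) l t with hNr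
  have Nr_mul : ∀ {g h l l' t t'}, Nr g l t → Nr h l' t' → Nr (g * h) (l * l') (t + t') := by
    intro g h l l' t t' h1 h2
    refine ⟨fun x => by rw [hmul, h1.1, h2.1], ?_⟩
    exact h1.2.mul (funext fun x => hwc g h x) (hT h) hB (hw g) h2.1 h2.2
  have Pinv : ∀ g, (∀ x, T g x ∈ B ↔ x ∈ B) → ∀ x, T g⁻¹ x ∈ B ↔ x ∈ B := by
    intro g hg x
    rw [← hg (T g⁻¹ x), ← hmul, mul_inv_cancel, hone]
  have Nr_inv : ∀ {g l t}, Nr g l t → Nr g⁻¹ l⁻¹ t := by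
    intro g l t h1
    exact ⟨Pinv g h1.1, h1.2.inv hw1 (funext fun x => hwc g g⁻¹ x) (hT _) hB (hw g) (Pinv g h1.1)⟩
  have Nr_one : Nr 1 1 0 := by
    refine ⟨fun x => by rw [hone], ?_⟩
    simp [NearConst, hw1]
  have hκ3 : κ + κ + κ < 1 := by
    refine lt_of_le_of_lt ?_ hκ
    calc κ + κ + κ = 3 * κ := by ring
      _ ≤ 5 * κ := by gcongr; norm_num
  have hκ4 : κ + κ + κ + κ + 0 < 1 := by
    refine lt_of_le_of_lt ?_ hκ
    calc κ + κ + κ + κ + 0 = 4 * κ := by ring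
      _ ≤ 5 * κ := by gcongr; norm_num
  have hκ5 : κ + κ + κ + κ + κ + 0 < 1 := by
    refine lt_of_le_of_lt (le_of_eq ?_) hκ
    ring
  have hex : ∀ i j, ∃ l, i ≠ j → Nr (elemSL i j (q * (1 : ℕ))) l κ := by
    intro i j
    by_cases hij : i ≠ j
    · obtain ⟨l, hl⟩ := hnear i j hij 1
      exact ⟨l, fun _ => ⟨hinv i j hij _, hl⟩⟩
    · exact ⟨1, fun h => absurd h hij⟩
  choose r hr using hex
  have hpow : ∀ i j, i ≠ j → ∀ a : ℕ, Nr (elemSL i j (q * a)) (r i j ^ a) κ := by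
    intro i j hij a
    induction a with
    | zero =>
      rw [Nat.cast_zero, mul_zero, elemSL_zero, pow_zero]
      refine ⟨Nr_one.1, Nr_one.2.trans ?_⟩
      simp
    | succ a ih =>
      obtain ⟨l, hl⟩ := hnear i j hij (a + 1)
      have h1 := Nr_mul ih (hr i j hij)
      rw [elemSL_mul hij, ← mul_add, ← Nat.cast_add] at h1
      have := h1.2.unique hB0 hl hκ3
      rw [pow_succ, this]
      exact ⟨hinv i j hij _, hl⟩
  refine ⟨r, fun i j hij a => (hpow i j hij a).2, ?_, ?_⟩
  · intro i j l hij hjl hil a b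
    have h1 := Nr_mul (Nr_mul (Nr_mul (Nr_mul (hpow i j hij a) (hpow j l hjl b))
      (Nr_inv (hpow i j hij a))) (Nr_inv (hpow j l hjl b))) (Nr_inv (hpow i l hil (q * a * b)))
    have he : elemSL i j (q * a) * elemSL j l (q * b) * (elemSL i j (q * a))⁻¹ *
        (elemSL j l (q * b))⁻¹ * (elemSL i l (q * ((q * a * b : ℕ) : ℤ)))⁻¹ = 1 := by
      rw [elemSL_mul_comm_corner hij hjl hil]
      have : (q : ℤ) * ((q * a * b : ℕ) : ℤ) = q * a * (q * b) := by push_cast; ring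
      rw [this]
      group
    rw [he] at h1
    simpa only [inv_pow] using h1.2.unique hB0 Nr_one.2 hκ5
  · intro i j k l hij hkl hjk hli a b
    have h1 := Nr_mul (Nr_mul (Nr_mul (hpow i j hij a) (hpow k l hkl b))
      (Nr_inv (hpow i j hij a))) (Nr_inv (hpow k l hkl b))
    have he : elemSL i j (q * a) * elemSL k l (q * b) * (elemSL i j (q * a))⁻¹ *
        (elemSL k l (q * b))⁻¹ = 1 := by
      rw [elemSL_commute hij hkl hjk hli]
      group
    rw [he] at h1
    simpa only [inv_pow] using h1.2.unique hB0 Nr_one.2 hκ4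

/-- On a fibre of a finite quotient, a cocycle into a quotient of a group of `n × n` matrices is
nearly trivial along a finite index subgroup of each root subgroup of `SL_{n+1}(ℤ)`. -/
theorem exists_fibre_root_subgroups_near_one (hn : 1 ≤ n)
    (hN : ∀ g ∈ N, ∀ s ∈ S, (g : Matrix (Fin n) (Fin n) ℚ) * s *
      (↑g⁻¹ : Matrix (Fin n) (Fin n) ℚ) ∈ S)
    (π : N →* Λ) (hπ : Function.Surjective π)
    (hker : ∀ g : N, π g = 1 ↔ ((g : (Matrix (Fin n) (Fin n) ℚ)ˣ) : Matrix _ _ ℚ) ∈ S)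
    (hμ : μ ≠ 0) (hc : ∀ k i, MeasurableSet (c k ⁻¹' {i}))
    (hcard : ∀ k i, Fintype.card (ι k) * μ (c k ⁻¹' {i}) ≤ 1) (happ : ApproximatedBy μ c)
    (hone : ∀ x, T 1 x = x) (hmul : ∀ g h x, T (g * h) x = T g (T h x))
    (hT : ∀ γ, MeasurePreserving (T γ) μ μ)
    (hcT : ∀ k γ x y, c k x = c k y → c k (T γ x) = c k (T γ y))
    (hw : ∀ γ, Measurable (w γ)) (hwc : ∀ g h x, w (g * h) x = w g (T h x) * w h x)
    {q : ℕ → ℕ} (hq : ∀ k, q k ≠ 0)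
    (hinv : ∀ k i j, i ≠ j → ∀ (a : ℤ) x, c k (T (elemSL i j (q k * a)) x) = c k x)
    {κ : ℝ≥0∞} (hκ0 : κ ≠ 0) (hκ : 5 * κ < 1) :
    ∃ k, ∃ b : ι k, ∃ M : ℕ, 0 < M ∧ μ (c k ⁻¹' {b}) ≠ 0 ∧ ∀ i j, i ≠ j → ∀ a : ℕ,
      μ {x | x ∈ c k ⁻¹' {b} ∧ w (elemSL i j (q k * M * a)) x ≠ 1} ≤ κ * μ (c k ⁻¹' {b}) := by
  classical
  obtain ⟨k, b, hb0, hnear⟩ : ∃ k, ∃ b : ι k, μ (c k ⁻¹' {b}) ≠ 0 ∧ ∀ i j, i ≠ j → ∀ a : ℕ,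
      ∃ l, NearConst μ (c k ⁻¹' {b}) (w (elemSL i j (q k * a))) l κ := by
    rcases hn.eq_or_lt with rfl | hn
    · have hΛ : ∀ l : Λ, l = 1 := by
        intro l
        obtain ⟨g, rfl⟩ := hπ l
        rw [hker]
        have : ((g : (Matrix (Fin 1) (Fin 1) ℚ)ˣ) : Matrix (Fin 1) (Fin 1) ℚ) =
            algebraMap ℚ _ (((g : (Matrix (Fin 1) (Fin 1) ℚ)ˣ) : Matrix (Fin 1) (Fin 1) ℚ) 0 0) := by
          ext a b
          rw [Subsingleton.elim a 0, Subsingleton.elim b 0]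
          simp [Matrix.algebraMap_matrix_apply]
        rw [this]
        exact S.algebraMap_mem _
      obtain ⟨b, hb⟩ : ∃ b : ι 0, μ (c 0 ⁻¹' {b}) ≠ 0 := by
        by_contra! h
        apply hμ
        rw [← Measure.measure_univ_eq_zero]
        have : (Set.univ : Set X) = ⋃ i, c 0 ⁻¹' {i} := by ext x; simp
        rw [this, measure_iUnion_null_iff]
        exact h
      refine ⟨0, b, hb, fun i j _ a => ⟨1, ?_⟩⟩
      simp [NearConst, hΛ (w _ _)]
    · let J := {t : Fin (n + 1) × Fin (n + 1) × Fin (n + 1) //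
        t.1 ≠ t.2.1 ∧ t.2.1 ≠ t.2.2 ∧ t.1 ≠ t.2.2}
      obtain ⟨k, b, hb0, h⟩ := exists_fibre_nearly_constant hμ hc hcard happ hone hmul hT hcT hw hwc
        (J := J) (fun t => elemSL t.1.1 t.1.2.1 1) (fun t => elemSL t.1.2.2 t.1.2.1 1)
        (fun t => elemSL t.1.1 t.1.2.2 (-1)) (fun t => elemSL t.1.2.2 t.1.1 (-1))
        (fun t => elemSL_commute t.2.1 t.2.2.1.symm t.2.2.1 t.2.1.symm _ _)
        (fun t => elemSL_commute t.2.2.2 t.2.1 t.2.2.2.symm t.2.1.symm _ _)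
        (fun t => by
          obtain ⟨⟨i, j, l⟩, hij, hjl, hil⟩ := t
          have h := elemSL_mul_comm_corner hil hjl.symm hij (1 : ℤ) 1
          simp only at hij hjl hil ⊢
          rw [← elemSL_inv hil, mul_assoc, eq_inv_mul_iff_mul_eq, ← mul_assoc, h]
          group)
        (fun t => elemSL_commute t.2.2.2.symm t.2.2.1.symm t.2.2.2 t.2.2.1 _ _)
        (fun t => by
          obtain ⟨⟨i, j, l⟩, hij, hjl, hil⟩ := t
          have h := elemSL_mul_comm_corner hil.symm hij hjl.symm (1 : ℤ) 1
          simp only at hij hjl hil ⊢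
          rw [← elemSL_inv hil.symm, mul_assoc, eq_inv_mul_iff_mul_eq, ← mul_assoc, h]
          group) hκ0
      refine ⟨k, b, hb0, fun i j hij a => ?_⟩
      obtain ⟨l, hli, hlj⟩ : ∃ l : Fin (n + 1), l ≠ i ∧ l ≠ j := by
        obtain ⟨l, hl⟩ := Finset.exists_mem_notMem_of_card_lt_card
          (s := {i, j}) (t := (Finset.univ : Finset (Fin (n + 1))))
          (lt_of_le_of_lt Finset.card_le_two (by simp only [Finset.card_univ, Fintype.card_fin]; omega))
        simp at hl
        exact ⟨l, hl.1, hl.2⟩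
      have := h ⟨(i, j, l), hij, hlj.symm, hli.symm⟩ (q k * a) (fun x => by
        rw [elemSL_pow hij]
        push_cast
        rw [mul_one]
        exact hinv k i j hij a x)
      simp only [elemSL_pow hij] at this
      push_cast at this
      simp only [mul_one] at this
      exact this
  have hinvB : ∀ i j, i ≠ j → ∀ (a : ℤ) x, T (elemSL i j (q k * a)) x ∈ c k ⁻¹' {b} ↔
      x ∈ c k ⁻¹' {b} := by
    intro i j hij a x
    rw [Set.mem_preimage, hinv k i j hij, Set.mem_preimage]
  obtain ⟨r, hr, hr1, hr2⟩ := forall_near_pow (hc k b) hb0 hone hmul hT hw hwc hκ hinvB hnear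
  have hM : ∀ t : Fin (n + 1) × Fin (n + 1), ∃ M : ℕ, 0 < M ∧ (t.1 ≠ t.2 → r t.1 t.2 ^ M = 1) := by
    intro t
    by_cases ht : t.1 ≠ t.2
    · obtain ⟨M, hM, h⟩ := exists_pow_eq_one_of_steinberg_relations hn hN π hπ hker (hq k) hr1 hr2 ht
      exact ⟨M, hM, fun _ => h⟩
    · exact ⟨1, one_pos, fun h => absurd h ht⟩
  choose M hM0 hM using hM
  refine ⟨k, b, ∏ t, M t, Finset.prod_pos fun t _ => hM0 t, hb0, fun i j hij a => ?_⟩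
  have h := hr i j hij ((∏ t, M t) * a)
  obtain ⟨d, hd⟩ := Finset.dvd_prod_of_mem M (Finset.mem_univ (i, j))
  rw [hd, mul_assoc, pow_mul, hM (i, j) hij, one_pow, ← mul_assoc, ← hd] at h
  rw [mul_assoc]
  have e : (((∏ t, M t) * a : ℕ) : ℤ) = ((∏ t, M t : ℕ) : ℤ) * a := by push_cast; rfl
  rw [e] at h
  exact h

end RigidFibre

section Lattices

open scoped Nat

variable {n : ℕ}

/-- A matrix as an additive endomorphism of `ℚⁿ`. -/
def matHom (s : Matrix (Fin n) (Fin n) ℚ) : (Fin n → ℚ) →+ (Fin n → ℚ) :=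
  s.mulVecLin.toAddMonoidHom

lemma matHom_apply (s : Matrix (Fin n) (Fin n) ℚ) (v : Fin n → ℚ) : matHom s v = s.mulVec v := rfl

lemma map_matHom_mul (s t : Matrix (Fin n) (Fin n) ℚ) (A : AddSubgroup (Fin n → ℚ)) :
    A.map (matHom (s * t)) = (A.map (matHom t)).map (matHom s) := by
  rw [AddSubgroup.map_map]
  congr 1
  refine AddMonoidHom.ext fun v => ?_
  simp [matHom_apply]

lemma map_matHom_one (A : AddSubgroup (Fin n → ℚ)) : A.map (matHom 1) = A := by
  have : matHom (1 : Matrix (Fin n) (Fin n) ℚ) = AddMonoidHom.id _ := by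
    refine AddMonoidHom.ext fun v => ?_
    simp [matHom_apply]
  rw [this, AddSubgroup.map_id]

lemma mem_map_matHom_unit (g : (Matrix (Fin n) (Fin n) ℚ)ˣ) (A : AddSubgroup (Fin n → ℚ))
    (v : Fin n → ℚ) : v ∈ A.map (matHom g) ↔ matHom (↑g⁻¹ : Matrix _ _ ℚ) v ∈ A := by
  constructor
  · rintro ⟨a, ha, rfl⟩
    simpa [matHom_apply] using ha
  · intro h
    exact ⟨_, h, by simp [matHom_apply]⟩

variable (n) in
/-- The lattice `(1/k!)ℤⁿ` in `ℚⁿ`. -/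
def facLattice (k : ℕ) : AddSubgroup (Fin n → ℚ) where
  carrier := {v | ∀ i, ∃ z : ℤ, (k ! : ℚ) * v i = z}
  zero_mem' := fun i => ⟨0, by simp⟩
  add_mem' := by
    intro a b ha hb i
    obtain ⟨y, hy⟩ := ha i
    obtain ⟨z, hz⟩ := hb i
    exact ⟨y + z, by push_cast; rw [← hy, ← hz, Pi.add_apply, mul_add]⟩
  neg_mem' := by
    intro a ha i
    obtain ⟨y, hy⟩ := ha i
    exact ⟨-y, by push_cast; rw [← hy, Pi.neg_apply, mul_neg]⟩

lemma mem_facLattice_of_dvd {k N : ℕ} (hN : N ∣ k !) {v : Fin n → ℚ}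
    (h : ∀ i, ∃ z : ℤ, (N : ℚ) * v i = z) : v ∈ facLattice n k := by
  intro i
  obtain ⟨d, hd⟩ := hN
  obtain ⟨z, hz⟩ := h i
  exact ⟨d * z, by rw [hd]; push_cast; rw [← hz]; ring⟩

lemma facLattice_mono : Monotone (facLattice n) := fun _ _ hkl _ hv =>
  mem_facLattice_of_dvd (Nat.factorial_dvd_factorial hkl) hv

lemma exists_denominator {ι : Type*} [Finite ι] (v : ι → ℚ) :
    ∃ d : ℕ, 0 < d ∧ ∀ i, ∃ z : ℤ, (d : ℚ) * v i = z := by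
  have := Fintype.ofFinite ι
  refine ⟨∏ i, (v i).den, Finset.prod_pos fun i _ => (v i).den_pos, fun i => ?_⟩
  obtain ⟨e, he⟩ := Finset.dvd_prod_of_mem (fun i => (v i).den) (Finset.mem_univ i)
  refine ⟨e * (v i).num, ?_⟩
  rw [he]
  push_cast
  rw [← Rat.den_mul_eq_num]
  ring

lemma exists_mem_facLattice (v : Fin n → ℚ) : ∃ k, v ∈ facLattice n k := by
  obtain ⟨d, hd, h⟩ := exists_denominator v
  exact ⟨d, mem_facLattice_of_dvd (Nat.dvd_factorial hd le_rfl) h⟩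

lemma exists_finset_subset_facLattice (Φ : Finset (Fin n → ℚ)) :
    ∃ k, ∀ v ∈ Φ, v ∈ facLattice n k := by
  choose k hk using exists_mem_facLattice (n := n)
  exact ⟨Φ.sup k, fun v hv => facLattice_mono (Finset.le_sup hv) (hk v)⟩

lemma exists_map_facLattice_le (s : Matrix (Fin n) (Fin n) ℚ) (k : ℕ) :
    ∃ l, (facLattice n k).map (matHom s) ≤ facLattice n l := by
  obtain ⟨d, hd, h⟩ := exists_denominator (fun t : Fin n × Fin n => s t.1 t.2)
  refine ⟨d + k, ?_⟩
  rintro _ ⟨v, hv, rfl⟩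
  have hdvd : d * k ! ∣ (d + k)! :=
    (Nat.mul_dvd_mul (Nat.dvd_factorial hd le_rfl) dvd_rfl).trans
      (Nat.factorial_mul_factorial_dvd_factorial_add d k)
  refine mem_facLattice_of_dvd hdvd fun i => ?_
  choose z hz using fun j => h (i, j)
  choose y hy using hv
  refine ⟨∑ j, z j * y j, ?_⟩
  rw [matHom_apply, Matrix.mulVec, dotProduct, Finset.mul_sum]
  push_cast
  refine Finset.sum_congr rfl fun j _ => ?_
  rw [← hz, ← hy]
  ring

/-- A subgroup `A` of `ℚⁿ` has finite index over `bA`. -/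
lemma exists_finset_reps (A : AddSubgroup (Fin n → ℚ)) {b : ℕ} (hb : 0 < b) :
    ∃ Φ : Finset (Fin n → ℚ), (∀ v ∈ Φ, v ∈ A) ∧
      ∀ v ∈ A, ∃ r ∈ Φ, ∃ a ∈ A, v = b • a + r := by
  classical
  by_contra! hcon
  have key : ∀ N : ℕ, ∃ Φ : Finset (Fin n → ℚ), Φ.card = N ∧ (∀ v ∈ Φ, v ∈ A) ∧
      ∀ v ∈ Φ, ∀ w ∈ Φ, v ≠ w → ∀ a ∈ A, v - w ≠ b • a := by
    intro N
    induction N with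
    | zero => exact ⟨∅, by simp⟩
    | succ N ih =>
      obtain ⟨Φ, hc, hA, hΦ⟩ := ih
      obtain ⟨v, hv, h⟩ := hcon Φ hA
      have hvΦ : v ∉ Φ := fun hmem => h v hmem 0 A.zero_mem (by simp)
      refine ⟨insert v Φ, by rw [Finset.card_insert_of_notMem hvΦ, hc], ?_, ?_⟩
      · intro w hw
        rcases Finset.mem_insert.1 hw with rfl | hw
        exacts [hv, hA w hw]
      · intro x hx y hy hxy a ha heq
        rcases Finset.mem_insert.1 hx with rfl | hx' <;> rcases Finset.mem_insert.1 hy with rfl | hy'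
        · exact hxy rfl
        · exact h y hy' a ha (by rw [← heq]; abel)
        · refine h x hx' (-a) (A.neg_mem ha) ?_
          rw [smul_neg, ← heq]
          abel
        · exact hΦ x hx' y hy' hxy a ha heq
  obtain ⟨Φ, hc, hA, hΦ⟩ := key (b ^ n + 1)
  have : NeZero b := ⟨hb.ne'⟩
  set L : Submodule ℤ (Fin n → ℚ) := Submodule.span ℤ (Φ : Set (Fin n → ℚ)) with hL
  have hLA : ∀ v ∈ L, v ∈ A := by
    intro v hv
    have : L ≤ AddSubgroup.toIntSubmodule A := Submodule.span_le.2 fun v hv => hA v hv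
    exact this hv
  have hfin : Module.Finite ℤ L := Module.Finite.span_finset ℤ Φ
  have hfree : Module.Free ℤ L := inferInstance
  let bas := Module.finBasis ℤ L
  have hrank : Module.finrank ℤ L ≤ n := by
    have hli : LinearIndependent ℤ (fun i => ((bas i : L) : Fin n → ℚ)) :=
      bas.linearIndependent.map' L.subtype L.ker_subtype
    have hli' : LinearIndependent ℚ (fun i => ((bas i : L) : Fin n → ℚ)) :=
      (LinearIndependent.iff_fractionRing ℤ ℚ).1 hli
    simpa using hli'.fintype_card_le_finrank
  let F : (Fin n → ℚ) → (Fin (Module.finrank ℤ L) → ZMod b) := fun v i =>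
    if h : v ∈ L then ((bas.repr ⟨v, h⟩ i : ℤ) : ZMod b) else 0
  obtain ⟨v, hv, w, hw, hvw, hF⟩ := Finset.exists_ne_map_eq_of_card_lt_of_maps_to
    (s := Φ) (t := Finset.univ) (f := F) (by
      rw [hc, Finset.card_univ, Fintype.card_fun, ZMod.card, Fintype.card_fin]
      exact Nat.lt_succ_of_le (Nat.pow_le_pow_right hb hrank)) (by simp)
  have hvL : v ∈ L := Submodule.subset_span hv
  have hwL : w ∈ L := Submodule.subset_span hw
  have hz : ∀ i, ∃ z : ℤ, bas.repr (⟨v, hvL⟩ - ⟨w, hwL⟩) i = b * z := by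
    intro i
    have h1 := congrFun hF i
    simp only [F, hvL, hwL, dif_pos] at h1
    have h2 := (ZMod.intCast_eq_intCast_iff_dvd_sub _ _ _).1 h1.symm
    obtain ⟨z, hz⟩ := h2
    exact ⟨z, by rw [map_sub, Finsupp.sub_apply, hz]⟩
  choose z hz using hz
  have hsum : (⟨v, hvL⟩ - ⟨w, hwL⟩ : L) = b • ∑ i, z i • bas i := by
    rw [← bas.sum_repr (⟨v, hvL⟩ - ⟨w, hwL⟩), Finset.smul_sum]
    refine Finset.sum_congr rfl fun i _ => ?_
    rw [hz, mul_smul]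
    simp
  refine hΦ v hv w hw hvw ((∑ i, z i • bas i : L) : Fin n → ℚ) (hLA _ (Subtype.coe_prop _)) ?_
  have := congrArg (fun t : L => (t : Fin n → ℚ)) hsum
  simpa using this

end Lattices

section Commensurability

variable {n : ℕ}

/-- Two subgroups of `ℚⁿ` are commensurable up to lattices if they agree after adding a lattice. -/
def LatComm (A B : AddSubgroup (Fin n → ℚ)) : Prop :=
  ∃ k, A ⊔ facLattice n k = B ⊔ facLattice n k

lemma LatComm.refl (A : AddSubgroup (Fin n → ℚ)) : LatComm A A := ⟨0, rfl⟩

lemma LatComm.symm {A B : AddSubgroup (Fin n → ℚ)} (h : LatComm A B) : LatComm B A :=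
  h.imp fun _ h => h.symm

lemma sup_facLattice_eq_of_le {A B : AddSubgroup (Fin n → ℚ)} {k l : ℕ} (hkl : k ≤ l)
    (h : A ⊔ facLattice n k = B ⊔ facLattice n k) : A ⊔ facLattice n l = B ⊔ facLattice n l := by
  have hk : facLattice n k ⊔ facLattice n l = facLattice n l :=
    sup_eq_right.2 (facLattice_mono hkl)
  rw [← hk, ← sup_assoc, ← sup_assoc, h]

lemma LatComm.trans {A B C : AddSubgroup (Fin n → ℚ)} (h : LatComm A B) (h' : LatComm B C) :
    LatComm A C := by
  obtain ⟨k, hk⟩ := h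
  obtain ⟨l, hl⟩ := h'
  exact ⟨max k l, (sup_facLattice_eq_of_le (le_max_left k l) hk).trans
    (sup_facLattice_eq_of_le (le_max_right k l) hl)⟩

lemma LatComm.of_le {A B : AddSubgroup (Fin n → ℚ)} {k l : ℕ} (h : A ≤ B ⊔ facLattice n k)
    (h' : B ≤ A ⊔ facLattice n l) : LatComm A B := by
  refine ⟨max k l, le_antisymm (sup_le ?_ le_sup_right) (sup_le ?_ le_sup_right)⟩
  · exact h.trans (sup_le_sup_left (facLattice_mono (le_max_left k l)) _)
  · exact h'.trans (sup_le_sup_left (facLattice_mono (le_max_right k l)) _)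

lemma LatComm.map {A B : AddSubgroup (Fin n → ℚ)} (h : LatComm A B)
    (s : Matrix (Fin n) (Fin n) ℚ) : LatComm (A.map (matHom s)) (B.map (matHom s)) := by
  obtain ⟨k, hk⟩ := h
  obtain ⟨l, hl⟩ := exists_map_facLattice_le s k
  refine LatComm.of_le (k := l) (l := l) ?_ ?_
  · calc A.map (matHom s) ≤ (B ⊔ facLattice n k).map (matHom s) :=
        AddSubgroup.map_mono (hk ▸ le_sup_left)
      _ ≤ _ := by rw [AddSubgroup.map_sup]; exact sup_le_sup_left hl _
  · calc B.map (matHom s) ≤ (A ⊔ facLattice n k).map (matHom s) :=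
        AddSubgroup.map_mono (hk ▸ le_sup_left)
      _ ≤ _ := by rw [AddSubgroup.map_sup]; exact sup_le_sup_left hl _

/-- The algebra of matrices mapping `A` into itself up to a lattice. -/
def latEnd (A : AddSubgroup (Fin n → ℚ)) : Subalgebra ℚ (Matrix (Fin n) (Fin n) ℚ) where
  carrier := {s | ∃ k, A.map (matHom s) ≤ A ⊔ facLattice n k}
  mul_mem' := by
    rintro s t ⟨k, hk⟩ ⟨l, hl⟩
    obtain ⟨j, hj⟩ := exists_map_facLattice_le s l
    refine ⟨max k j, ?_⟩
    rw [map_matHom_mul]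
    refine (AddSubgroup.map_mono hl).trans ?_
    rw [AddSubgroup.map_sup]
    refine sup_le (hk.trans (sup_le_sup_left (facLattice_mono (le_max_left k j)) _)) ?_
    exact (hj.trans (facLattice_mono (le_max_right k j))).trans le_sup_right
  add_mem' := by
    rintro s t ⟨k, hk⟩ ⟨l, hl⟩
    refine ⟨max k l, ?_⟩
    rintro _ ⟨v, hv, rfl⟩
    have e : matHom (s + t) v = matHom s v + matHom t v := by
      simp [matHom_apply, Matrix.add_mulVec]
    rw [e]
    refine AddSubgroup.add_mem _ ?_ ?_
    · exact sup_le_sup_left (facLattice_mono (le_max_left k l)) _ (hk ⟨v, hv, rfl⟩)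
    · exact sup_le_sup_left (facLattice_mono (le_max_right k l)) _ (hl ⟨v, hv, rfl⟩)
  algebraMap_mem' := by
    intro r
    obtain ⟨Φ, -, hΦ⟩ := exists_finset_reps A r.den_pos
    obtain ⟨k, hk⟩ := exists_finset_subset_facLattice (Φ.image (r • ·))
    refine ⟨k, ?_⟩
    rintro _ ⟨v, hv, rfl⟩
    obtain ⟨t, ht, a, ha, rfl⟩ := hΦ v hv
    have e : matHom (algebraMap ℚ (Matrix (Fin n) (Fin n) ℚ) r) (r.den • a + t) =
        r.num • a + r • t := by
      rw [matHom_apply, Algebra.algebraMap_eq_smul_one, Matrix.smul_mulVec, Matrix.one_mulVec,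
        smul_add]
      congr 1
      ext i
      rw [Pi.smul_apply, Pi.smul_apply, Pi.smul_apply, smul_eq_mul, nsmul_eq_mul, zsmul_eq_mul,
        ← mul_assoc, Rat.mul_den_eq_num]
    rw [e]
    exact AddSubgroup.add_mem _ (AddSubgroup.mem_sup_left (A.zsmul_mem ha _))
      (AddSubgroup.mem_sup_right (hk _ (Finset.mem_image_of_mem _ ht)))

lemma conj_mem_latEnd_map (g : (Matrix (Fin n) (Fin n) ℚ)ˣ) {A : AddSubgroup (Fin n → ℚ)}
    {s : Matrix (Fin n) (Fin n) ℚ} (hs : s ∈ latEnd A) :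
    (g : Matrix (Fin n) (Fin n) ℚ) * s * (↑g⁻¹ : Matrix (Fin n) (Fin n) ℚ) ∈
      latEnd (A.map (matHom g)) := by
  obtain ⟨k, hk⟩ := hs
  obtain ⟨l, hl⟩ := exists_map_facLattice_le (g : Matrix (Fin n) (Fin n) ℚ) k
  refine ⟨l, ?_⟩
  rw [← map_matHom_mul, mul_assoc, Units.inv_mul, mul_one, map_matHom_mul]
  refine (AddSubgroup.map_mono hk).trans ?_
  rw [AddSubgroup.map_sup]
  exact sup_le_sup_left hl _

lemma Subalgebra.units_inv_mem {R : Type*} [Ring R] [Algebra ℚ R] [FiniteDimensional ℚ R]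
    (S : Subalgebra ℚ R) (g : Rˣ) (hg : (g : R) ∈ S) : (↑g⁻¹ : R) ∈ S := by
  have hinj : Function.Injective (LinearMap.mulLeft ℚ (⟨g, hg⟩ : S)) := by
    intro s t hst
    have := congrArg (fun z : S => (z : R)) hst
    simpa using this
  obtain ⟨s, hs⟩ := LinearMap.injective_iff_surjective.1 hinj 1
  have h1 : (g : R) * s = 1 := by simpa using congrArg (fun z : S => (z : R)) hs
  rw [Units.inv_eq_of_mul_eq_one_right h1]
  exact s.2

lemma latComm_map_iff (g : (Matrix (Fin n) (Fin n) ℚ)ˣ) (A : AddSubgroup (Fin n → ℚ)) :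
    LatComm (A.map (matHom g)) A ↔ (g : Matrix (Fin n) (Fin n) ℚ) ∈ latEnd A := by
  constructor
  · rintro ⟨k, hk⟩
    exact ⟨k, hk ▸ le_sup_left⟩
  · intro h
    obtain ⟨l, hl⟩ := (latEnd A).units_inv_mem g h
    obtain ⟨k, hk⟩ := h
    obtain ⟨j, hj⟩ := exists_map_facLattice_le (g : Matrix (Fin n) (Fin n) ℚ) l
    refine LatComm.of_le hk (l := j) ?_
    have := AddSubgroup.map_mono (f := matHom (g : Matrix (Fin n) (Fin n) ℚ)) hl
    rw [← map_matHom_mul, Units.mul_inv, map_matHom_one, AddSubgroup.map_sup] at this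
    exact this.trans (sup_le_sup_left hj _)

/-- Being of full rank in `ℚⁿ`. -/
def FullRank (A : AddSubgroup (Fin n → ℚ)) : Prop :=
  ∃ b : Fin n → (Fin n → ℚ), (∀ i, b i ∈ A) ∧ LinearIndependent ℚ b

lemma FullRank.exists_nsmul_mem {A : AddSubgroup (Fin n → ℚ)} (hA : FullRank A) (v : Fin n → ℚ) :
    ∃ b : ℕ, 0 < b ∧ b • v ∈ A := by
  obtain ⟨b, hb, hli⟩ := hA
  let bas := basisOfLinearIndependentOfCardEqFinrank' b hli (by simp)
  obtain ⟨d, hd, hz⟩ := exists_denominator (fun i => bas.repr v i)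
  choose z hz using hz
  refine ⟨d, hd, ?_⟩
  have : d • v = ∑ i, z i • b i := by
    conv_lhs => rw [← bas.sum_repr v]
    rw [Finset.smul_sum]
    refine Finset.sum_congr rfl fun i _ => ?_
    rw [← Nat.cast_smul_eq_nsmul ℚ, smul_smul, hz, Int.cast_smul_eq_zsmul]
    simp [bas]
  rw [this]
  exact AddSubgroup.sum_mem _ fun i _ => A.zsmul_mem (hb i) _

lemma FullRank.exists_nsmul_mem_finset {A : AddSubgroup (Fin n → ℚ)} (hA : FullRank A)
    {ι : Type*} [Finite ι] (v : ι → Fin n → ℚ) : ∃ b : ℕ, 0 < b ∧ ∀ i, b • v i ∈ A := by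
  have := Fintype.ofFinite ι
  choose b hb h using fun i => hA.exists_nsmul_mem (v i)
  refine ⟨∏ i, b i, Finset.prod_pos fun i _ => hb i, fun i => ?_⟩
  obtain ⟨e, he⟩ := Finset.dvd_prod_of_mem b (Finset.mem_univ i)
  rw [he, mul_comm, mul_smul]
  exact A.nsmul_mem (h i) _

lemma FullRank.exists_nsmul_facLattice {A : AddSubgroup (Fin n → ℚ)} (hA : FullRank A) (k : ℕ) :
    ∃ b : ℕ, 0 < b ∧ ∀ v ∈ facLattice n k, b • v ∈ A := by
  obtain ⟨b, hb, h⟩ := hA.exists_nsmul_mem_finset (fun i : Fin n => Pi.single i (1 : ℚ))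
  refine ⟨b * k.factorial, Nat.mul_pos hb k.factorial_pos, fun v hv => ?_⟩
  choose z hz using hv
  have : (b * k.factorial) • v = ∑ i, z i • (b • (Pi.single i (1 : ℚ) : Fin n → ℚ)) := by
    ext j
    rw [Finset.sum_apply, Finset.sum_eq_single j]
    · rw [Pi.smul_apply, Pi.smul_apply, Pi.smul_apply, Pi.single_eq_same, nsmul_eq_mul,
        nsmul_eq_mul, zsmul_eq_mul, ← hz]
      push_cast
      ring
    · intro i _ hij
      simp [Pi.single_eq_of_ne hij.symm]
    · simp
  rw [this]
  exact AddSubgroup.sum_mem _ fun i _ => A.zsmul_mem (h i) _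

/-- Only countably many subgroups of full rank agree with `C` after adding a given lattice. -/
lemma countable_sup_facLattice_fibre (k : ℕ) (C : AddSubgroup (Fin n → ℚ)) :
    {A | FullRank A ∧ A ⊔ facLattice n k = C}.Countable := by
  classical
  let F : ℕ × Finset (Fin n → ℚ) → AddSubgroup (Fin n → ℚ) := fun t =>
    C.map (nsmulAddMonoidHom t.1) ⊔ AddSubgroup.closure (t.2 : Set (Fin n → ℚ))
  refine (Set.countable_range F).mono ?_
  rintro A ⟨hA, rfl⟩
  obtain ⟨b, hb, hbA⟩ := hA.exists_nsmul_facLattice k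
  set C := A ⊔ facLattice n k with hC
  have hbC : C.map (nsmulAddMonoidHom b) ≤ A := by
    rw [AddSubgroup.map_le_iff_le_comap]
    refine sup_le (fun a ha => A.nsmul_mem ha b) fun v hv => hbA v hv
  obtain ⟨Φ, -, hΦ⟩ := exists_finset_reps C hb
  have hch : ∀ r : Fin n → ℚ, ∃ a ∈ A, (∃ a' ∈ A, ∃ c ∈ C, a' = b • c + r) →
      ∃ c ∈ C, a = b • c + r := by
    intro r
    by_cases h : ∃ a' ∈ A, ∃ c ∈ C, a' = b • c + r
    · obtain ⟨a', ha', h'⟩ := h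
      exact ⟨a', ha', fun _ => h'⟩
    · exact ⟨0, A.zero_mem, fun h' => absurd h' h⟩
  choose r hrA hr using hch
  refine ⟨(b, Φ.image r), le_antisymm (sup_le hbC ?_) fun a ha => ?_⟩
  · rw [AddSubgroup.closure_le]
    intro v hv
    obtain ⟨w, -, rfl⟩ := Finset.mem_image.1 (Finset.mem_coe.1 hv)
    exact hrA w
  · obtain ⟨t, ht, c, hc, rfl⟩ := hΦ a (AddSubgroup.mem_sup_left ha)
    obtain ⟨c', hc', h'⟩ := hr t ⟨_, ha, c, hc, rfl⟩
    have e : b • c + t = b • (c - c') + r t := by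
      rw [h', smul_sub]
      abel
    rw [e]
    refine AddSubgroup.add_mem _ (AddSubgroup.mem_sup_left ⟨c - c', C.sub_mem hc hc', rfl⟩)
      (AddSubgroup.mem_sup_right (AddSubgroup.subset_closure ?_))
    exact Finset.mem_coe.2 (Finset.mem_image_of_mem r ht)

lemma FullRank.exists_linear_extension {A : AddSubgroup (Fin n → ℚ)} (hA : FullRank A)
    (e : A →+ (Fin n → ℚ)) :
    ∃ s : Matrix (Fin n) (Fin n) ℚ, ∀ a : A, matHom s a = e a := by
  obtain ⟨b, hb, hli⟩ := hA
  let bas := basisOfLinearIndependentOfCardEqFinrank' b hli (by simp)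
  let l : (Fin n → ℚ) →ₗ[ℚ] (Fin n → ℚ) := bas.constr ℚ fun i => e ⟨b i, hb i⟩
  refine ⟨LinearMap.toMatrix' l, fun a => ?_⟩
  have hl : ∀ v, matHom (LinearMap.toMatrix' l) v = l v := fun v => by
    rw [matHom_apply, LinearMap.toMatrix'_mulVec]
  rw [hl]
  obtain ⟨d, hd, hz⟩ := exists_denominator (fun i => bas.repr a i)
  choose z hz using hz
  have h1 : d • a = ∑ i, z i • (⟨b i, hb i⟩ : A) := by
    apply Subtype.ext
    push_cast
    conv_lhs => rw [← bas.sum_repr (a : Fin n → ℚ)]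
    rw [Finset.smul_sum]
    refine Finset.sum_congr rfl fun i _ => ?_
    rw [← Nat.cast_smul_eq_nsmul ℚ, smul_smul, hz, Int.cast_smul_eq_zsmul]
    simp [bas]
  have h2 : d • l a = d • e a := by
    rw [← map_nsmul e, h1, map_sum, ← map_nsmul l, ← AddSubgroup.coe_nsmul, h1]
    push_cast
    rw [map_sum]
    refine Finset.sum_congr rfl fun i _ => ?_
    rw [map_zsmul, map_zsmul]
    congr 1
    have : b i = bas i := by simp [bas]
    conv_lhs => rw [this]
    exact bas.constr_basis ℚ _ i
  exact (smul_right_injective _ hd.ne') h2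

lemma FullRank.ext_matHom {A : AddSubgroup (Fin n → ℚ)} (hA : FullRank A)
    {s t : Matrix (Fin n) (Fin n) ℚ} (h : ∀ a ∈ A, matHom s a = matHom t a) : s = t := by
  obtain ⟨b, hb, hli⟩ := hA
  let bas := basisOfLinearIndependentOfCardEqFinrank' b hli (by simp)
  apply Matrix.toLin'.injective
  refine bas.ext fun i => ?_
  have := h (b i) (hb i)
  simpa [bas, matHom_apply] using this

/-- Isomorphic subgroups of full rank differ by an invertible matrix. -/
lemma exists_map_eq_of_addEquiv {A B : AddSubgroup (Fin n → ℚ)} (hA : FullRank A)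
    (hB : FullRank B) (e : A ≃+ B) :
    ∃ g : (Matrix (Fin n) (Fin n) ℚ)ˣ, A.map (matHom g) = B := by
  obtain ⟨s, hs⟩ := hA.exists_linear_extension (B.subtype.comp e.toAddMonoidHom)
  obtain ⟨t, ht⟩ := hB.exists_linear_extension (A.subtype.comp e.symm.toAddMonoidHom)
  have hs' : ∀ a : A, matHom s a = e a := hs
  have ht' : ∀ a : B, matHom t a = e.symm a := ht
  have hts : t * s = 1 := hA.ext_matHom fun a ha => by
    have h1 : matHom (t * s) a = matHom t (matHom s a) := by simp [matHom_apply]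
    rw [h1, hs' ⟨a, ha⟩, ht']
    simp [matHom_apply]
  have hst : s * t = 1 := mul_eq_one_comm.1 hts
  refine ⟨⟨s, t, hst, hts⟩, le_antisymm ?_ ?_⟩
  · rintro _ ⟨a, ha, rfl⟩
    rw [Units.val_mk, hs' ⟨a, ha⟩]
    exact Subtype.coe_prop _
  · intro v hv
    refine ⟨e.symm ⟨v, hv⟩, Subtype.coe_prop _, ?_⟩
    rw [Units.val_mk, hs']
    simp

instance countable_matrix_units : Countable (Matrix (Fin n) (Fin n) ℚ)ˣ :=
  have : Countable (Matrix (Fin n) (Fin n) ℚ) := inferInstanceAs (Countable (Fin n → Fin n → ℚ))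
  Units.val_injective.countable

lemma countable_isomorphic {A : AddSubgroup (Fin n → ℚ)} (hA : FullRank A) :
    {B : AddSubgroup (Fin n → ℚ) | FullRank B ∧ Nonempty (A ≃+ B)}.Countable := by
  refine (Set.countable_range fun g : (Matrix (Fin n) (Fin n) ℚ)ˣ => A.map (matHom g)).mono ?_
  rintro B ⟨hB, ⟨e⟩⟩
  obtain ⟨g, hg⟩ := exists_map_eq_of_addEquiv hA hB e
  exact ⟨g, hg⟩

lemma nonempty_addEquiv_map (g : (Matrix (Fin n) (Fin n) ℚ)ˣ) (A : AddSubgroup (Fin n → ℚ)) :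
    Nonempty (A ≃+ A.map (matHom (g : Matrix (Fin n) (Fin n) ℚ))) := by
  refine ⟨A.equivMapOfInjective _ fun v w h => ?_⟩
  have := congrArg (matHom (↑g⁻¹ : Matrix (Fin n) (Fin n) ℚ)) h
  simpa [matHom_apply] using this

lemma FullRank.map {A : AddSubgroup (Fin n → ℚ)} (hA : FullRank A)
    (g : (Matrix (Fin n) (Fin n) ℚ)ˣ) :
    FullRank (A.map (matHom (g : Matrix (Fin n) (Fin n) ℚ))) := by
  obtain ⟨b, hb, hli⟩ := hA
  refine ⟨fun i => matHom g (b i), fun i => ⟨b i, hb i, rfl⟩, ?_⟩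
  refine hli.map' (g : Matrix (Fin n) (Fin n) ℚ).mulVecLin (LinearMap.ker_eq_bot.2 ?_)
  exact Matrix.mulVec_injective_of_isUnit g.isUnit

end Commensurability

section LatticeCocycle

open MeasureTheory
open scoped ENNReal

variable {n : ℕ}

/-- The normalizer of an algebra of matrices in the group of invertible matrices. -/
def algNormalizer (S : Subalgebra ℚ (Matrix (Fin n) (Fin n) ℚ)) :
    Subgroup (Matrix (Fin n) (Fin n) ℚ)ˣ where
  carrier := {g | ∀ s, (g : Matrix (Fin n) (Fin n) ℚ) * s *
    (↑g⁻¹ : Matrix (Fin n) (Fin n) ℚ) ∈ S ↔ s ∈ S}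
  one_mem' := by simp
  mul_mem' := by
    intro g h hg hh s
    have := hg ((h : Matrix (Fin n) (Fin n) ℚ) * s * (↑h⁻¹ : Matrix (Fin n) (Fin n) ℚ))
    rw [hh s] at this
    rw [← this]
    simp [mul_assoc]
  inv_mem' := by
    intro g hg s
    rw [← hg]
    simp [mul_assoc]

lemma mem_algNormalizer {S : Subalgebra ℚ (Matrix (Fin n) (Fin n) ℚ)}
    {g : (Matrix (Fin n) (Fin n) ℚ)ˣ} : g ∈ algNormalizer S ↔
    ∀ s, (g : Matrix (Fin n) (Fin n) ℚ) * s * (↑g⁻¹ : Matrix (Fin n) (Fin n) ℚ) ∈ S ↔ s ∈ S :=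
  Iff.rfl

/-- The units of an algebra of matrices that normalize it. -/
def algUnits (S : Subalgebra ℚ (Matrix (Fin n) (Fin n) ℚ)) : Subgroup (algNormalizer S) where
  carrier := {g | ((g : (Matrix (Fin n) (Fin n) ℚ)ˣ) : Matrix (Fin n) (Fin n) ℚ) ∈ S}
  one_mem' := by simp [S.one_mem]
  mul_mem' := by
    intro g h hg hh
    simpa using S.mul_mem hg hh
  inv_mem' := by
    intro g hg
    simpa using S.units_inv_mem _ hg

instance (S : Subalgebra ℚ (Matrix (Fin n) (Fin n) ℚ)) : (algUnits S).Normal where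
  conj_mem := by
    intro g hg h
    have := (mem_algNormalizer.1 h.2 ((g : (Matrix (Fin n) (Fin n) ℚ)ˣ) : Matrix _ _ ℚ)).2 hg
    simpa [algUnits] using this

/-- The normalizer of an algebra modulo its units. -/
abbrev AlgOut (S : Subalgebra ℚ (Matrix (Fin n) (Fin n) ℚ)) : Type :=
  algNormalizer S ⧸ algUnits S

instance (S : Subalgebra ℚ (Matrix (Fin n) (Fin n) ℚ)) : MeasurableSpace (AlgOut S) := ⊤

instance (S : Subalgebra ℚ (Matrix (Fin n) (Fin n) ℚ)) : DiscreteMeasurableSpace (AlgOut S) :=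
  ⟨fun _ => trivial⟩

instance countable_algOut (S : Subalgebra ℚ (Matrix (Fin n) (Fin n) ℚ)) : Countable (AlgOut S) :=
  (QuotientGroup.mk_surjective (s := algUnits S)).countable

instance countable_subalgebra : Countable (Subalgebra ℚ (Matrix (Fin n) (Fin n) ℚ)) := by
  have : Countable (Matrix (Fin n) (Fin n) ℚ) := inferInstanceAs (Countable (Fin n → Fin n → ℚ))
  have h : Function.Surjective fun t : Finset (Matrix (Fin n) (Fin n) ℚ) =>
      Submodule.span ℚ (t : Set (Matrix (Fin n) (Fin n) ℚ)) := by
    intro P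
    obtain ⟨t, ht⟩ := IsNoetherian.noetherian P
    exact ⟨t, ht⟩
  have : Countable (Submodule ℚ (Matrix (Fin n) (Fin n) ℚ)) := h.countable
  exact (Subalgebra.toSubmodule_injective).countable

variable {X : Type*} [MeasurableSpace X]

/-- A family of subgroups of `ℚⁿ` depending measurably on a parameter. -/
def MeasFam (A : X → AddSubgroup (Fin n → ℚ)) : Prop := ∀ v, Measurable fun x => v ∈ A x

lemma MeasFam.comp {A : X → AddSubgroup (Fin n → ℚ)} (hA : MeasFam A) {T : X → X}
    (hT : Measurable T) : MeasFam fun x => A (T x) := fun v => (hA v).comp hT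

lemma MeasFam.map {A : X → AddSubgroup (Fin n → ℚ)} (hA : MeasFam A)
    (s : Matrix (Fin n) (Fin n) ℚ) : MeasFam fun x => (A x).map (matHom s) := by
  intro v
  have : (fun x => v ∈ (A x).map (matHom s)) = fun x => ∃ u, u ∈ A x ∧ matHom s u = v := by
    funext x
    exact propext AddSubgroup.mem_map
  rw [this]
  exact Measurable.exists fun u => (hA u).and measurable_const

lemma MeasFam.sup {A : X → AddSubgroup (Fin n → ℚ)} (hA : MeasFam A)
    (L : AddSubgroup (Fin n → ℚ)) : MeasFam fun x => A x ⊔ L := by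
  intro v
  have : (fun x => v ∈ A x ⊔ L) = fun x => ∃ u, u ∈ A x ∧ ∃ z ∈ L, u + z = v := by
    funext x
    exact propext AddSubgroup.mem_sup
  rw [this]
  exact Measurable.exists fun u => (hA u).and measurable_const

lemma MeasFam.measurable_le {A B : X → AddSubgroup (Fin n → ℚ)} (hA : MeasFam A)
    (hB : MeasFam B) : Measurable fun x => A x ≤ B x :=
  Measurable.forall fun v => (hA v).imp (hB v)

lemma MeasFam.measurable_eq {A B : X → AddSubgroup (Fin n → ℚ)} (hA : MeasFam A)
    (hB : MeasFam B) : Measurable fun x => A x = B x := by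
  have : (fun x => A x = B x) = fun x => A x ≤ B x ∧ B x ≤ A x := by
    funext x
    exact propext le_antisymm_iff
  rw [this]
  exact (hA.measurable_le hB).and (hB.measurable_le hA)

lemma MeasFam.measurable_latComm {A B : X → AddSubgroup (Fin n → ℚ)} (hA : MeasFam A)
    (hB : MeasFam B) : Measurable fun x => LatComm (A x) (B x) :=
  Measurable.exists fun _ => (hA.sup _).measurable_eq (hB.sup _)

lemma MeasFam.measurable_latEnd_eq {A : X → AddSubgroup (Fin n → ℚ)} (hA : MeasFam A)
    (S : Subalgebra ℚ (Matrix (Fin n) (Fin n) ℚ)) : Measurable fun x => latEnd (A x) = S := by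
  have : Countable (Matrix (Fin n) (Fin n) ℚ) := inferInstanceAs (Countable (Fin n → Fin n → ℚ))
  have : (fun x => latEnd (A x) = S) =
      fun x => ∀ s, (∃ k, (A x).map (matHom s) ≤ A x ⊔ facLattice n k) ↔ s ∈ S := by
    funext x
    exact propext SetLike.ext_iff
  rw [this]
  refine Measurable.forall fun s => Measurable.iff (Measurable.exists fun k => ?_) measurable_const
  exact (hA.map s).measurable_le (hA.sup _)

lemma MeasFam.map_measurable {A : X → AddSubgroup (Fin n → ℚ)} (hA : MeasFam A)
    {g : X → (Matrix (Fin n) (Fin n) ℚ)ˣ} (hg : ∀ j, Measurable fun x => g x = j) :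
    MeasFam fun x => (A x).map (matHom (g x)) := by
  intro v
  have : (fun x => v ∈ (A x).map (matHom (g x))) =
      fun x => ∃ j : (Matrix (Fin n) (Fin n) ℚ)ˣ, g x = j ∧ v ∈ (A x).map (matHom j) := by
    funext x
    exact propext ⟨fun h => ⟨_, rfl, h⟩, by rintro ⟨_, rfl, h⟩; exact h⟩
  rw [this]
  exact Measurable.exists fun j => (hg j).and (hA.map _ v)

/-- A measurable choice of a witness from a countable type. -/
lemma exists_measurable_choice {ι : Type*} [Countable ι] [Nonempty ι] {P : ι → X → Prop}
    (hP : ∀ i, Measurable (P i)) :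
    ∃ f : X → ι, (∀ j, Measurable fun x => f x = j) ∧ ∀ x, (∃ i, P i x) → P (f x) x := by
  classical
  obtain ⟨e, he⟩ := exists_surjective_nat ι
  have hex : ∀ x, ∃ m, P (e m) x ∨ ¬ ∃ i, P i x := by
    intro x
    by_cases h : ∃ i, P i x
    · obtain ⟨i, hi⟩ := h
      obtain ⟨m, rfl⟩ := he i
      exact ⟨m, Or.inl hi⟩
    · exact ⟨0, Or.inr h⟩
  have hmeas : ∀ m, Measurable fun x => P (e m) x ∨ ¬ ∃ i, P i x := fun m =>
    (hP _).or (Measurable.exists hP).not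
  have hfind : Measurable fun x => Nat.find (hex x) :=
    measurable_find hex fun m => measurableSet_setOfPred.2 (hmeas m)
  refine ⟨fun x => e (Nat.find (hex x)), fun j => ?_, fun x hx => ?_⟩
  · exact (measurable_from_top (f := fun m => e m = j)).comp hfind
  · exact (Nat.find_spec (hex x)).resolve_right (not_not.2 hx)

lemma latEnd_map_eq_iff_mem_algNormalizer {A : AddSubgroup (Fin n → ℚ)}
    {g : (Matrix (Fin n) (Fin n) ℚ)ˣ} (h : latEnd (A.map (matHom g)) = latEnd A) :
    g ∈ algNormalizer (latEnd A) := by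
  intro s
  constructor
  · intro hs
    rw [← h] at hs
    have := conj_mem_latEnd_map g⁻¹ hs
    rw [← map_matHom_mul, Units.inv_mul, map_matHom_one] at this
    simpa [mul_assoc] using this
  · intro hs
    rw [← h]
    exact conj_mem_latEnd_map g hs

variable {Γ : Type*} [Group Γ]

/-- The cocycle attached to an equivariant family of subgroups of `ℚⁿ`, after reduction to a set on
which the algebra of endomorphisms up to lattices is constant. -/
theorem exists_lattice_cocycle {μ : Measure X} (hμ : μ ≠ 0) {T : Γ → X → X}
    (hone : ∀ x, T 1 x = x) (hmul : ∀ g h x, T (g * h) x = T g (T h x))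
    (hT : ∀ γ, Measurable (T γ)) {f : X → AddSubgroup (Fin n → ℚ)} (hf : MeasFam f)
    (hfT : ∀ γ x, ∃ g : (Matrix (Fin n) (Fin n) ℚ)ˣ, (f x).map (matHom g) = f (T γ x)) :
    ∃ (S : Subalgebra ℚ (Matrix (Fin n) (Fin n) ℚ)) (C : Set X) (F : X → AddSubgroup (Fin n → ℚ))
      (w : Γ → X → AlgOut S), MeasurableSet C ∧ μ C ≠ 0 ∧ (∀ γ x, T γ x ∈ C ↔ x ∈ C) ∧ MeasFam F ∧
      (∀ x, ∃ g : (Matrix (Fin n) (Fin n) ℚ)ˣ, F x = (f x).map (matHom g)) ∧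
      (∀ γ, Measurable (w γ)) ∧ (∀ g h x, w (g * h) x = w g (T h x) * w h x) ∧
      ∀ γ, ∀ x ∈ C, w γ x = 1 → LatComm (F (T γ x)) (F x) := by
  classical
  have hTinv : ∀ γ x, T γ⁻¹ (T γ x) = x := fun γ x => by rw [← hmul, inv_mul_cancel, hone]
  let P : Subalgebra ℚ (Matrix (Fin n) (Fin n) ℚ) → (Matrix (Fin n) (Fin n) ℚ)ˣ → X → Prop :=
    fun S g x => latEnd ((f x).map (matHom g)) = S
  have hP : ∀ S g, Measurable (P S g) := fun S g => (hf.map _).measurable_latEnd_eq S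
  obtain ⟨S, hS⟩ : ∃ S, μ {x | ∃ g, P S g x} ≠ 0 := by
    by_contra! hcon
    refine hμ (Measure.measure_univ_eq_zero.1 (measure_mono_null ?_ (measure_iUnion_null hcon)))
    intro x _
    exact Set.mem_iUnion.2 ⟨latEnd ((f x).map (matHom (1 : (Matrix (Fin n) (Fin n) ℚ)ˣ))), 1, rfl⟩
  set C : Set X := {x | ∃ g, P S g x} with hC
  obtain ⟨h, hh, hhC⟩ := exists_measurable_choice (hP S)
  have hhC : ∀ x ∈ C, latEnd ((f x).map (matHom (h x))) = S := hhC
  set F : X → AddSubgroup (Fin n → ℚ) := fun x => (f x).map (matHom (h x)) with hF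
  have hFm : MeasFam F := hf.map_measurable hh
  have hCT' : ∀ γ x, x ∈ C → T γ x ∈ C := by
    rintro γ x ⟨g, hg⟩
    obtain ⟨r, hr⟩ := hfT γ x
    refine ⟨g * r⁻¹, ?_⟩
    simp only [P] at hg ⊢
    rw [← hr, ← map_matHom_mul, ← Units.val_mul, inv_mul_cancel_right, hg]
  have hCT : ∀ γ x, T γ x ∈ C ↔ x ∈ C := fun γ x =>
    ⟨fun hx => by
      have := hCT' γ⁻¹ _ hx
      rwa [hTinv] at this, hCT' γ x⟩
  have hex : ∀ γ, ∀ x ∈ C, ∃ g : algNormalizer S,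
      LatComm ((F x).map (matHom ((g : (Matrix (Fin n) (Fin n) ℚ)ˣ) : Matrix _ _ ℚ)))
        (F (T γ x)) := by
    intro γ x hx
    obtain ⟨r, hr⟩ := hfT γ x
    have e : (F x).map (matHom (h (T γ x) * r * (h x)⁻¹ : (Matrix (Fin n) (Fin n) ℚ)ˣ)) =
        F (T γ x) := by
      simp only [hF]
      rw [← map_matHom_mul, ← Units.val_mul, inv_mul_cancel_right, Units.val_mul, map_matHom_mul,
        hr]
    have hN : (h (T γ x) * r * (h x)⁻¹) ∈ algNormalizer S := by
      rw [← hhC x hx]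
      refine latEnd_map_eq_iff_mem_algNormalizer ?_
      have h1 : latEnd (F x) = S := hhC x hx
      have h2 : latEnd (F (T γ x)) = S := hhC _ ((hCT γ x).2 hx)
      change latEnd ((F x).map _) = latEnd (F x)
      rw [e, h1, h2]
    exact ⟨⟨_, hN⟩, e ▸ LatComm.refl _⟩
  have huniq : ∀ x ∈ C, ∀ (B : AddSubgroup (Fin n → ℚ)) (g g' : algNormalizer S),
      LatComm ((F x).map (matHom ((g : (Matrix (Fin n) (Fin n) ℚ)ˣ) : Matrix _ _ ℚ))) B →
      (LatComm ((F x).map (matHom ((g' : (Matrix (Fin n) (Fin n) ℚ)ˣ) : Matrix _ _ ℚ))) B ↔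
        (g : AlgOut S) = g') := by
    intro x hx B g g'
    have hD : latEnd (F x) = S := hhC x hx
    generalize F x = D at hD ⊢
    intro hg
    rw [QuotientGroup.eq]
    have h1 : LatComm (D.map (matHom
        ((g' : (Matrix (Fin n) (Fin n) ℚ)ˣ) : Matrix _ _ ℚ))) B ↔
        LatComm (D.map (matHom ((g⁻¹ * g' : algNormalizer S) :
          (Matrix (Fin n) (Fin n) ℚ)ˣ))) D := by
      constructor
      · intro h'
        have := (h'.trans hg.symm).map ((g⁻¹ : algNormalizer S) : (Matrix (Fin n) (Fin n) ℚ)ˣ)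
        rw [← map_matHom_mul, ← map_matHom_mul, ← Units.val_mul, ← Units.val_mul, ← Subgroup.coe_mul,
          ← Subgroup.coe_mul, inv_mul_cancel, Subgroup.coe_one, Units.val_one,
          map_matHom_one] at this
        exact this
      · intro h'
        have := h'.map (g : (Matrix (Fin n) (Fin n) ℚ)ˣ)
        rw [← map_matHom_mul, ← Units.val_mul, ← Subgroup.coe_mul, mul_inv_cancel_left] at this
        exact this.trans hg
    rw [h1, latComm_map_iff, hD]
    rfl
  choose! gw hgw using hex
  let w : Γ → X → AlgOut S := fun γ x => if x ∈ C then (gw γ x : AlgOut S) else 1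
  have hwC : ∀ γ, ∀ x ∈ C, ∀ g : algNormalizer S,
      LatComm ((F x).map (matHom ((g : (Matrix (Fin n) (Fin n) ℚ)ˣ) : Matrix _ _ ℚ)))
        (F (T γ x)) ↔ w γ x = g := by
    intro γ x hx g
    rw [huniq x hx _ (gw γ x) g (hgw γ x hx)]
    simp only [w, if_pos hx]
  have hCm : MeasurableSet C := measurableSet_setOfPred.2 (Measurable.exists (hP S))
  refine ⟨S, C, F, w, hCm, hS, hCT, hFm, fun x => ⟨h x, rfl⟩, fun γ => ?_, fun g g' x => ?_, ?_⟩
  · refine measurable_to_countable' fun l => ?_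
    obtain ⟨g, rfl⟩ := QuotientGroup.mk_surjective l
    have : w γ ⁻¹' {(g : AlgOut S)} = {x | (x ∈ C ∧ LatComm ((F x).map (matHom
        ((g : (Matrix (Fin n) (Fin n) ℚ)ˣ) : Matrix _ _ ℚ))) (F (T γ x))) ∨
        (x ∉ C ∧ (1 : AlgOut S) = g)} := by
      ext x
      by_cases hx : x ∈ C
      · simp [hx, hwC γ x hx g]
      · simp [hx, w]
    rw [this]
    refine measurableSet_setOfPred.2 (Measurable.or ?_ ?_)
    · exact (measurableSet_setOfPred.1 hCm).and ((hFm.map _).measurable_latComm (hFm.comp (hT γ)))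
    · exact (measurableSet_setOfPred.1 hCm).not.and measurable_const
  · by_cases hx : x ∈ C
    · have h1 := hgw g' x hx
      have h2 := hgw g (T g' x) ((hCT _ _).2 hx)
      have h3 := (h1.map (gw g (T g' x) : (Matrix (Fin n) (Fin n) ℚ)ˣ)).trans h2
      rw [← map_matHom_mul, ← Units.val_mul, ← Subgroup.coe_mul, ← hmul, hwC _ x hx] at h3
      rw [h3]
      simp only [w, if_pos hx, if_pos ((hCT g' x).2 hx)]
      rfl
    · have hx' : T g' x ∉ C := fun h => hx ((hCT _ _).1 h)
      simp only [w, if_neg hx, if_neg hx', mul_one]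
  · intro γ x hx h1
    have h2 := (hwC γ x hx 1).2 h1
    rw [Subgroup.coe_one, Units.val_one, map_matHom_one] at h2
    exact h2.symm

end LatticeCocycle

section PadicVectors

open MeasureTheory Filter
open scoped ENNReal Topology

variable {p : ℕ} [Fact p.Prime] {m : ℕ}

noncomputable instance padicInt_measurableSpace : MeasurableSpace ℤ_[p] := borel _

instance padicInt_borelSpace : BorelSpace ℤ_[p] := ⟨rfl⟩

/-- Reduction of a `p`-adic vector modulo `p ^ k`. -/
noncomputable def vecMod (k : ℕ) (x : Fin m → ℤ_[p]) : Fin m → ZMod (p ^ k) := fun i => PadicInt.toZModPow k (x i)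

lemma vecMod_add (k : ℕ) (x y : Fin m → ℤ_[p]) : vecMod k (x + y) = vecMod k x + vecMod k y := by
  funext i
  simp [vecMod]

lemma toZModPow_eq_iff (k : ℕ) (a b : ℤ_[p]) :
    PadicInt.toZModPow k a = PadicInt.toZModPow k b ↔ ‖a - b‖ ≤ (p : ℝ) ^ (-k : ℤ) := by
  rw [PadicInt.norm_le_pow_iff_mem_span_pow, ← PadicInt.ker_toZModPow, RingHom.mem_ker, map_sub,
    sub_eq_zero]

lemma vecMod_eq_iff (k : ℕ) (x y : Fin m → ℤ_[p]) :
    vecMod k x = vecMod k y ↔ dist x y ≤ (p : ℝ) ^ (-k : ℤ) := by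
  have hp : (0 : ℝ) < p := by exact_mod_cast (Fact.out : p.Prime).pos
  rw [dist_pi_le_iff (by positivity), funext_iff]
  simp only [vecMod, toZModPow_eq_iff, dist_eq_norm]

lemma vecMod_surjective (k : ℕ) : Function.Surjective (vecMod (p := p) (m := m) k) := by
  intro y
  have : NeZero (p ^ k) := ⟨pow_ne_zero _ (Fact.out : p.Prime).ne_zero⟩
  refine ⟨fun i => ((y i).val : ℤ_[p]), ?_⟩
  funext i
  simp [vecMod]

lemma vecMod_eq_of_le {k l : ℕ} (hkl : k ≤ l) {x y : Fin m → ℤ_[p]}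
    (h : vecMod l x = vecMod l y) : vecMod k x = vecMod k y := by
  rw [vecMod_eq_iff] at h ⊢
  refine h.trans (zpow_le_zpow_right₀ ?_ (by omega))
  exact_mod_cast (Fact.out : p.Prime).one_le

lemma isOpen_vecMod_preimage (k : ℕ) (E : Set (Fin m → ZMod (p ^ k))) :
    IsOpen (vecMod k ⁻¹' E : Set (Fin m → ℤ_[p])) := by
  have hp : (0 : ℝ) < p := by exact_mod_cast (Fact.out : p.Prime).pos
  refine Metric.isOpen_iff.2 fun x hx => ⟨(p : ℝ) ^ (-k : ℤ), by positivity, fun y hy => ?_⟩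
  rw [Set.mem_preimage, (vecMod_eq_iff k y x).2 (Metric.mem_ball.1 hy).le]
  exact hx

lemma approximatedBy_vecMod (μ : Measure (Fin m → ℤ_[p])) [IsFiniteMeasure μ] :
    ApproximatedBy μ (fun k => vecMod (p := p) (m := m) k) := by
  have hp : (1 : ℝ) < p := by exact_mod_cast (Fact.out : p.Prime).one_lt
  intro D hD ε hε
  obtain ⟨U, hDU, hU, hμU⟩ := D.exists_isOpen_lt_add (μ := μ) (measure_ne_top _ _)
    (ε := ε / 2) (by simpa using hε)
  let V : ℕ → Set (Fin m → ℤ_[p]) := fun k => {x | ∀ y, vecMod k y = vecMod k x → y ∈ U}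
  have hVV : ∀ k, vecMod k ⁻¹' (vecMod k '' V k) = V k := by
    intro k
    refine Set.Subset.antisymm ?_ (Set.subset_preimage_image _ _)
    rintro x ⟨y, hy, hyx⟩ z hz
    exact hy z (hz.trans hyx.symm)
  have hVmono : Monotone V := fun k l hkl x hx y hy => hx y (vecMod_eq_of_le hkl hy)
  have hVU : ∀ k, V k ⊆ U := fun k x hx => hx x rfl
  have hVm : ∀ k, MeasurableSet (V k) := fun k => hVV k ▸ (isOpen_vecMod_preimage k _).measurableSet
  have hUn : ⋃ k, V k = U := by
    refine Set.Subset.antisymm (Set.iUnion_subset hVU) fun x hx => ?_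
    obtain ⟨r, hr, hball⟩ := Metric.isOpen_iff.1 hU x hx
    obtain ⟨k, hk⟩ := exists_pow_lt_of_lt_one hr (inv_lt_one_of_one_lt₀ hp)
    refine Set.mem_iUnion.2 ⟨k, fun y hy => hball ?_⟩
    refine lt_of_le_of_lt ((vecMod_eq_iff k y x).1 hy) ?_
    rwa [zpow_neg, zpow_natCast, ← inv_pow]
  have ht := tendsto_measure_iUnion_atTop (μ := μ) hVmono
  rw [hUn] at ht
  have ht' : ∀ᶠ k in atTop, μ U < μ (V k) + ε / 2 := by
    by_cases h0 : μ U = 0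
    · refine Eventually.of_forall fun k => ?_
      rw [h0]
      exact lt_of_lt_of_le (ENNReal.half_pos hε) le_add_self
    · have hlt : μ U - ε / 2 < μ U := ENNReal.sub_lt_self (measure_ne_top _ _) h0 (by simpa using hε)
      filter_upwards [ht.eventually (lt_mem_nhds hlt)] with k hk
      exact ENNReal.lt_add_of_sub_lt_right (Or.inl (measure_ne_top _ _)) hk
  obtain ⟨K, hK⟩ := eventually_atTop.1 ht'
  refine ⟨K, fun k hk => ⟨vecMod k '' V k, ?_⟩⟩
  rw [hVV]
  have hsub : symmDiff D (V k) ⊆ (U \ D) ∪ (U \ V k) := by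
    rintro x (⟨hx, hx'⟩ | ⟨hx, hx'⟩)
    · exact Or.inr ⟨hDU hx, hx'⟩
    · exact Or.inl ⟨hVU k hx, hx'⟩
  refine (measure_mono hsub).trans ((measure_union_le _ _).trans ?_)
  rw [← ENNReal.add_halves ε]
  refine add_le_add ?_ ?_
  · rw [measure_sdiff hDU hD.nullMeasurableSet (measure_ne_top _ _)]
    exact tsub_le_iff_left.2 hμU.le
  · rw [measure_sdiff (hVU k) (hVm k).nullMeasurableSet (measure_ne_top _ _)]
    exact tsub_le_iff_left.2 (hK k hk).le

instance (k : ℕ) : NeZero (p ^ k) := ⟨pow_ne_zero _ (Fact.out : p.Prime).ne_zero⟩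

variable (p m) in
/-- The normalized Haar measure on `ℤ_pᵐ`. -/
noncomputable def vecHaar : Measure (Fin m → ℤ_[p]) := Measure.addHaarMeasure ⊤

instance : (vecHaar p m).IsAddHaarMeasure := by
  unfold vecHaar
  infer_instance

lemma vecHaar_univ : vecHaar p m Set.univ = 1 := by
  have := Measure.addHaarMeasure_self (K₀ := (⊤ : TopologicalSpace.PositiveCompacts
    (Fin m → ℤ_[p])))
  simpa [vecHaar] using this

instance : IsProbabilityMeasure (vecHaar p m) := ⟨vecHaar_univ⟩

lemma card_mul_vecHaar_fibre (k : ℕ) (b : Fin m → ZMod (p ^ k)) :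
    Fintype.card (Fin m → ZMod (p ^ k)) * vecHaar p m (vecMod k ⁻¹' {b}) ≤ 1 := by
  have heq : ∀ a, vecHaar p m (vecMod k ⁻¹' {a}) = vecHaar p m (vecMod k ⁻¹' {b}) := by
    intro a
    obtain ⟨y, hy⟩ := vecMod_surjective (p := p) k (b - a)
    rw [← measure_preimage_add (vecHaar p m) y (vecMod k ⁻¹' {b})]
    congr 1
    ext x
    simp only [Set.mem_preimage, Set.mem_singleton_iff, vecMod_add, hy]
    constructor
    · rintro rfl
      abel
    · intro h
      have := congrArg (fun t => t - (b - a)) h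
      simpa using this
  have hsum : ∑ a, vecHaar p m (vecMod k ⁻¹' {a}) = 1 := by
    rw [← measure_biUnion_finset, ← vecHaar_univ (p := p) (m := m)]
    · congr 1
      ext x
      simp
    · intro a _ a' _ haa'
      exact Set.disjoint_left.2 fun x hx hx' => haa' (hx.symm.trans hx')
    · exact fun a _ => (isOpen_vecMod_preimage k _).measurableSet
  rw [Finset.sum_congr rfl fun a _ => heq a, Finset.sum_const, nsmul_eq_mul] at hsum
  exact hsum.le

/-- The action of integer matrices on `p`-adic vectors. -/
noncomputable def vecAct (γ : Matrix.SpecialLinearGroup (Fin m) ℤ) (x : Fin m → ℤ_[p]) : Fin m → ℤ_[p] :=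
  ((Matrix.SpecialLinearGroup.coeMonoidHom γ).map (Int.castRingHom ℤ_[p])).mulVec x

lemma vecAct_one (x : Fin m → ℤ_[p]) : vecAct 1 x = x := by
  simp [vecAct]

lemma vecAct_mul (g h : Matrix.SpecialLinearGroup (Fin m) ℤ) (x : Fin m → ℤ_[p]) :
    vecAct (g * h) x = vecAct g (vecAct h x) := by
  rw [vecAct, vecAct, vecAct, map_mul, Matrix.map_mul, Matrix.mulVec_mulVec]

lemma continuous_vecAct (g : Matrix.SpecialLinearGroup (Fin m) ℤ) :
    Continuous (vecAct (p := p) g) := by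
  unfold vecAct
  fun_prop

lemma measurePreserving_vecAct (g : Matrix.SpecialLinearGroup (Fin m) ℤ) :
    MeasurePreserving (vecAct g) (vecHaar p m) (vecHaar p m) := by
  let f : (Fin m → ℤ_[p]) →+ (Fin m → ℤ_[p]) :=
    (((Matrix.SpecialLinearGroup.coeMonoidHom g).map (Int.castRingHom ℤ_[p])).mulVecLin).toAddMonoidHom
  have hf : ⇑f = vecAct g := rfl
  rw [← hf]
  refine f.measurePreserving (hf ▸ continuous_vecAct g) ?_ rfl
  intro y
  refine ⟨vecAct g⁻¹ y, ?_⟩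
  rw [hf, ← vecAct_mul, mul_inv_cancel, vecAct_one]

lemma vecMod_vecAct_congr (k : ℕ) (g : Matrix.SpecialLinearGroup (Fin m) ℤ) {x y : Fin m → ℤ_[p]}
    (h : vecMod k x = vecMod k y) : vecMod k (vecAct g x) = vecMod k (vecAct g y) := by
  funext i
  simp only [vecMod, vecAct, Matrix.mulVec, dotProduct, map_sum, map_mul]
  refine Finset.sum_congr rfl fun j _ => ?_
  rw [show PadicInt.toZModPow k (x j) = PadicInt.toZModPow k (y j) from congrFun h j]

lemma vecAct_elemSL {i j : Fin m} (hij : i ≠ j) (a : ℤ) (x : Fin m → ℤ_[p]) :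
    vecAct (elemSL i j a) x = x + Pi.single i ((a : ℤ_[p]) * x j) := by
  rw [vecAct, elemSL_coe hij, Matrix.map_add _ (by simp), Matrix.add_mulVec]
  congr 1
  · simp
  · funext l
    simp only [Matrix.mulVec, dotProduct, Matrix.map_apply, Matrix.single_apply, Pi.single_apply]
    rw [Finset.sum_eq_single j]
    · by_cases hl : l = i
      · simp [hl]
      · simp [hl, Ne.symm hl]
    · intro t _ ht
      simp [ht.symm]
    · simp

lemma vecMod_vecAct_elemSL (k : ℕ) {i j : Fin m} (hij : i ≠ j) (a : ℤ) (x : Fin m → ℤ_[p]) :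
    vecMod k (vecAct (elemSL i j ((p ^ k : ℕ) * a)) x) = vecMod k x := by
  rw [vecAct_elemSL hij, vecMod_add]
  refine add_eq_left.2 ?_
  funext l
  have hz : PadicInt.toZModPow k ((p : ℤ_[p]) ^ k) = 0 := by
    rw [← Nat.cast_pow, map_natCast, ZMod.natCast_self]
  by_cases hl : l = i
  · subst hl
    simp [vecMod, hz, mul_assoc]
  · simp [vecMod, Pi.single_eq_of_ne hl]

end PadicVectors

section PadicGroups

open MeasureTheory Filter
open scoped ENNReal Topology

variable {p : ℕ} [Fact p.Prime] {m : ℕ}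

/-- The pairing of a rational vector with a `p`-adic vector. -/
noncomputable def padPair (v : Fin m → ℚ) (x : Fin m → ℤ_[p]) : ℚ_[p] :=
  ∑ i, (v i : ℚ_[p]) * (x i : ℚ_[p])

/-- The rational vectors whose pairing with a `p`-adic vector is integral. -/
noncomputable def padGroup (x : Fin m → ℤ_[p]) : AddSubgroup (Fin m → ℚ) where
  carrier := {v | ‖padPair v x‖ ≤ 1}
  zero_mem' := by simp [padPair]
  add_mem' := by
    intro a b ha hb
    have : padPair (a + b) x = padPair a x + padPair b x := by
      simp [padPair, add_mul, Finset.sum_add_distrib]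
    rw [Set.mem_ofPred_eq, this]
    exact (Padic.nonarchimedean _ _).trans (max_le ha hb)
  neg_mem' := by
    intro a ha
    have : padPair (-a) x = -padPair a x := by
      simp [padPair]
    rw [Set.mem_ofPred_eq, this, norm_neg]
    exact ha

lemma mem_padGroup {x : Fin m → ℤ_[p]} {v : Fin m → ℚ} :
    v ∈ padGroup x ↔ ‖padPair v x‖ ≤ 1 := Iff.rfl

lemma fullRank_padGroup (x : Fin m → ℤ_[p]) : FullRank (padGroup x) := by
  refine ⟨fun i => Pi.single i 1, fun i => ?_, ?_⟩
  · rw [mem_padGroup, padPair, Finset.sum_eq_single i]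
    · simpa using (x i).2
    · intro j _ hj
      simp [Pi.single_eq_of_ne hj]
    · simp
  · have := (Pi.basisFun ℚ (Fin m)).linearIndependent
    convert this using 2
    simp

lemma measFam_padGroup : MeasFam (padGroup (p := p) (m := m)) := by
  intro v
  refine measurableSet_setOfPred.1 (IsClosed.measurableSet ?_)
  refine isClosed_le (f := fun x : Fin m → ℤ_[p] => ‖padPair v x‖) ?_ continuous_const
  unfold padPair
  have hi : ∀ i, Continuous fun x : Fin m → ℤ_[p] => (x i : ℚ_[p]) := fun i =>
    continuous_subtype_val.comp (continuous_apply i)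
  fun_prop

lemma padPair_vecAct (γ : Matrix.SpecialLinearGroup (Fin m) ℤ) (v : Fin m → ℚ)
    (x : Fin m → ℤ_[p]) : padPair v (vecAct γ x) = padPair (matHom
      (((Matrix.SpecialLinearGroup.coeMonoidHom γ).map (Int.castRingHom ℚ)).transpose) v) x := by
  simp only [padPair, vecAct, matHom_apply, Matrix.mulVec, dotProduct, Matrix.transpose_apply,
    Matrix.map_apply]
  have hs : ∀ f : Fin m → ℤ_[p], ((∑ j, f j : ℤ_[p]) : ℚ_[p]) = ∑ j, (f j : ℚ_[p]) := fun f =>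
    map_sum (PadicInt.Coe.ringHom (p := p)) f _
  push_cast
  simp only [hs, Finset.mul_sum, Finset.sum_mul]
  rw [Finset.sum_comm]
  refine Finset.sum_congr rfl fun i _ => Finset.sum_congr rfl fun j _ => ?_
  simp
  ring

lemma exists_map_padGroup_vecAct (γ : Matrix.SpecialLinearGroup (Fin m) ℤ) (x : Fin m → ℤ_[p]) :
    ∃ g : (Matrix (Fin m) (Fin m) ℚ)ˣ, (padGroup (vecAct γ x)).map (matHom g) = padGroup x := by
  let f : Matrix.SpecialLinearGroup (Fin m) ℤ → Matrix (Fin m) (Fin m) ℚ := fun γ =>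
    ((Matrix.SpecialLinearGroup.coeMonoidHom γ).map (Int.castRingHom ℚ)).transpose
  have hf : ∀ a b, f a * f b = f (b * a) := by
    intro a b
    simp only [f, map_mul]
    rw [Matrix.map_mul, Matrix.transpose_mul]
  have hf1 : f 1 = 1 := by simp [f]
  refine ⟨⟨f γ, f γ⁻¹, by rw [hf, inv_mul_cancel, hf1], by rw [hf, mul_inv_cancel, hf1]⟩, ?_⟩
  ext v
  rw [mem_map_matHom_unit, mem_padGroup, padPair_vecAct, mem_padGroup]
  change ‖padPair (matHom (f γ) (matHom (f γ⁻¹) v)) x‖ ≤ 1 ↔ _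
  rw [matHom_apply, matHom_apply, Matrix.mulVec_mulVec, hf, inv_mul_cancel, hf1, Matrix.one_mulVec]

/-- The group determines the vector up to proportionality. -/
lemma mul_eq_mul_of_padGroup_eq {x y : Fin m → ℤ_[p]} (h : padGroup x = padGroup y) (i j : Fin m) :
    x j * y i = x i * y j := by
  have hpair : ∀ (t : ℕ) (a b : ℕ) (z : Fin m → ℤ_[p]),
      padPair (Pi.single i ((a : ℚ) / p ^ t) - Pi.single j ((b : ℚ) / p ^ t)) z =
        ((a * z i - b * z j : ℤ_[p]) : ℚ_[p]) / p ^ t := by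
    intro t a b z
    simp only [padPair, Pi.sub_apply, Rat.cast_sub, sub_mul, Finset.sum_sub_distrib]
    rw [Finset.sum_eq_single i, Finset.sum_eq_single j]
    · simp
      ring
    · intro l _ hl
      simp [Pi.single_eq_of_ne hl]
    · simp
    · intro l _ hl
      simp [Pi.single_eq_of_ne hl]
    · simp
  have hmem : ∀ (t : ℕ) (a b : ℕ) (z : Fin m → ℤ_[p]),
      Pi.single i ((a : ℚ) / p ^ t) - Pi.single j ((b : ℚ) / p ^ t) ∈ padGroup z ↔
        PadicInt.toZModPow t ((a : ℤ_[p]) * z i - (b : ℤ_[p]) * z j) = 0 := by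
    intro t a b z
    rw [mem_padGroup, hpair, ← map_zero (PadicInt.toZModPow (p := p) t), toZModPow_eq_iff, sub_zero,
      norm_div, norm_pow, Padic.norm_p, ← PadicInt.norm_def, inv_pow, div_inv_eq_mul, zpow_neg,
      zpow_natCast]
    have hp : (0 : ℝ) < (p : ℝ) ^ t := by
      have : (0 : ℝ) < p := by exact_mod_cast (Fact.out : p.Prime).pos
      positivity
    rw [← one_div, le_div_iff₀ hp]
  refine PadicInt.ext_of_toZModPow.1 fun t => ?_
  set a := (PadicInt.toZModPow t (x j)).val with ha
  set b := (PadicInt.toZModPow t (x i)).val with hb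
  have ha' : ((a : ℕ) : ZMod (p ^ t)) = PadicInt.toZModPow t (x j) := ZMod.natCast_zmod_val _
  have hb' : ((b : ℕ) : ZMod (p ^ t)) = PadicInt.toZModPow t (x i) := ZMod.natCast_zmod_val _
  have h1 := (hmem t a b x).2 (by
    rw [map_sub, map_mul, map_mul, map_natCast, map_natCast, ha', hb', mul_comm, sub_self])
  rw [h, hmem, map_sub, map_mul, map_mul, map_natCast, map_natCast, ha', hb', sub_eq_zero] at h1
  rw [map_mul, map_mul, h1]

lemma vecHaar_eq_zero_of_finite_translates {Z : Set (Fin m → ℤ_[p])} (hZ : MeasurableSet Z)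
    (v : Fin m → ℤ_[p]) (h : ∀ x, {k : ℕ | x + k • v ∈ Z}.Finite) : vecHaar p m Z = 0 := by
  have hc := (measurePreserving_add_right (vecHaar p m) v).conservative
  have := hc.ae_mem_imp_frequently_image_mem hZ.nullMeasurableSet
  rw [← compl_compl Z]
  refine this.mono fun x hx hxZ => ?_
  refine Nat.frequently_atTop_iff_infinite.1 (hx hxZ) ?_
  refine (h x).subset fun k hk => ?_
  have hit : ∀ k, (fun y => y + v)^[k] x = x + k • v := by
    intro k
    simp
  rw [Set.mem_ofPred_eq, hit] at hk
  exact hk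

lemma finite_quadratic_roots {a b c : ℤ_[p]} (h : a ≠ 0 ∨ b ≠ 0 ∨ c ≠ 0) :
    {k : ℕ | a * (k : ℤ_[p]) ^ 2 + b * k + c = 0}.Finite := by
  have hP : Polynomial.C a * Polynomial.X ^ 2 + Polynomial.C b * Polynomial.X + Polynomial.C c ≠ 0 := by
    intro h0
    have h2 := congrArg (fun P => Polynomial.coeff P 2) h0
    have h1 := congrArg (fun P => Polynomial.coeff P 1) h0
    have h00 := congrArg (fun P => Polynomial.coeff P 0) h0
    simp [Polynomial.coeff_X, Polynomial.coeff_C] at h2 h1 h00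
    tauto
  refine Set.Finite.of_finite_image (f := fun k : ℕ => (k : ℤ_[p]))
    ((Polynomial.finite_setOfPred_isRoot hP).subset ?_) Nat.cast_injective.injOn
  rintro _ ⟨k, hk, rfl⟩
  simpa [Polynomial.IsRoot] using hk

/-- The zero set of a nonzero binary quadratic form is null. -/
lemma vecHaar_quadratic_eq_zero {i j : Fin m} (hij : i ≠ j) {a b c : ℤ_[p]}
    (h : a ≠ 0 ∨ b ≠ 0 ∨ c ≠ 0) :
    vecHaar p m {x | a * x i ^ 2 + b * (x i * x j) + c * x j ^ 2 = 0} = 0 := by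
  have hm : ∀ a b c : ℤ_[p], MeasurableSet
      {x : Fin m → ℤ_[p] | a * x i ^ 2 + b * (x i * x j) + c * x j ^ 2 = 0} := fun a b c =>
    IsClosed.measurableSet (isClosed_eq (by fun_prop) continuous_const)
  have ha : ∀ a b c : ℤ_[p], a ≠ 0 →
      vecHaar p m {x | a * x i ^ 2 + b * (x i * x j) + c * x j ^ 2 = 0} = 0 := by
    intro a b c ha
    refine vecHaar_eq_zero_of_finite_translates (hm a b c) (Pi.single i 1) fun x => ?_
    refine (finite_quadratic_roots (a := a) (b := 2 * a * x i + b * x j)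
      (c := a * x i ^ 2 + b * (x i * x j) + c * x j ^ 2) (Or.inl ha)).subset fun k hk => ?_
    simp [Pi.single_eq_of_ne hij.symm] at hk
    rw [Set.mem_ofPred_eq, ← hk]
    ring
  have hc : ∀ a b c : ℤ_[p], c ≠ 0 →
      vecHaar p m {x | a * x i ^ 2 + b * (x i * x j) + c * x j ^ 2 = 0} = 0 := by
    intro a b c hc
    refine vecHaar_eq_zero_of_finite_translates (hm a b c) (Pi.single j 1) fun x => ?_
    refine (finite_quadratic_roots (a := c) (b := 2 * c * x j + b * x i)
      (c := a * x i ^ 2 + b * (x i * x j) + c * x j ^ 2) (Or.inl hc)).subset fun k hk => ?_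
    simp [Pi.single_eq_of_ne hij] at hk
    rw [Set.mem_ofPred_eq, ← hk]
    ring
  by_cases h1 : a = 0
  · by_cases h2 : c = 0
    · have hb : b ≠ 0 := by tauto
      refine measure_mono_null ?_ (measure_union_null (ha 1 0 0 one_ne_zero) (hc 0 0 1 one_ne_zero))
      intro x hx
      simp only [Set.mem_ofPred_eq, h1, h2, zero_mul, zero_add, add_zero, mul_eq_zero, hb,
        false_or] at hx
      rcases hx with hx | hx
      · left
        simp [hx]
      · right
        simp [hx]
    · exact hc a b c h2
  · exact ha a b c h1

end PadicGroups

section BlockEmbedding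

open MeasureTheory Filter Matrix
open scoped ENNReal Topology

variable {d m : ℕ}

/-- The embedding of `SL₂(ℤ)` as a diagonal block. -/
def sl2Emb (e : Fin 2 ⊕ Fin d ≃ Fin m) :
    SpecialLinearGroup (Fin 2) ℤ →* SpecialLinearGroup (Fin m) ℤ where
  toFun h := ⟨Matrix.reindex e e (Matrix.fromBlocks (SpecialLinearGroup.coeMonoidHom h) 0 0 1), by
    rw [Matrix.det_reindex_self, Matrix.det_fromBlocks_zero₂₁, Matrix.det_one, mul_one]
    exact h.2⟩
  map_one' := by
    apply SpecialLinearGroup.coeMonoidHom_injective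
    change Matrix.reindex e e _ = 1
    simp
  map_mul' := by
    intro g h
    apply SpecialLinearGroup.coeMonoidHom_injective
    change Matrix.reindex e e (Matrix.fromBlocks (SpecialLinearGroup.coeMonoidHom (g * h)) 0 0 1) =
      Matrix.reindex e e (Matrix.fromBlocks (SpecialLinearGroup.coeMonoidHom g) 0 0 1) *
        Matrix.reindex e e (Matrix.fromBlocks (SpecialLinearGroup.coeMonoidHom h) 0 0 1)
    rw [map_mul SpecialLinearGroup.coeMonoidHom, Matrix.reindex_apply, Matrix.reindex_apply,
      Matrix.reindex_apply, Matrix.submatrix_mul_equiv, Matrix.fromBlocks_multiply]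
    simp

lemma coe_sl2Emb (e : Fin 2 ⊕ Fin d ≃ Fin m) (h : SpecialLinearGroup (Fin 2) ℤ) :
    SpecialLinearGroup.coeMonoidHom (sl2Emb e h) =
      Matrix.reindex e e (Matrix.fromBlocks (SpecialLinearGroup.coeMonoidHom h) 0 0 1) := rfl

lemma sl2Emb_elemSL (e : Fin 2 ⊕ Fin d ≃ Fin m) {i j : Fin 2} (hij : i ≠ j) (a : ℤ) :
    sl2Emb e (elemSL i j a) = elemSL (e (Sum.inl i)) (e (Sum.inl j)) a := by
  have hij' : e (Sum.inl i) ≠ e (Sum.inl j) := fun h => hij (Sum.inl_injective (e.injective h))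
  apply SpecialLinearGroup.coeMonoidHom_injective
  rw [coe_sl2Emb, elemSL_coe hij, elemSL_coe hij']
  ext k l
  obtain ⟨k, rfl⟩ := e.surjective k
  obtain ⟨l, rfl⟩ := e.surjective l
  rcases k with k | k <;> rcases l with l | l <;>
    simp [Matrix.one_apply, Matrix.single_apply]

variable {p : ℕ} [Fact p.Prime]

lemma vecAct_sl2Emb_apply (e : Fin 2 ⊕ Fin d ≃ Fin m) (h : SpecialLinearGroup (Fin 2) ℤ)
    (x : Fin m → ℤ_[p]) (i : Fin 2) : vecAct (sl2Emb e h) x (e (Sum.inl i)) =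
      ((SpecialLinearGroup.coeMonoidHom h i 0 : ℤ) : ℤ_[p]) * x (e (Sum.inl 0)) +
        ((SpecialLinearGroup.coeMonoidHom h i 1 : ℤ) : ℤ_[p]) * x (e (Sum.inl 1)) := by
  rw [vecAct, coe_sl2Emb, Matrix.mulVec, dotProduct, ← e.sum_comp, Fintype.sum_sum_type]
  simp [Fin.sum_univ_two]

lemma sl2_eq_or_eq_neg {h h' : SpecialLinearGroup (Fin 2) ℤ}
    {a b c d a' b' c' d' : ℤ} (ha : SpecialLinearGroup.coeMonoidHom h = !![a, b; c, d])
    (ha' : SpecialLinearGroup.coeMonoidHom h' = !![a', b'; c', d'])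
    (h1 : a * c' - c * a' = 0) (h2 : a * d' + b * c' - c * b' - d * a' = 0)
    (h3 : b * d' - d * b' = 0) : h' = h ∨ h' = -1 * h := by
  have hd : a * d - b * c = 1 := by
    have := h.2
    rw [show (h : Matrix (Fin 2) (Fin 2) ℤ) = !![a, b; c, d] from ha, Matrix.det_fin_two_of] at this
    exact this
  have hd' : a' * d' - b' * c' = 1 := by
    have := h'.2
    rw [show (h' : Matrix (Fin 2) (Fin 2) ℤ) = !![a', b'; c', d'] from ha',
      Matrix.det_fin_two_of] at this
    exact this
  set g := d * a' - b * c' with hg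
  have e1 : a' = g * a := by rw [hg]; linear_combination (-a') * hd + b * h1
  have e2 : c' = g * c := by rw [hg]; linear_combination (-c') * hd + d * h1
  have e3 : b' = g * b := by rw [hg]; linear_combination (-b') * hd + b * h2 - a * h3
  have e4 : d' = g * d := by rw [hg]; linear_combination (-d') * hd + d * h2 - c * h3
  have hg2 : g * g = 1 := by
    rw [e1, e2, e3, e4] at hd'
    linear_combination hd' - g * g * hd
  rcases mul_self_eq_one_iff.1 hg2 with hg1 | hg1
  · left
    apply SpecialLinearGroup.coeMonoidHom_injective
    rw [ha, ha', e1, e2, e3, e4, hg1]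
    simp
  · right
    apply SpecialLinearGroup.coeMonoidHom_injective
    have hneg : SpecialLinearGroup.coeMonoidHom (-1 : SpecialLinearGroup (Fin 2) ℤ) = -1 := by
      change ((-1 : SpecialLinearGroup (Fin 2) ℤ) : Matrix (Fin 2) (Fin 2) ℤ) = -1
      simp
    rw [map_mul, ha, ha', e1, e2, e3, e4, hg1, hneg]
    simp

lemma ae_padGroup_free (e : Fin 2 ⊕ Fin d ≃ Fin m) :
    ∀ᵐ x ∂vecHaar p m, ∀ h h' : SpecialLinearGroup (Fin 2) ℤ,
      padGroup (vecAct (sl2Emb e h) x) = padGroup (vecAct (sl2Emb e h') x) →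
        h' = h ∨ h' = -1 * h := by
  have : Countable (Matrix (Fin 2) (Fin 2) ℤ) := inferInstanceAs (Countable (Fin 2 → Fin 2 → ℤ))
  have : Countable (SpecialLinearGroup (Fin 2) ℤ) :=
    SpecialLinearGroup.coeMonoidHom_injective.countable
  rw [ae_all_iff]
  intro h
  rw [ae_all_iff]
  intro h'
  by_cases hh : h' = h ∨ h' = -1 * h
  · exact Eventually.of_forall fun _ _ => hh
  have hij : e (Sum.inl 0) ≠ e (Sum.inl 1) := fun h => by simpa using e.injective h
  have key := fun (x : Fin m → ℤ_[p]) (heq : padGroup (vecAct (sl2Emb e h) x) =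
    padGroup (vecAct (sl2Emb e h') x)) =>
      mul_eq_mul_of_padGroup_eq heq (e (Sum.inl 0)) (e (Sum.inl 1))
  simp only [vecAct_sl2Emb_apply] at key
  have hM := Matrix.eta_fin_two (SpecialLinearGroup.coeMonoidHom h)
  have hM' := Matrix.eta_fin_two (SpecialLinearGroup.coeMonoidHom h')
  set a := SpecialLinearGroup.coeMonoidHom h 0 0
  set b := SpecialLinearGroup.coeMonoidHom h 0 1
  set c := SpecialLinearGroup.coeMonoidHom h 1 0
  set d := SpecialLinearGroup.coeMonoidHom h 1 1
  set a' := SpecialLinearGroup.coeMonoidHom h' 0 0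
  set b' := SpecialLinearGroup.coeMonoidHom h' 0 1
  set c' := SpecialLinearGroup.coeMonoidHom h' 1 0
  set d' := SpecialLinearGroup.coeMonoidHom h' 1 1
  have hne : ((a * c' - c * a' : ℤ) : ℤ_[p]) ≠ 0 ∨
      ((a * d' + b * c' - c * b' - d * a' : ℤ) : ℤ_[p]) ≠ 0 ∨
      ((b * d' - d * b' : ℤ) : ℤ_[p]) ≠ 0 := by
    by_contra! hcon
    obtain ⟨h1, h2, h3⟩ := hcon
    exact hh (sl2_eq_or_eq_neg hM hM' (by exact_mod_cast h1) (by exact_mod_cast h2)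
      (by exact_mod_cast h3))
  refine measure_mono_null (fun x hx => ?_) (vecHaar_quadratic_eq_zero hij hne)
  by_contra hx0
  refine hx fun heq => absurd ?_ hx0
  have h1 := key x heq
  rw [Set.mem_ofPred_eq]
  push_cast
  linear_combination -h1

end BlockEmbedding

section BottomRow

open MeasureTheory Filter Matrix
open scoped ENNReal Topology

lemma coe_mul_elemSL (h : SpecialLinearGroup (Fin 2) ℤ) {i j : Fin 2} (hij : i ≠ j) (t : ℤ) :
    SpecialLinearGroup.coeMonoidHom (h * (elemSL i j t)⁻¹) =
      SpecialLinearGroup.coeMonoidHom h * (1 + Matrix.single i j (-t)) := by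
  rw [elemSL_inv hij, map_mul, elemSL_coe hij]

lemma bottom_row_mul_lower (h : SpecialLinearGroup (Fin 2) ℤ) (t : ℤ) :
    SpecialLinearGroup.coeMonoidHom (h * (elemSL 1 0 t)⁻¹) 1 0 =
        SpecialLinearGroup.coeMonoidHom h 1 0 - t * SpecialLinearGroup.coeMonoidHom h 1 1 ∧
      SpecialLinearGroup.coeMonoidHom (h * (elemSL 1 0 t)⁻¹) 1 1 =
        SpecialLinearGroup.coeMonoidHom h 1 1 := by
  rw [coe_mul_elemSL h (by decide)]
  constructor
  · simp [Matrix.mul_apply, Fin.sum_univ_two, Matrix.single_apply, Matrix.one_apply]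
    ring
  · simp [Matrix.mul_apply, Matrix.one_apply]

lemma bottom_row_mul_upper (h : SpecialLinearGroup (Fin 2) ℤ) (t : ℤ) :
    SpecialLinearGroup.coeMonoidHom (h * (elemSL 0 1 t)⁻¹) 1 1 =
        SpecialLinearGroup.coeMonoidHom h 1 1 - t * SpecialLinearGroup.coeMonoidHom h 1 0 ∧
      SpecialLinearGroup.coeMonoidHom (h * (elemSL 0 1 t)⁻¹) 1 0 =
        SpecialLinearGroup.coeMonoidHom h 1 0 := by
  rw [coe_mul_elemSL h (by decide)]
  constructor
  · simp [Matrix.mul_apply, Fin.sum_univ_two, Matrix.single_apply, Matrix.one_apply]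
    ring
  · simp [Matrix.mul_apply, Matrix.one_apply]

lemma bottom_row_ne_zero (h : SpecialLinearGroup (Fin 2) ℤ)
    (h0 : SpecialLinearGroup.coeMonoidHom h 1 0 = 0) :
    SpecialLinearGroup.coeMonoidHom h 1 1 ≠ 0 := by
  intro h1
  have hdet : (SpecialLinearGroup.coeMonoidHom h).det = 1 := h.2
  rw [Matrix.det_fin_two, h0, h1] at hdet
  simp at hdet

lemma eq_of_abs_sub_mul_le {c d : ℤ} (hd : d ≠ 0) {N a b : ℕ} (hN : 0 < N)
    (ha : |c - ((N * (3 * a : ℕ) : ℕ) : ℤ) * d| ≤ |d|)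
    (hb : |c - ((N * (3 * b : ℕ) : ℕ) : ℤ) * d| ≤ |d|) : a = b := by
  by_contra hab
  have h1 : |(((N * (3 * a : ℕ) : ℕ) : ℤ) - ((N * (3 * b : ℕ) : ℕ) : ℤ)) * d| ≤ 2 * |d| := by
    have := abs_sub (c - ((N * (3 * b : ℕ) : ℕ) : ℤ) * d) (c - ((N * (3 * a : ℕ) : ℕ) : ℤ) * d)
    rw [show c - ((N * (3 * b : ℕ) : ℕ) : ℤ) * d - (c - ((N * (3 * a : ℕ) : ℕ) : ℤ) * d) =
      (((N * (3 * a : ℕ) : ℕ) : ℤ) - ((N * (3 * b : ℕ) : ℕ) : ℤ)) * d by ring] at this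
    linarith
  rw [abs_mul] at h1
  have hd0 : 0 < |d| := abs_pos.2 hd
  have h2 := le_of_mul_le_mul_right h1 hd0
  have h3 : (((N * (3 * a : ℕ) : ℕ) : ℤ) - ((N * (3 * b : ℕ) : ℕ) : ℤ)) =
      N * (3 * ((a : ℤ) - b)) := by push_cast; ring
  rw [h3, abs_mul, abs_mul] at h2
  have h4 : 1 ≤ |(a : ℤ) - b| := Int.one_le_abs (by omega)
  have h5 : 1 ≤ |(N : ℤ)| := Int.one_le_abs (by omega)
  norm_num at h2 h5
  nlinarith

end BottomRow

section Core

open MeasureTheory Filter Matrix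
open scoped ENNReal Topology

variable {n p : ℕ} [Fact p.Prime]

/-- There is no measurable reduction from the groups `padGroup x ⊆ ℚⁿ⁺¹` to subgroups of `ℚⁿ`. -/
theorem not_measurable_reduction_padGroup (hn : 1 ≤ n)
    {f : (Fin (n + 1) → ℤ_[p]) → AddSubgroup (Fin n → ℚ)} (hf : MeasFam f)
    (hfull : ∀ x, FullRank (f x))
    (hred : ∀ x y, Nonempty (padGroup x ≃+ padGroup y) ↔ Nonempty (f x ≃+ f y)) : False := by
  have hfT : ∀ (γ : SpecialLinearGroup (Fin (n + 1)) ℤ) (x : Fin (n + 1) → ℤ_[p]),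
      ∃ g : (Matrix (Fin n) (Fin n) ℚ)ˣ, (f x).map (matHom g) = f (vecAct γ x) := by
    intro γ x
    obtain ⟨g, hg⟩ := exists_map_padGroup_vecAct γ x
    obtain ⟨e⟩ := nonempty_addEquiv_map g (padGroup (vecAct γ x))
    rw [hg] at e
    obtain ⟨e'⟩ := (hred x (vecAct γ x)).1 ⟨e.symm⟩
    exact exists_map_eq_of_addEquiv (hfull _) (hfull _) e'
  have hμ0 : vecHaar p (n + 1) ≠ 0 := IsProbabilityMeasure.ne_zero _
  obtain ⟨S, C, F, w, hC, hC0, hCT, hF, hFf, hw, hwc, hwF⟩ :=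
    exists_lattice_cocycle hμ0 vecAct_one vecAct_mul
      (fun γ => (measurePreserving_vecAct γ).measurable) hf hfT
  have hFfull : ∀ x, FullRank (F x) := fun x => by
    obtain ⟨g, hg⟩ := hFf x
    rw [hg]
    exact (hfull x).map g
  have hFiso : ∀ x, Nonempty (f x ≃+ F x) := fun x => by
    obtain ⟨g, hg⟩ := hFf x
    rw [hg]
    exact nonempty_addEquiv_map g _
  set μ := (vecHaar p (n + 1)).restrict C with hμ
  have hμC : ∀ᵐ x ∂μ, x ∈ C := ae_restrict_mem hC
  have hTμ : ∀ γ, MeasurePreserving (vecAct (p := p) γ) μ μ := fun γ => by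
    have := (measurePreserving_vecAct (p := p) γ).restrict_preimage hC
    rwa [show vecAct γ ⁻¹' C = C from Set.ext fun x => hCT γ x] at this
  obtain ⟨k, b, M, hM, hb0, hsmall⟩ := exists_fibre_root_subgroups_near_one (μ := μ)
    (N := algNormalizer S) (S := S) (Λ := AlgOut S) (T := vecAct)
    (c := fun k => vecMod (p := p) (m := n + 1) k) (w := w) hn
    (fun g hg s hs => (mem_algNormalizer.1 hg s).2 hs) (QuotientGroup.mk' (algUnits S))
    (QuotientGroup.mk'_surjective _) (fun g => by
      rw [QuotientGroup.mk'_apply, QuotientGroup.eq_one_iff]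
      exact Iff.rfl)
    (fun h => hC0 (Measure.restrict_eq_zero.1 h))
    (fun k i => (isOpen_vecMod_preimage k {i}).measurableSet)
    (fun k i => (mul_le_mul_right (Measure.restrict_apply_le _ _) _).trans
      (card_mul_vecHaar_fibre k i))
    (approximatedBy_vecMod μ) vecAct_one vecAct_mul hTμ
    (fun k γ x y h => vecMod_vecAct_congr k γ h) hw hwc (q := fun k => p ^ k)
    (fun k => pow_ne_zero _ (Fact.out : p.Prime).ne_zero)
    (fun k i j hij a x => vecMod_vecAct_elemSL k hij a x)
    (κ := 1 / 40) (by norm_num) (by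
      rw [mul_one_div]
      exact ENNReal.div_lt_of_lt_mul (by norm_num))
  have : Countable (Matrix (Fin 2) (Fin 2) ℤ) := inferInstanceAs (Countable (Fin 2 → Fin 2 → ℤ))
  have : Countable (SpecialLinearGroup (Fin 2) ℤ) :=
    SpecialLinearGroup.coeMonoidHom_injective.countable
  let e : Fin 2 ⊕ Fin (n - 1) ≃ Fin (n + 1) :=
    finSumFinEquiv.trans (finCongr (by omega))
  let Θ : ℕ → (Fin (n + 1) → ℤ_[p]) → (Fin n → ℚ) → Prop :=
    fun k x v => v ∈ F x ⊔ facLattice n k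
  have hΘiff : ∀ k x y, Θ k x = Θ k y ↔ F x ⊔ facLattice n k = F y ⊔ facLattice n k := by
    intro k x y
    refine ⟨fun h => ?_, fun h => ?_⟩
    · ext v
      exact iff_of_eq (congrFun h v)
    · funext v
      exact congrArg (fun A : AddSubgroup (Fin n → ℚ) => v ∈ A) h
  let N := p ^ k * M
  have hN : 0 < N := Nat.mul_pos (pow_pos (Fact.out : p.Prime).pos _) hM
  let u : Fin 2 → Fin 2 → Fin 5 → SpecialLinearGroup (Fin 2) ℤ :=
    fun i j a => elemSL i j ((N * (3 * a : ℕ) : ℕ) : ℤ)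
  have huY : ∀ i j, i ≠ j → ∀ a x, vecAct (p := p) (sl2Emb e (u i j a)) x ∈ vecMod k ⁻¹' {b} ↔
      x ∈ vecMod k ⁻¹' {b} := by
    intro i j hij a x
    have hij' : e (Sum.inl i) ≠ e (Sum.inl j) := fun h => hij (Sum.inl_injective (e.injective h))
    have h1 := vecMod_vecAct_elemSL (p := p) k hij' ((M * (3 * a : ℕ) : ℕ) : ℤ) x
    rw [← Nat.cast_mul, ← mul_assoc, ← sl2Emb_elemSL e hij] at h1
    rw [Set.mem_preimage, Set.mem_preimage, h1]
  have huε : ∀ i j, i ≠ j → ∀ a, μ {x | x ∈ vecMod k ⁻¹' {b} ∧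
      ∀ l, Θ l (vecAct (sl2Emb e (u i j a)) x) ≠ Θ l x} ≤ μ (vecMod k ⁻¹' {b}) / 40 := by
    intro i j hij a
    have hij' : e (Sum.inl i) ≠ e (Sum.inl j) := fun h => hij (Sum.inl_injective (e.injective h))
    have h1 := hsmall _ _ hij' (3 * a)
    rw [one_div, mul_comm (40⁻¹ : ℝ≥0∞), ← div_eq_mul_inv, ← Nat.cast_mul, ← Nat.cast_mul,
      ← sl2Emb_elemSL e hij] at h1
    refine (measure_mono_ae ?_).trans h1
    filter_upwards [hμC] with x hxC hx
    refine ⟨hx.1, fun hw1 => ?_⟩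
    obtain ⟨l, hl⟩ := hwF _ x hxC hw1
    exact hx.2 l ((hΘiff _ _ _).2 hl)
  refine false_of_almost_invariant μ (H := SpecialLinearGroup (Fin 2) ℤ)
    (T := fun h x => vecAct (sl2Emb e h) x) (Θ := Θ)
    (L := fun x v => v ∈ padGroup x) (Y := vecMod k ⁻¹' {b})
    (A := {h | |SpecialLinearGroup.coeMonoidHom h 1 0| ≤ |SpecialLinearGroup.coeMonoidHom h 1 1| ∧
      SpecialLinearGroup.coeMonoidHom h 1 1 ≠ 0})
    (A' := {h | |SpecialLinearGroup.coeMonoidHom h 1 1| ≤ |SpecialLinearGroup.coeMonoidHom h 1 0| ∧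
      SpecialLinearGroup.coeMonoidHom h 1 0 ≠ 0})
    (u := u 1 0) (u' := u 0 1)
    (fun x => by simp only [map_one, vecAct_one])
    (fun g h x => by simp only [map_mul, vecAct_mul])
    (fun h => hTμ _) (fun l => measurable_pi_iff.2 fun v => ?_) (fun l x y h => ?_)
    (measurable_pi_iff.2 fun v => measFam_padGroup v) (fun l x => ?_) (-1)
    (ae_restrict_of_ae ?_) (isOpen_vecMod_preimage k {b}).measurableSet hb0
    (fun h => ?_) (huY 1 0 (by decide)) (huY 0 1 (by decide)) (fun h i j hi hj => ?_)
    (fun h i j hi hj => ?_) (huε 1 0 (by decide)) (huε 0 1 (by decide))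
  · exact hF.sup _ v
  · exact (hΘiff _ _ _).2 (sup_facLattice_eq_of_le (Nat.le_succ l) ((hΘiff _ _ _).1 h))
  · refine ⟨⋃ B ∈ {B | FullRank B ∧ B ⊔ facLattice n l = F x ⊔ facLattice n l},
      {ℓ | ∃ y, Nonempty (F y ≃+ B) ∧ (fun v => v ∈ padGroup y) = ℓ},
      (countable_sup_facLattice_fibre l _).biUnion fun B _ => ?_, fun y hy => ?_⟩
    · by_cases hB : ∃ y₀, Nonempty (F y₀ ≃+ B)
      · obtain ⟨y₀, ⟨e₀⟩⟩ := hB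
        refine ((countable_isomorphic (fullRank_padGroup y₀)).image
          fun (A : AddSubgroup _) v => v ∈ A).mono ?_
        rintro ℓ ⟨y, ⟨e₁⟩, rfl⟩
        obtain ⟨e₂⟩ := hFiso y₀
        obtain ⟨e₃⟩ := hFiso y
        exact ⟨padGroup y, ⟨fullRank_padGroup y, (hred y₀ y).2
          ⟨((e₂.trans e₀).trans e₁.symm).trans e₃.symm⟩⟩, rfl⟩
      · refine Set.countable_empty.mono ?_
        rintro ℓ ⟨y, hy, -⟩
        exact hB ⟨y, hy⟩
    · exact Set.mem_biUnion ⟨hFfull y, (hΘiff _ _ _).1 hy⟩ ⟨y, ⟨AddEquiv.refl _⟩, rfl⟩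
  · filter_upwards [ae_padGroup_free (p := p) e] with x hx h h' heq
    refine hx h h' ?_
    ext v
    exact iff_of_eq (congrFun heq v)
  · rcases le_total |SpecialLinearGroup.coeMonoidHom h 1 0|
      |SpecialLinearGroup.coeMonoidHom h 1 1| with hle | hle
    · exact Or.inl ⟨hle, fun h0 => by
        rw [h0, abs_zero] at hle
        exact bottom_row_ne_zero h (abs_nonpos_iff.1 hle) h0⟩
    · exact Or.inr ⟨hle, fun h0 => by
        rw [h0, abs_zero] at hle
        exact bottom_row_ne_zero h h0 (abs_nonpos_iff.1 hle)⟩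
  · obtain ⟨hi1, hi2⟩ := hi
    obtain ⟨hj1, -⟩ := hj
    rw [(bottom_row_mul_lower h _).1, (bottom_row_mul_lower h _).2] at hi1 hj1
    rw [(bottom_row_mul_lower h _).2] at hi2
    exact Fin.ext (eq_of_abs_sub_mul_le hi2 hN hi1 hj1)
  · obtain ⟨hi1, hi2⟩ := hi
    obtain ⟨hj1, -⟩ := hj
    rw [(bottom_row_mul_upper h _).1, (bottom_row_mul_upper h _).2] at hi1 hj1
    rw [(bottom_row_mul_upper h _).2] at hi2
    exact Fin.ext (eq_of_abs_sub_mul_le hi2 hN hi1 hj1)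

end Core

section Cancellation

variable {A B : Type*} [AddCommGroup A] [AddCommGroup B]

/-- A group with a nonzero homomorphism to `ℤ` splits off a copy of `ℤ`. -/
lemma nonempty_addEquiv_ker_prod_int (f : A →+ ℤ) (hf : f ≠ 0) :
    Nonempty (f.ker × ℤ ≃+ A) := by
  obtain ⟨d, hd⟩ := Int.subgroup_cyclic f.range
  rw [← AddSubgroup.zmultiples_eq_closure] at hd
  obtain ⟨a, ha⟩ : d ∈ f.range := hd ▸ AddSubgroup.mem_zmultiples d
  have hd0 : d ≠ 0 := by
    rintro rfl
    refine hf (AddMonoidHom.range_eq_bot_iff.1 ?_)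
    rw [hd, AddSubgroup.zmultiples_zero_eq_bot]
  let F : f.ker × ℤ →+ A := f.ker.subtype.coprod (zmultiplesHom A a)
  have hF : ∀ k z, F (k, z) = k + z • a := fun k z => by simp [F]
  refine ⟨AddEquiv.ofBijective F ⟨(injective_iff_map_eq_zero F).2 ?_, fun x => ?_⟩⟩
  · rintro ⟨k, z⟩ h
    rw [hF] at h
    have hz : z * d = 0 := by
      have := congrArg f h
      simpa [ha, AddMonoidHom.mem_ker.1 k.2] using this
    obtain rfl : z = 0 := (mul_eq_zero.1 hz).resolve_right hd0
    have hk : k = 0 := Subtype.ext (by simpa using h)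
    rw [hk]
    rfl
  · obtain ⟨z, hz⟩ := AddSubgroup.mem_zmultiples_iff.1
      (hd ▸ (⟨x, rfl⟩ : f x ∈ f.range) : f x ∈ AddSubgroup.zmultiples d)
    refine ⟨(⟨x - z • a, ?_⟩, z), ?_⟩
    · rw [AddMonoidHom.mem_ker, map_sub, map_zsmul, ha, hz, sub_self]
    · rw [hF]
      simp

/-- The second component of an isomorphism `A × ℤ ≃+ B × ℤ` on the first factor. -/
def crossHom (e : A × ℤ ≃+ B × ℤ) : A →+ ℤ :=
  (AddMonoidHom.snd B ℤ).comp (e.toAddMonoidHom.comp (AddMonoidHom.inl A ℤ))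

lemma crossHom_apply (e : A × ℤ ≃+ B × ℤ) (a : A) : crossHom e a = (e (a, 0)).2 := rfl

lemma crossHom_symm_eq_zero (e : A × ℤ ≃+ B × ℤ) (h : crossHom e = 0) : crossHom e.symm = 0 := by
  ext b
  change crossHom e.symm b = 0
  set m := crossHom e.symm b with hm
  set k := (e.symm (0, 1)).2 with hk
  have h1 : (e.symm (m • ((0 : B), (1 : ℤ)) - k • (b, (0 : ℤ)))).2 = 0 := by
    rw [map_sub, map_zsmul, map_zsmul, Prod.snd_sub, Prod.smul_snd, Prod.smul_snd, ← hk,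
      ← crossHom_apply, ← hm]
    simp [mul_comm]
  have h2 := DFunLike.congr_fun h (e.symm (m • ((0 : B), (1 : ℤ)) - k • (b, (0 : ℤ)))).1
  rw [crossHom_apply, show ((e.symm (m • ((0 : B), (1 : ℤ)) - k • (b, (0 : ℤ)))).1, (0 : ℤ)) =
    e.symm (m • ((0 : B), (1 : ℤ)) - k • (b, (0 : ℤ))) from Prod.ext rfl h1.symm,
    e.apply_symm_apply] at h2
  simpa using h2

lemma symm_apply_of_mem_ker_crossHom (e : A × ℤ ≃+ B × ℤ) {a : A} (ha : a ∈ (crossHom e).ker) :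
    e.symm ((e (a, 0)).1, 0) = (a, 0) := by
  rw [AddMonoidHom.mem_ker, crossHom_apply] at ha
  rw [show ((e (a, 0)).1, (0 : ℤ)) = e (a, 0) from Prod.ext rfl ha.symm, e.symm_apply_apply]

/-- The kernels of the two cross homomorphisms are isomorphic. -/
lemma nonempty_addEquiv_ker_crossHom (e : A × ℤ ≃+ B × ℤ) :
    Nonempty ((crossHom e).ker ≃+ (crossHom e.symm).ker) := by
  refine ⟨{
    toFun := fun a => ⟨(e (a, 0)).1, by
      rw [AddMonoidHom.mem_ker, crossHom_apply, symm_apply_of_mem_ker_crossHom e a.2]⟩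
    invFun := fun b => ⟨(e.symm (b, 0)).1, by
      have := symm_apply_of_mem_ker_crossHom e.symm b.2
      rw [e.symm_symm] at this
      rw [AddMonoidHom.mem_ker, crossHom_apply, this]⟩
    left_inv := fun a => Subtype.ext (by
      change (e.symm ((e (a, 0)).1, 0)).1 = a
      rw [symm_apply_of_mem_ker_crossHom e a.2])
    right_inv := fun b => Subtype.ext (by
      have := symm_apply_of_mem_ker_crossHom e.symm b.2
      rw [e.symm_symm] at this
      change (e ((e.symm (b, 0)).1, 0)).1 = b
      rw [this])
    map_add' := fun a a' => Subtype.ext (by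
      change (e ((a : A) + a', 0)).1 = (e (a, 0)).1 + (e (a', 0)).1
      rw [← Prod.fst_add, ← map_add, Prod.mk_add_mk, add_zero]) }⟩

/-- The group `ℤ` cancels from direct sums. -/
theorem nonempty_addEquiv_of_prod_int (e : A × ℤ ≃+ B × ℤ) : Nonempty (A ≃+ B) := by
  obtain ⟨k⟩ := nonempty_addEquiv_ker_crossHom e
  by_cases h : crossHom e = 0
  · have h' := crossHom_symm_eq_zero e h
    rw [h, h', AddMonoidHom.ker_zero, AddMonoidHom.ker_zero] at k
    exact ⟨(AddSubgroup.topEquiv.symm.trans k).trans AddSubgroup.topEquiv⟩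
  · have h' : crossHom e.symm ≠ 0 := fun h0 => h (crossHom_symm_eq_zero e.symm h0)
    obtain ⟨i⟩ := nonempty_addEquiv_ker_prod_int _ h
    obtain ⟨j⟩ := nonempty_addEquiv_ker_prod_int _ h'
    exact ⟨(i.symm.trans (k.prodCongr (AddEquiv.refl ℤ))).trans j⟩

end Cancellation

section Suspension

variable {n : ℕ}

/-- The subgroup `A ⊕ ℤ` of `ℚⁿ⁺¹`. -/
def prodInt (A : AddSubgroup (Fin n → ℚ)) : AddSubgroup (Fin (n + 1) → ℚ) where
  carrier := {v | Fin.init v ∈ A ∧ ∃ z : ℤ, v (Fin.last n) = z}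
  zero_mem' := ⟨A.zero_mem, 0, by simp⟩
  add_mem' := by
    rintro v w ⟨hv, y, hy⟩ ⟨hw, z, hz⟩
    exact ⟨A.add_mem hv hw, y + z, by rw [Pi.add_apply, hy, hz, Int.cast_add]⟩
  neg_mem' := by
    rintro v ⟨hv, y, hy⟩
    exact ⟨A.neg_mem hv, -y, by rw [Pi.neg_apply, hy, Int.cast_neg]⟩

lemma mem_prodInt {A : AddSubgroup (Fin n → ℚ)} {v : Fin (n + 1) → ℚ} :
    v ∈ prodInt A ↔ Fin.init v ∈ A ∧ ∃ z : ℤ, v (Fin.last n) = z := Iff.rfl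

lemma snoc_mem_prodInt {A : AddSubgroup (Fin n → ℚ)} {v : Fin n → ℚ} (hv : v ∈ A) (z : ℤ) :
    (Fin.snoc v (z : ℚ) : Fin (n + 1) → ℚ) ∈ prodInt A := by
  rw [mem_prodInt, Fin.init_snoc, Fin.snoc_last]
  exact ⟨hv, z, rfl⟩

lemma nonempty_prod_int_addEquiv_prodInt (A : AddSubgroup (Fin n → ℚ)) :
    Nonempty (A × ℤ ≃+ prodInt A) := by
  let F : A × ℤ →+ prodInt A := AddMonoidHom.mk'
    (fun a => ⟨Fin.snoc (a.1 : Fin n → ℚ) (a.2 : ℚ), snoc_mem_prodInt a.1.2 a.2⟩) (by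
      rintro ⟨a, y⟩ ⟨b, z⟩
      refine Subtype.ext (funext fun i => ?_)
      refine Fin.lastCases ?_ (fun i => ?_) i <;> simp)
  refine ⟨AddEquiv.ofBijective F ⟨?_, ?_⟩⟩
  · rintro ⟨a, y⟩ ⟨b, z⟩ h
    have h' : (Fin.snoc (a : Fin n → ℚ) (y : ℚ) : Fin (n + 1) → ℚ) = Fin.snoc (b : Fin n → ℚ) (z : ℚ) :=
      congrArg Subtype.val h
    obtain ⟨h1, h2⟩ := Fin.snoc_inj.1 h'
    exact Prod.ext (Subtype.ext h1) (by exact_mod_cast h2)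
  · rintro ⟨v, hv, z, hz⟩
    exact ⟨(⟨Fin.init v, hv⟩, z), Subtype.ext (by
      change Fin.snoc (Fin.init v) (z : ℚ) = v
      rw [← hz, Fin.snoc_init_self])⟩

lemma FullRank.prodInt {A : AddSubgroup (Fin n → ℚ)} (hA : FullRank A) : FullRank (prodInt A) := by
  obtain ⟨b, hb, hlin⟩ := hA
  refine ⟨Fin.snoc (fun i => Fin.snoc (b i) 0) (Fin.snoc 0 1), fun i => ?_, ?_⟩
  · refine Fin.lastCases ?_ (fun i => ?_) i
    · rw [Fin.snoc_last]
      exact_mod_cast snoc_mem_prodInt A.zero_mem 1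
    · rw [Fin.snoc_castSucc]
      exact_mod_cast snoc_mem_prodInt (hb i) 0
  · rw [Fintype.linearIndependent_iff] at hlin ⊢
    intro g hg
    rw [Fin.sum_univ_castSucc] at hg
    simp only [Fin.snoc_castSucc, Fin.snoc_last] at hg
    have hlast : g (Fin.last n) = 0 := by
      have := congrFun hg (Fin.last n)
      simpa using this
    have hinit := hlin (fun i => g i.castSucc) (by
      funext j
      have := congrFun hg j.castSucc
      simpa [hlast] using this)
    exact fun i => Fin.lastCases hlast hinit i

lemma nonempty_addEquiv_prodInt_iff (A B : AddSubgroup (Fin n → ℚ)) :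
    Nonempty (prodInt A ≃+ prodInt B) ↔ Nonempty (A ≃+ B) := by
  obtain ⟨i⟩ := nonempty_prod_int_addEquiv_prodInt A
  obtain ⟨j⟩ := nonempty_prod_int_addEquiv_prodInt B
  refine ⟨fun ⟨e⟩ => nonempty_addEquiv_of_prod_int ((i.trans e).trans j.symm), fun ⟨e⟩ => ?_⟩
  exact ⟨(i.symm.trans (e.prodCongr (AddEquiv.refl ℤ))).trans j⟩

end Suspension

section Codes

variable {n : ℕ}

lemma CodesSubgroupN.eq {χ : (Fin n → ℚ) → Bool} {H H' : AddSubgroup (Fin n → ℚ)}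
    (h : CodesSubgroupN n χ H) (h' : CodesSubgroupN n χ H') : H = H' := by
  ext v
  rw [← h v, h' v]

lemma isoN_iff {χ χ' : (Fin n → ℚ) → Bool} {H H' : AddSubgroup (Fin n → ℚ)}
    (h : CodesSubgroupN n χ H) (h' : CodesSubgroupN n χ' H') :
    IsoN n χ χ' ↔ Nonempty (H ≃+ H') := by
  refine ⟨?_, fun e => ⟨H, H', h, h', e⟩⟩
  rintro ⟨K, K', hK, hK', e⟩
  rwa [h.eq hK, h'.eq hK']

end Codes

open Classical in
/-- Isomorphism in rank `n` reduces to isomorphism in rank `n + 1` via `A ↦ A ⊕ ℤ`. -/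
theorem exists_measurable_reduction_succ (n : ℕ) : ∃ φ : GN n → GN (n + 1), Measurable φ ∧
    ∀ χ χ' : GN n, IsoN n χ χ' ↔ IsoN (n + 1) (φ χ) (φ χ') := by
  have hcode : ∀ (χ : (Fin n → ℚ) → Bool) (H : AddSubgroup (Fin n → ℚ)), CodesSubgroupN n χ H →
      CodesSubgroupN (n + 1)
        (fun v => χ (Fin.init v) && decide (∃ z : ℤ, v (Fin.last n) = z)) (prodInt H) := by
    intro χ H h v
    rw [Bool.and_eq_true, h, decide_eq_true_iff, mem_prodInt]
  refine ⟨fun χ => ⟨fun v => χ.1 (Fin.init v) && decide (∃ z : ℤ, v (Fin.last n) = z), ?_⟩, ?_, ?_⟩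
  · obtain ⟨H, hH, hr⟩ := χ.2
    exact ⟨prodInt H, hcode _ H hH, FullRank.prodInt hr⟩
  · refine Measurable.subtype_mk (measurable_pi_iff.2 fun v => ?_)
    exact (measurable_of_countable (fun c : Bool => c && decide (∃ z : ℤ, v (Fin.last n) = z))).comp
      ((measurable_pi_apply (Fin.init v)).comp measurable_subtype_coe)
  · intro χ χ'
    obtain ⟨H, hH, -⟩ := χ.2
    obtain ⟨H', hH', -⟩ := χ'.2
    rw [isoN_iff hH hH', isoN_iff (hcode _ _ hH) (hcode _ _ hH'), nonempty_addEquiv_prodInt_iff]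

open Classical in
/-- Isomorphism in rank `n + 1` does not reduce to isomorphism in rank `n`. -/
theorem not_exists_measurable_reduction_pred {n : ℕ} (hn : 1 ≤ n) :
    ¬ ∃ ψ : GN (n + 1) → GN n, Measurable ψ ∧
      ∀ χ χ' : GN (n + 1), IsoN (n + 1) χ χ' ↔ IsoN n (ψ χ) (ψ χ') := by
  rintro ⟨ψ, hψ, hred⟩
  have hcode : ∀ x : Fin (n + 1) → ℤ_[2], CodesSubgroupN (n + 1)
      (fun v => decide (v ∈ padGroup x)) (padGroup x) := fun x v => decide_eq_true_iff
  let code : (Fin (n + 1) → ℤ_[2]) → GN (n + 1) := fun x =>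
    ⟨fun v => decide (v ∈ padGroup x), padGroup x, hcode x, fullRank_padGroup x⟩
  have hcode_meas : Measurable code := by
    refine Measurable.subtype_mk (measurable_pi_iff.2 fun v => measurable_to_bool ?_)
    have : (fun x : Fin (n + 1) → ℤ_[2] => decide (v ∈ padGroup x)) ⁻¹' {true} =
        {x | v ∈ padGroup x} := by
      ext x
      simp
    rw [this]
    exact measurableSet_setOfPred.2 (measFam_padGroup v)
  choose f hf hfull using fun x => (ψ (code x)).2
  refine not_measurable_reduction_padGroup (p := 2) hn (f := f) (fun v => ?_) hfull fun x y => ?_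
  · have : (fun x => v ∈ f x) = fun x => (ψ (code x)).1 v = true :=
      funext fun x => propext (hf x v).symm
    rw [this]
    exact (measurable_of_countable (fun c : Bool => c = true)).comp
      ((measurable_pi_apply v).comp (measurable_subtype_coe.comp (hψ.comp hcode_meas)))
  · rw [← isoN_iff (hcode x) (hcode y), ← isoN_iff (hf x) (hf y)]
    exact hred (code x) (code y)

/-- Thomas' theorem: for every `n ≥ 1`, isomorphism of torsion-free abelian groups of
rank `n` is Borel reducible to isomorphism in rank `n+1`, but not conversely. -/
theorem thomas_rank_hierarchy (n : ℕ) (hn : 1 ≤ n) :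
    (∃ φ : GN n → GN (n + 1), Measurable φ ∧
      ∀ χ χ' : GN n, IsoN n χ χ' ↔ IsoN (n + 1) (φ χ) (φ χ')) ∧
    ¬ ∃ ψ : GN (n + 1) → GN n, Measurable ψ ∧
      ∀ χ χ' : GN (n + 1), IsoN (n + 1) χ χ' ↔ IsoN n (ψ χ) (ψ χ') :=
  ⟨exists_measurable_reduction_succ n, not_exists_measurable_reduction_pred hn⟩
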